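/- Let A and B be C*-algebras. If K is a primitive ideal of the Banach *-algebra A ⊗̂ B, then K = A ⊗̂ F + E ⊗̂ B for some prime closed ideals E of A and F of B. -/

import Mathlib

open scoped TensorProduct
open Pointwise

universe u

noncomputable section

/-- A C⋆-norm on a complex `*`-algebra.  On a matrix algebra over a C⋆-algebra such a
norm is unique, namely the canonical C⋆-norm. -/
structure IsCStarNorm {M : Type*} [NonUnitalRing M] [StarRing M] [Module ℂ M]
    (N : M → ℝ) : Prop where
  add_le : ∀ x y, N (x + y) ≤ N x + N y
  smul_eq : ∀ (c : ℂ) (x : M), N (c • x) = ‖c‖ * N x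
  eq_zero_of : ∀ x, N x = 0 → x = 0
  mul_le : ∀ x y, N (x * y) ≤ N x * N y
  star_mul_self : ∀ x, N (star x * x) = N x * N x

/-- The operator space projective tensor norm `‖·‖_∧` on the algebraic tensor product
`A ⊗ B`, relative to given families of matrix norms on `A` and `B`:
`‖u‖_∧ = inf { ‖α‖ ‖v‖ ‖w‖ ‖β‖ : u = α (v ⊗ w) β }` where `v ∈ M_p(A)`, `w ∈ M_q(B)`,
`α ∈ M_{1,pq}(ℂ)` and `β ∈ M_{pq,1}(ℂ)` (row and column vectors carrying the Euclidean
norm, which is their norm as scalar matrices). -/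
noncomputable def osProjNorm {A B : Type u}
    [AddCommGroup A] [Module ℂ A] [AddCommGroup B] [Module ℂ B]
    (NA : ∀ p : ℕ, Matrix (Fin p) (Fin p) A → ℝ)
    (NB : ∀ q : ℕ, Matrix (Fin q) (Fin q) B → ℝ) (u : A ⊗[ℂ] B) : ℝ :=
  sInf { r : ℝ | ∃ (p q : ℕ) (α : Fin p × Fin q → ℂ) (v : Matrix (Fin p) (Fin p) A)
      (w : Matrix (Fin q) (Fin q) B) (β : Fin p × Fin q → ℂ),
      u = ∑ ik : Fin p × Fin q, ∑ jl : Fin p × Fin q,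
            (α ik * β jl) • (v ik.1 jl.1 ⊗ₜ[ℂ] w ik.2 jl.2) ∧
      r = Real.sqrt (∑ ik, ‖α ik‖ ^ 2) * NA p v * NB q w *
            Real.sqrt (∑ jl, ‖β jl‖ ^ 2) }

/-- `X` is a completion of the algebraic tensor product `A ⊗ B` with respect to the
norm `ν`, via the (necessarily isometric) dense embedding `ι`, and the multiplication and
involution of `X` are the canonical ones induced from `A` and `B`.  Applied with
`ν = osProjNorm NA NB` (for the canonical matrix C⋆-norms `NA`, `NB`) this characterizes
the Banach `*`-algebra `A ⊗̂ B` (the operator space projective tensor product) up to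
isometric `*`-isomorphism; applied with `ν = bsProjNorm` it characterizes the Banach
space projective tensor product `A ⊗_γ B`. -/
structure IsTensorCompletion {A B : Type u} [NonUnitalRing A] [StarRing A] [Module ℂ A]
    [NonUnitalRing B] [StarRing B] [Module ℂ B] (ν : A ⊗[ℂ] B → ℝ)
    (X : Type u) [NonUnitalNormedRing X] [StarRing X] [NormedSpace ℂ X] [CompleteSpace X]
    (ι : A ⊗[ℂ] B →ₗ[ℂ] X) : Prop where
  norm_eq : ∀ u, ‖ι u‖ = ν u
  dense : DenseRange ι
  mul_tmul : ∀ (a c : A) (b d : B),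
    ι (a ⊗ₜ[ℂ] b) * ι (c ⊗ₜ[ℂ] d) = ι ((a * c) ⊗ₜ[ℂ] (b * d))
  star_tmul : ∀ (a : A) (b : B), star (ι (a ⊗ₜ[ℂ] b)) = ι (star a ⊗ₜ[ℂ] star b)

/-- The product ideal `S ⊗̂ T`: the closure in `X` (a completion of `A ⊗ B`) of the span of
elementary tensors `a ⊗ b` with `a ∈ S`, `b ∈ T`. -/
def tensorIdeal {A B : Type u} [NonUnitalRing A] [StarRing A] [Module ℂ A]
    [NonUnitalRing B] [StarRing B] [Module ℂ B]
    {X : Type u} [NonUnitalNormedRing X] [StarRing X] [NormedSpace ℂ X] [CompleteSpace X]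
    (ι : A ⊗[ℂ] B →ₗ[ℂ] X) (S : Set A) (T : Set B) : Set X :=
  closure (ι '' (Submodule.span ℂ (Set.image2 (fun a b => a ⊗ₜ[ℂ] b) S T)))

/-- A closed prime (two-sided) ideal of a Banach algebra: a proper closed two-sided ideal `K`
such that whenever the product of two closed two-sided ideals is contained in `K`, one of them
is contained in `K`. -/
def IsClosedPrimeIdeal {Y : Type u} [NonUnitalNormedRing Y] (K : TwoSidedIdeal Y) : Prop :=
  IsClosed (K : Set Y) ∧ (K : Set Y) ≠ Set.univ ∧
    ∀ I J : TwoSidedIdeal Y, IsClosed (I : Set Y) → IsClosed (J : Set Y) →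
      (∀ x ∈ I, ∀ y ∈ J, x * y ∈ K) → (I : Set Y) ⊆ (K : Set Y) ∨ (J : Set Y) ⊆ (K : Set Y)

/-- An irreducible continuous `*`-representation of a Banach `*`-algebra `Y` on a complex
Hilbert space. -/
structure IrreducibleRepOn (Y : Type u)
    [NonUnitalNormedRing Y] [StarRing Y] [NormedSpace ℂ Y] where
  H : Type u
  [normH : NormedAddCommGroup H]
  [ipsH : InnerProductSpace ℂ H]
  [csH : CompleteSpace H]
  π : Y →⋆ₙₐ[ℂ] (H →L[ℂ] H)
  continuous : Continuous π
  nonzero : ∃ y, π y ≠ 0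
  irreducible : ∀ S : Submodule ℂ H, IsClosed (S : Set H) →
    (∀ y : Y, ∀ v ∈ S, π y v ∈ S) → S = ⊥ ∨ S = ⊤

/-- A primitive ideal: the kernel of an irreducible `*`-representation. -/
def IsPrimitiveIdeal {Y : Type u} [NonUnitalNormedRing Y] [StarRing Y] [NormedSpace ℂ Y]
    (K : TwoSidedIdeal Y) : Prop :=
  ∃ ρ : IrreducibleRepOn Y, ∀ y, y ∈ K ↔ ρ.π y = 0

/-- A subset `K` of a ring is modular (as an ideal) if there is a relative unit `e`
with `x * e - x ∈ K` and `e * x - x ∈ K` for every `x`. -/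
def IsModularIdealSet {Y : Type u} [NonUnitalRing Y] (K : Set Y) : Prop :=
  ∃ e : Y, ∀ x : Y, x * e - x ∈ K ∧ e * x - x ∈ K

/-- A maximal modular (two-sided) ideal: a modular ideal which is proper and maximal among
proper two-sided ideals. -/
def IsMaximalModularIdeal {Y : Type u} [NonUnitalRing Y] (K : TwoSidedIdeal Y) : Prop :=
  IsModularIdealSet (K : Set Y) ∧ (K : Set Y) ≠ Set.univ ∧
    ∀ L : TwoSidedIdeal Y, (K : Set Y) ⊆ (L : Set Y) →
      (L : Set Y) = (K : Set Y) ∨ (L : Set Y) = Set.univ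

/-- The operator norm of a `p × p` matrix of bounded operators on a Hilbert space `H`,
viewed as an operator on the `ℓ²`-direct sum `H ⊕ ⋯ ⊕ H`. -/
noncomputable def opMatrixNorm {H : Type u} [NormedAddCommGroup H] [InnerProductSpace ℂ H]
    {p : ℕ} (T : Matrix (Fin p) (Fin p) (H →L[ℂ] H)) : ℝ :=
  sSup { r : ℝ | ∃ x : Fin p → H, (∑ i, ‖x i‖ ^ 2) ≤ 1 ∧
      r = Real.sqrt (∑ i, ‖∑ j, (T i j) (x j)‖ ^ 2) }

/-- An operator algebra structure on a Banach algebra `Y`: a bicontinuous algebra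
homomorphism of `Y` into the bounded operators on some Hilbert space. -/
structure OperatorAlgebraEmbedding (Y : Type u) [NonUnitalNormedRing Y] [NormedSpace ℂ Y] where
  H : Type u
  [normH : NormedAddCommGroup H]
  [ipsH : InnerProductSpace ℂ H]
  [csH : CompleteSpace H]
  ρ : Y →ₙₐ[ℂ] (H →L[ℂ] H)
  c : ℝ
  C : ℝ
  c_pos : 0 < c
  lower : ∀ y, c * ‖y‖ ≤ ‖ρ y‖
  upper : ∀ y, ‖ρ y‖ ≤ C * ‖y‖

/-- The matrix norms on `Y` induced by an operator algebra embedding, giving `Y` its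
operator space structure: the norm of `v ∈ M_p(Y)` is the operator norm of the matrix
of operators obtained by applying the embedding entrywise. -/
noncomputable def OperatorAlgebraEmbedding.matrixNorm {Y : Type u}
    [NonUnitalNormedRing Y] [NormedSpace ℂ Y] (e : OperatorAlgebraEmbedding Y)
    (p : ℕ) (v : Matrix (Fin p) (Fin p) Y) : ℝ :=
  letI := e.normH; letI := e.ipsH
  opMatrixNorm (v.map e.ρ)

/-- The Banach space projective tensor norm `‖·‖_γ` on the algebraic tensor product. -/
noncomputable def bsProjNorm {A B : Type u} [NonUnitalNormedRing A] [NormedSpace ℂ A]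
    [NonUnitalNormedRing B] [NormedSpace ℂ B] (u : A ⊗[ℂ] B) : ℝ :=
  sInf { r : ℝ | ∃ (n : ℕ) (a : Fin n → A) (b : Fin n → B),
      u = ∑ i, a i ⊗ₜ[ℂ] b i ∧ r = ∑ i, ‖a i‖ * ‖b i‖ }

/-- A C⋆-algebra `A` is subhomogeneous if there is `n : ℕ` bounding the (finite)
dimensions of all its irreducible `*`-representations. -/
def IsSubhomogeneous (A : Type u) [NonUnitalCStarAlgebra A] : Prop :=
  ∃ n : ℕ, ∀ ρ : IrreducibleRepOn A,
    letI := ρ.normH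
    letI := ρ.ipsH
    FiniteDimensional ℂ ρ.H ∧ Module.finrank ℂ ρ.H ≤ n


set_option linter.all false

section Part1
namespace PIS

section Basic
variable {M : Type*} [NonUnitalCStarAlgebra M]

/-- row square norm -/
def rsq {ι : Type*} [Fintype ι] (X : ι → M) : ℝ := ‖∑ i, X i * star (X i)‖
/-- column square norm -/
def csq {ι : Type*} [Fintype ι] (X : ι → M) : ℝ := ‖∑ i, star (X i) * X i‖

variable {ι κ : Type*} [Fintype ι] [Fintype κ]

lemma rsq_nonneg (X : ι → M) : 0 ≤ rsq X := norm_nonneg _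
lemma csq_nonneg (X : ι → M) : 0 ≤ csq X := norm_nonneg _
lemma csq_star (X : ι → M) : csq (fun i => star (X i)) = rsq X := by simp [rsq, csq]
lemma rsq_star (X : ι → M) : rsq (fun i => star (X i)) = csq X := by simp [rsq, csq]

section order
variable [PartialOrder M] [StarOrderedRing M]

lemma row_le_of_le {S T : M} (h0 : 0 ≤ S) (h : S ≤ T) : ‖S‖ ≤ ‖T‖ :=
  CStarAlgebra.norm_le_norm_of_nonneg_of_le h0 h

lemma conj_le_norm_smul (x b : M) (hb : IsSelfAdjoint b) :
    x * b * star x ≤ ‖b‖ • (x * star x) := by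
  have := CStarAlgebra.star_left_conjugate_le_norm_smul (a := star x) (b := b) hb
  simpa using this

lemma sum_mul_star_nonneg (X : ι → M) : 0 ≤ ∑ i, X i * star (X i) :=
  Finset.sum_nonneg fun i _ => mul_star_self_nonneg _

lemma cs_le (a b : κ → M) :
    (∑ j, a j * b j) * star (∑ j, a j * b j) ≤
      ‖∑ j, star (b j) * b j‖ • ∑ j, a j * star (a j) := by
  set S := ∑ j, a j * b j with hS
  set D := ∑ j, star (b j) * b j with hD
  set β := ‖D‖ with hβ
  have hDn : 0 ≤ D := Finset.sum_nonneg fun i _ => star_mul_self_nonneg _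
  have h1 : 0 ≤ ∑ j, (β • a j - S * star (b j)) * star (β • a j - S * star (b j)) :=
    sum_mul_star_nonneg _
  have h2 : ∑ j, (β • a j - S * star (b j)) * star (β • a j - S * star (b j)) =
      β • (β • ∑ j, a j * star (a j)) - β • (S * star S) - β • (S * star S) + S * D * star S := by
    have e1 : S * star S = ∑ j, a j * b j * star S := by rw [hS, Finset.sum_mul]
    have e2 : S * star S = ∑ j, S * (star (b j) * star (a j)) := by
      conv_lhs => rw [hS, star_sum, ← hS, Finset.mul_sum]
      simp
    have e3 : S * D * star S = ∑ j, S * (star (b j) * b j) * star S := by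
      rw [hD, Finset.mul_sum, Finset.sum_mul]
    rw [e3]
    conv_rhs => 
      enter [1, 2]
      rw [e2]
    conv_rhs => 
      enter [1, 1, 2]
      rw [e1]
    simp only [Finset.smul_sum, ← Finset.sum_sub_distrib, ← Finset.sum_add_distrib]
    refine Finset.sum_congr rfl fun j _ => ?_
    simp only [star_sub, star_smul, star_mul, star_star, sub_mul, mul_sub, smul_mul_assoc,
      mul_smul_comm, mul_assoc, star_trivial, smul_sub]
    abel
  have h3 : S * D * star S ≤ β • (S * star S) := conj_le_norm_smul S D hDn.isSelfAdjoint
  have h4 : β • (S * star S) ≤ β • (β • ∑ j, a j * star (a j)) := by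
    rw [h2] at h1
    have := add_le_add_right h3 (β • (β • ∑ j, a j * star (a j)) - β • (S * star S) - β • (S * star S))
    have h5 := h1.trans this
    have h6 : (0:M) ≤ β • (β • ∑ j, a j * star (a j)) - β • (S * star S) := by
      convert h5 using 1; abel
    exact sub_nonneg.mp h6
  rcases (norm_nonneg D).eq_or_lt with h0 | h0
  · have hD0 : D = 0 := norm_eq_zero.mp h0.symm
    have hb : ∀ j, b j = 0 := by
      intro j
      have h7 := (Finset.sum_eq_zero_iff_of_nonneg
        (fun i _ => star_mul_self_nonneg (b i))).mp (hD.symm.trans hD0) j (Finset.mem_univ j)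
      exact CStarRing.star_mul_self_eq_zero_iff _ |>.mp h7
    have : S = 0 := by simp [hS, hb]
    rw [hβ, ← h0, this]; simp
  · have h8 := smul_le_smul_of_nonneg_left h4 (inv_nonneg.mpr h0.le)
    rw [smul_smul, smul_smul, ← hβ, inv_mul_cancel₀ (by rw [hβ]; exact h0.ne'), one_smul, one_smul] at h8
    exact h8

end order

lemma rsq_conj (a b : M) (X : ι → M) :
    rsq (fun i => a * X i * b) ≤ ‖a‖ ^ 2 * ‖b‖ ^ 2 * rsq X := by
  letI := CStarAlgebra.spectralOrder M
  letI := CStarAlgebra.spectralOrderedRing M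
  have h1 : ∑ i, (a * X i * b) * star (a * X i * b) =
      a * (∑ i, X i * (b * star b) * star (X i)) * star a := by
    rw [Finset.mul_sum, Finset.sum_mul]
    refine Finset.sum_congr rfl fun j _ => ?_
    simp [mul_assoc]
  have h2 : ∑ i, X i * (b * star b) * star (X i) ≤ ‖b * star b‖ • ∑ i, X i * star (X i) := by
    rw [Finset.smul_sum]
    exact Finset.sum_le_sum fun i _ => conj_le_norm_smul _ _ (IsSelfAdjoint.mul_star_self b)
  have h0 : 0 ≤ ∑ i, X i * (b * star b) * star (X i) :=
    Finset.sum_nonneg fun i _ => star_right_conjugate_nonneg (mul_star_self_nonneg b) _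
  have h3 := row_le_of_le h0 h2
  rw [norm_smul, norm_norm, CStarRing.norm_self_mul_star] at h3
  unfold rsq
  rw [h1]
  calc _ ≤ ‖a‖ * ‖∑ i, X i * (b * star b) * star (X i)‖ * ‖star a‖ :=
        (norm_mul_le _ _).trans (by gcongr; exact norm_mul_le _ _)
    _ ≤ ‖a‖ * (‖b‖ * ‖b‖ * ‖∑ i, X i * star (X i)‖) * ‖a‖ := by rw [norm_star]; gcongr
    _ = _ := by ring

lemma csq_conj (a b : M) (X : ι → M) :
    csq (fun i => a * X i * b) ≤ ‖a‖ ^ 2 * ‖b‖ ^ 2 * csq X := by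
  rw [← rsq_star, ← rsq_star]
  have := rsq_conj (star b) (star a) (fun i => star (X i))
  simp only [star_mul, norm_star, ← mul_assoc] at this ⊢
  linarith

lemma rsq_sandwich (s : κ → M) (hs : ∀ j, star (s j) = s j) (Z : ι → M) :
    rsq (fun i => ∑ j, s j * Z i * s j) ≤ ‖∑ j, s j * s j‖ ^ 2 * rsq Z := by
  letI := CStarAlgebra.spectralOrder M
  letI := CStarAlgebra.spectralOrderedRing M
  set k := ‖∑ j, s j * s j‖ with hk
  have h1 : ∀ i, (∑ j, s j * Z i * s j) * star (∑ j, s j * Z i * s j) ≤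
      k • ∑ j, s j * (Z i * star (Z i)) * s j := by
    intro i
    have := cs_le (fun j => s j * Z i) s
    simpa [hs, ← mul_assoc] using this
  have h2 : ∑ i, (∑ j, s j * Z i * s j) * star (∑ j, s j * Z i * s j) ≤
      (k * rsq Z) • ∑ j, s j * s j := by
    calc _ ≤ ∑ i, k • ∑ j, s j * (Z i * star (Z i)) * s j := Finset.sum_le_sum fun i _ => h1 i
      _ = k • ∑ j, s j * (∑ i, Z i * star (Z i)) * star (s j) := by
        rw [← Finset.smul_sum, Finset.sum_comm]
        congr 1
        refine Finset.sum_congr rfl fun j _ => ?_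
        rw [Finset.mul_sum, Finset.sum_mul, hs]
      _ ≤ k • ∑ j, rsq Z • (s j * star (s j)) := by
        refine smul_le_smul_of_nonneg_left ?_ (norm_nonneg _)
        refine Finset.sum_le_sum fun j _ => ?_
        exact conj_le_norm_smul _ _ (sum_mul_star_nonneg Z).isSelfAdjoint
      _ = _ := by simp only [hs]; rw [← Finset.smul_sum, smul_smul]
  have := row_le_of_le (sum_mul_star_nonneg _) h2
  rw [norm_smul, Real.norm_of_nonneg (by positivity [rsq_nonneg Z])] at this
  unfold rsq at *
  rw [← hk] at this
  linarith

lemma csq_sandwich (s : κ → M) (hs : ∀ j, star (s j) = s j) (Z : ι → M) :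
    csq (fun i => ∑ j, s j * Z i * s j) ≤ ‖∑ j, s j * s j‖ ^ 2 * csq Z := by
  rw [← rsq_star, ← rsq_star]
  have := rsq_sandwich s hs (fun i => star (Z i))
  simpa [hs, ← mul_assoc] using this

lemma norm_le_of_rsq {X : ι → M} (h : rsq X ≤ 1) (i : ι) : ‖X i‖ ≤ 1 := by
  letI := CStarAlgebra.spectralOrder M
  letI := CStarAlgebra.spectralOrderedRing M
  have h1 : X i * star (X i) ≤ ∑ i, X i * star (X i) :=
    Finset.single_le_sum (f := fun i => X i * star (X i))
      (fun j _ => mul_star_self_nonneg (X j)) (Finset.mem_univ i)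
  have := (row_le_of_le (mul_star_self_nonneg _) h1).trans h
  rw [CStarRing.norm_self_mul_star] at this
  nlinarith [norm_nonneg (X i)]

/-- admissible with square radius -/
def Adm (r : ℝ) (X : ι → M) : Prop := rsq X ≤ r ∧ csq X ≤ r

lemma Adm.conj {r : ℝ} {X : ι → M} (h : Adm r X) (a b : M) {k l : ℝ} (ha : ‖a‖ ≤ k) (hb : ‖b‖ ≤ l) :
    Adm (k ^ 2 * l ^ 2 * r) (fun i => a * X i * b) := by
  have h0 : 0 ≤ r := (rsq_nonneg X).trans h.1
  constructor
  · refine (rsq_conj a b X).trans ?_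
    have := rsq_nonneg X
    have := h.1
    gcongr
  · refine (csq_conj a b X).trans ?_
    have := csq_nonneg X
    have := h.2
    gcongr

lemma Adm.sandwich {r : ℝ} {X : ι → M} (h : Adm r X) (s : κ → M) (hs : ∀ j, star (s j) = s j)
    {k : ℝ} (hk : ‖∑ j, s j * s j‖ ≤ k) :
    Adm (k ^ 2 * r) (fun i => ∑ j, s j * X i * s j) := by
  have h0 : 0 ≤ r := (rsq_nonneg X).trans h.1
  constructor
  · refine (rsq_sandwich s hs X).trans ?_
    have := rsq_nonneg X
    have := h.1
    gcongr
  · refine (csq_sandwich s hs X).trans ?_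
    have := csq_nonneg X
    have := h.2
    gcongr

lemma Adm.smul {r : ℝ} {X : ι → M} (h : Adm r X) (c : ℂ) : Adm (‖c‖ ^ 2 * r) (fun i => c • X i) := by
  have h0 : 0 ≤ r := (rsq_nonneg X).trans h.1
  have e1 : rsq (fun i => c • X i) = ‖c‖ ^ 2 * rsq X := by
    unfold rsq
    simp only [star_smul, smul_mul_smul_comm, ← Finset.smul_sum, norm_smul, norm_mul, norm_star]
    ring
  have e2 : csq (fun i => c • X i) = ‖c‖ ^ 2 * csq X := by
    unfold csq
    simp only [star_smul, smul_mul_smul_comm, ← Finset.smul_sum, norm_smul, norm_mul, norm_star]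
    ring
  refine ⟨?_, ?_⟩
  · rw [e1]; have := h.1; gcongr
  · rw [e2]; have := h.2; gcongr

end Basic
end PIS
end Part1

section Part2
namespace PIS

section GT
variable {M N : Type*} [CStarAlgebra M] [CStarAlgebra N]

/-- c, d, s with c = 1 - d = cos, s = sin -/
structure Trig (s d : M) : Prop where
  ss : star s = s
  sd : star d = d
  comm : d * s = s * d
  sq : (1 - d) * (1 - d) + s * s = 1
  dle : ‖d‖ ≤ ‖s * s‖

lemma exists_trig [PartialOrder M] [StarOrderedRing M] (s : M) (hs : star s = s) (h : ‖s‖ ≤ 1) :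
    ∃ d : M, Trig s d ∧ 0 ≤ d ∧ d ≤ s * s := by
  have hsa : IsSelfAdjoint s := hs
  have hb : ∀ x ∈ spectrum ℝ s, |x| ≤ 1 := fun x hx => by
    rcases subsingleton_or_nontrivial M with hM | hM
    · simp [spectrum.of_subsingleton] at hx
    · exact (spectrum.norm_le_norm_of_mem hx).trans h
  have hb2 : ∀ x ∈ spectrum ℝ s, x ^ 2 ≤ 1 := fun x hx => by
    have := hb x hx
    rw [← sq_abs]; nlinarith [abs_nonneg x]
  set d := cfc (fun x : ℝ => 1 - Real.sqrt (1 - x ^ 2)) s with hd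
  have hc : ContinuousOn (fun x : ℝ => 1 - Real.sqrt (1 - x ^ 2)) (spectrum ℝ s) := by fun_prop
  have hs2 : s * s = cfc (fun x : ℝ => x ^ 2) s := by
    rw [cfc_pow_id (R := ℝ) s 2, sq]
  have h0 : 0 ≤ d := by
    apply cfc_nonneg
    intro x hx
    have : Real.sqrt (1 - x ^ 2) ≤ 1 := Real.sqrt_le_iff.mpr ⟨by norm_num, by nlinarith [sq_nonneg x]⟩
    linarith
  have h1 : d ≤ s * s := by
    rw [hs2]
    apply cfc_mono _ hc (by fun_prop)
    intro x hx
    have := hb2 x hx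
    have h3 : 0 ≤ Real.sqrt (1 - x ^ 2) := Real.sqrt_nonneg _
    have h4 : Real.sqrt (1 - x ^ 2) ^ 2 = 1 - x ^ 2 := Real.sq_sqrt (by linarith)
    have : Real.sqrt (1 - x ^ 2) ≤ 1 := Real.sqrt_le_iff.mpr ⟨by norm_num, by nlinarith [sq_nonneg x]⟩
    nlinarith
  refine ⟨d, ⟨hs, h0.isSelfAdjoint, ?_, ?_, row_le_of_le h0 h1⟩, h0, h1⟩
  · have := (cfc_commute_cfc (fun x : ℝ => 1 - Real.sqrt (1 - x ^ 2)) (fun x => x) s).eq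
    rwa [cfc_id' ℝ s] at this
  · have e : (1 : M) - d = cfc (fun x : ℝ => Real.sqrt (1 - x ^ 2)) s := by
      rw [hd, ← cfc_one ℝ s, ← cfc_sub _ _ s]
      simp
    rw [e, hs2, ← cfc_mul _ _ s, ← cfc_add s _ _, ← cfc_one ℝ s]
    apply cfc_congr
    intro x hx
    have := hb2 x hx
    simp only [Pi.one_apply]
    rw [Real.mul_self_sqrt (by linarith)]; ring

lemma trig_unitary {u s d : M} (h : Trig s d) (hu : star u * u = 1) (hu' : u * star u = 1) (e : ℂ)
    (he : e = Complex.I ∨ e = - Complex.I) :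
    star (u * (1 - d + e • s)) * (u * (1 - d + e • s)) = 1 ∧
    (u * (1 - d + e • s)) * star (u * (1 - d + e • s)) = 1 ∧
    star (u * (1 - d + e • s)) = (1 - d - e • s) * star u := by
  have hee : e * e = -1 := by rcases he with rfl | rfl <;> simp
  have hse : star e = - e := by rcases he with rfl | rfl <;> simp
  have h3 : star (u * (1 - d + e • s)) = (1 - d - e • s) * star u := by
    simp [star_mul, h.ss, h.sd, hse, sub_eq_add_neg]
  have key1 : (1 - d - e • s) * (1 - d + e • s) = 1 := by
    have : (1 - d - e • s) * (1 - d + e • s) =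
      (1 - d) * (1 - d) - (e * e) • (s * s) + e • (s * d - d * s) := by
      simp only [mul_add, mul_sub, sub_mul, add_mul, smul_mul_assoc, mul_smul_comm, smul_smul, 
        one_mul, mul_one, smul_sub, smul_add]
      abel
    rw [this, hee, h.comm, sub_self, smul_zero, add_zero, neg_smul, one_smul, sub_neg_eq_add, h.sq]
  have key2 : (1 - d + e • s) * (1 - d - e • s) = 1 := by
    have : (1 - d + e • s) * (1 - d - e • s) =
      (1 - d) * (1 - d) - (e * e) • (s * s) - e • (s * d - d * s) := by
      simp only [mul_add, mul_sub, sub_mul, add_mul, smul_mul_assoc, mul_smul_comm, smul_smul, 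
        one_mul, mul_one, smul_sub, smul_add]
      abel
    rw [this, hee, h.comm, sub_self, smul_zero, sub_zero, neg_smul, one_smul, sub_neg_eq_add, h.sq]
  refine ⟨?_, ?_, h3⟩
  · rw [h3]
    calc _ = (1 - d - e • s) * (star u * u) * (1 - d + e • s) := by noncomm_ring
      _ = 1 := by rw [hu, mul_one, key1]
  · rw [h3]
    calc _ = u * ((1 - d + e • s) * (1 - d - e • s)) * star u := by noncomm_ring
      _ = 1 := by rw [key2, mul_one, hu']

def FF {ι : Type*} [Fintype ι] (Φ : M →ₗ[ℂ] N →ₗ[ℂ] ℂ) (X : ι → M) (Y : ι → N) : ℝ :=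
  ∑ i, (Φ (X i) (Y i)).re

def GG {ι : Type*} [Fintype ι] (Φ : M →ₗ[ℂ] N →ₗ[ℂ] ℂ) (X : ι → M) (Y : ι → N) (m : ℝ)
   (u : M) (v : N) : ℝ :=
  (Φ u v).re + m * (FF Φ (fun i => star u * X i * star u) Y + FF Φ X (fun i => v * Y i * v))

/-- error family -/
def er (s d z : M) : M := d * z + z * d - d * z * d + s * z * s

variable {ι : Type*} [Fintype ι]

lemma FF_add_left (Φ : M →ₗ[ℂ] N →ₗ[ℂ] ℂ) (X X' : ι → M) (Y : ι → N) :
    FF Φ (fun i => X i + X' i) Y = FF Φ X Y + FF Φ X' Y := by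
  simp [FF, Finset.sum_add_distrib]
lemma FF_sub_left (Φ : M →ₗ[ℂ] N →ₗ[ℂ] ℂ) (X X' : ι → M) (Y : ι → N) :
    FF Φ (fun i => X i - X' i) Y = FF Φ X Y - FF Φ X' Y := by
  simp [FF, Finset.sum_sub_distrib]
lemma FF_add_right (Φ : M →ₗ[ℂ] N →ₗ[ℂ] ℂ) (X : ι → M) (Y Y' : ι → N) :
    FF Φ X (fun i => Y i + Y' i) = FF Φ X Y + FF Φ X Y' := by
  simp [FF, Finset.sum_add_distrib]
lemma FF_sub_right (Φ : M →ₗ[ℂ] N →ₗ[ℂ] ℂ) (X : ι → M) (Y Y' : ι → N) :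
    FF Φ X (fun i => Y i - Y' i) = FF Φ X Y - FF Φ X Y' := by
  simp [FF, Finset.sum_sub_distrib]
lemma FF_sum_left {κ : Type*} [Fintype κ] (Φ : M →ₗ[ℂ] N →ₗ[ℂ] ℂ) (X : κ → ι → M) (Y : ι → N) :
    FF Φ (fun i => ∑ k, X k i) Y = ∑ k, FF Φ (X k) Y := by
  simp only [FF, map_sum, LinearMap.sum_apply, Complex.re_sum]
  exact Finset.sum_comm
lemma FF_sum_right {κ : Type*} [Fintype κ] (Φ : M →ₗ[ℂ] N →ₗ[ℂ] ℂ) (X : ι → M) (Y : κ → ι → N) :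
    FF Φ X (fun i => ∑ k, Y k i) = ∑ k, FF Φ X (Y k) := by
  simp only [FF, map_sum, LinearMap.sum_apply, Complex.re_sum]
  exact Finset.sum_comm

lemma pert (Φ : M →ₗ[ℂ] N →ₗ[ℂ] ℂ) (X : ι → M) (Y : ι → N) (m δ : ℝ) {u s d : M} {v s' d' : N}
    (hu : star u * u = 1) (hu' : u * star u = 1) (hv : star v * v = 1) (hv' : v * star v = 1)
    (hs : Trig s d) (hs' : Trig s' d')
    (hmax : ∀ u' v', star u' * u' = 1 → u' * star u' = 1 → star v' * v' = 1 → v' * star v' = 1 →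
      GG Φ X Y m u' v' ≤ GG Φ X Y m u v + δ) :
    - (Φ (u * s) (v * s')).re ≤ (Φ (u * d) v).re + (Φ u (v * d')).re - (Φ (u * d) (v * d')).re
      + m * (FF Φ (fun i => er s d (star u * X i) * star u) Y
        + FF Φ X (fun i => v * er s' d' (Y i * v))) + δ := by
  obtain ⟨a1, a2, a3⟩ := trig_unitary hs hu hu' Complex.I (Or.inl rfl)
  obtain ⟨b1, b2, b3⟩ := trig_unitary hs hu hu' (-Complex.I) (Or.inr rfl)
  obtain ⟨c1, c2, c3⟩ := trig_unitary hs' hv hv' Complex.I (Or.inl rfl)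
  obtain ⟨d1, d2, d3⟩ := trig_unitary hs' hv hv' (-Complex.I) (Or.inr rfl)
  have h1 := hmax _ _ a1 a2 c1 c2
  have h2 := hmax _ _ b1 b2 d1 d2
  unfold GG at h1 h2
  rw [a3] at h1
  rw [b3] at h2
  have e1 : (Φ (u * (1 - d + Complex.I • s)) (v * (1 - d' + Complex.I • s'))).re +
     (Φ (u * (1 - d + (-Complex.I) • s)) (v * (1 - d' + (-Complex.I) • s'))).re =
     2 * (Φ u v).re - 2 * (Φ (u * d) v).re - 2 * (Φ u (v * d')).re + 2 * (Φ (u * d) (v * d')).re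
      - 2 * (Φ (u * s) (v * s')).re := by
    simp [mul_add, mul_sub]
    ring
  have e2 : FF Φ (fun i => (1 - d - Complex.I • s) * star u * X i * ((1 - d - Complex.I • s) * star u)) Y
     + FF Φ (fun i => (1 - d - (-Complex.I) • s) * star u * X i * ((1 - d - (-Complex.I) • s) * star u)) Y
     = 2 * FF Φ (fun i => star u * X i * star u) Y
       - 2 * FF Φ (fun i => er s d (star u * X i) * star u) Y := by
    rw [← FF_add_left, two_mul, two_mul, ← FF_add_left, ← FF_add_left, ← FF_sub_left]
    congr 1
    funext i
    unfold er
    have : ∀ z w : M, (1 - d - Complex.I • s) * z * ((1 - d - Complex.I • s) * w) +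
       (1 - d - (-Complex.I) • s) * z * ((1 - d - (-Complex.I) • s) * w) =
       z * w + z * w - ((d * z + z * d - d * z * d + s * z * s) * w 
        + (d * z + z * d - d * z * d + s * z * s) * w) := by
      intro z w
      simp only [mul_add, mul_sub, sub_mul, add_mul, smul_mul_assoc, mul_smul_comm, smul_smul, 
        one_mul, mul_one, smul_sub, neg_smul, sub_neg_eq_add, mul_assoc, smul_neg, smul_add, Complex.I_mul_I]
      simp only [← mul_assoc, one_smul]
      abel
    have h := this (star u * X i) (star u)
    simp only [← mul_assoc] at h ⊢
    exact h
  have e3 : FF Φ X (fun i => v * (1 - d' + Complex.I • s') * Y i * (v * (1 - d' + Complex.I • s')))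
     + FF Φ X (fun i => v * (1 - d' + (-Complex.I) • s') * Y i * (v * (1 - d' + (-Complex.I) • s')))
     = 2 * FF Φ X (fun i => v * Y i * v)
       - 2 * FF Φ X (fun i => v * er s' d' (Y i * v)) := by
    rw [← FF_add_right, two_mul, two_mul, ← FF_add_right, ← FF_add_right, ← FF_sub_right]
    congr 1
    funext i
    unfold er
    have : ∀ z w : N, w * (1 - d' + Complex.I • s') * z * (1 - d' + Complex.I • s') +
       w * (1 - d' + (-Complex.I) • s') * z * (1 - d' + (-Complex.I) • s') =
       w * z + w * z - (w * (d' * z + z * d' - d' * z * d' + s' * z * s')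
        + w * (d' * z + z * d' - d' * z * d' + s' * z * s')) := by
      intro z w
      simp only [mul_add, mul_sub, sub_mul, add_mul, smul_mul_assoc, mul_smul_comm, smul_smul, 
        one_mul, mul_one, smul_sub, neg_smul, sub_neg_eq_add, mul_assoc, smul_neg, smul_add, Complex.I_mul_I, mul_neg, neg_mul]
      simp only [← mul_assoc, one_smul]
      abel
    have h := this (Y i * v) v
    simp only [← mul_assoc] at h ⊢
    exact h
  have h3 := add_le_add h1 h2
  have key : m * (FF Φ (fun i => (1 - d - Complex.I • s) * star u * X i * ((1 - d - Complex.I • s) * star u)) Y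
    + FF Φ (fun i => (1 - d - (-Complex.I) • s) * star u * X i * ((1 - d - (-Complex.I) • s) * star u)) Y
    + (FF Φ X (fun i => v * (1 - d' + Complex.I • s') * Y i * (v * (1 - d' + Complex.I • s')))
     + FF Φ X (fun i => v * (1 - d' + (-Complex.I) • s') * Y i * (v * (1 - d' + (-Complex.I) • s'))))) =
     m * (2 * FF Φ (fun i => star u * X i * star u) Y
       - 2 * FF Φ (fun i => er s d (star u * X i) * star u) Y + (2 * FF Φ X (fun i => v * Y i * v)
       - 2 * FF Φ X (fun i => v * er s' d' (Y i * v)))) := by rw [e2, e3]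
  linarith

end GT
end PIS
end Part2

section Part3
namespace PIS

section GT2
variable {M N : Type*} [CStarAlgebra M] [CStarAlgebra N]
variable {ι κ : Type*} [Fintype ι] [Fintype κ]

lemma norm_one_le : ‖(1 : M)‖ ≤ 1 := by
  have h := CStarRing.norm_star_mul_self (x := (1 : M))
  simp only [star_one, mul_one] at h
  nlinarith [norm_nonneg (1 : M), sq_nonneg (‖(1:M)‖ - 1)]

lemma norm_unit_le {u : M} (hu : star u * u = 1) : ‖u‖ ≤ 1 := by
  have h := CStarRing.norm_star_mul_self (x := u)
  rw [hu] at h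
  have := norm_one_le (M := M)
  nlinarith [norm_nonneg u]

lemma Adm.mono {r r' : ℝ} {X : ι → M} (h : Adm r X) (hr : r ≤ r') : Adm r' X :=
  ⟨h.1.trans hr, h.2.trans hr⟩

lemma er_bound (L : (ι → M) →+ ℝ) (T : ℝ) (hT : 0 ≤ T)
    (hL : ∀ r : ℝ, 0 < r → ∀ X, Adm (r ^ 2) X → |L X| ≤ T * r) (Z : ι → M) (hZ : Adm 1 Z)
    (s d : κ → M) (hs : ∀ k, Trig (s k) (d k)) (k0 η : ℝ) (hk0 : 0 < k0) (hη : 0 < η)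
    (hd : ‖∑ k, d k‖ ≤ k0) (hss : ‖∑ k, s k * s k‖ ≤ k0) (hdη : ∀ k, ‖d k‖ ≤ η) :
    L (fun i => ∑ k, er (s k) (d k) (Z i)) ≤ T * (3 * k0 + Fintype.card κ * η ^ 2) := by
  have e : (fun i => ∑ k, er (s k) (d k) (Z i)) =
      (fun i => (∑ k, d k) * Z i * 1) + (fun i => 1 * Z i * (∑ k, d k))
       - ∑ k, (fun i => d k * Z i * d k) + (fun i => ∑ k, s k * Z i * s k) := by
    funext i
    simp only [er, Pi.add_apply, Pi.sub_apply, Finset.sum_apply, Finset.sum_add_distrib,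
      Finset.sum_sub_distrib, Finset.sum_mul, Finset.mul_sum, mul_one, one_mul]
  rw [e, map_add, map_sub, map_add, map_sum]
  have h1 := hL k0 hk0 _ (((hZ.conj (∑ k, d k) 1 hd norm_one_le)).mono (by simp))
  have h2 := hL k0 hk0 _ (((hZ.conj 1 (∑ k, d k) norm_one_le hd)).mono (by simp))
  have h3 := hL k0 hk0 _ ((hZ.sandwich s (fun j => (hs j).ss) hss).mono (by simp))
  have h4 : ∀ k, |L (fun i => d k * Z i * d k)| ≤ T * η ^ 2 := fun k =>
    hL (η ^ 2) (by positivity) _ ((hZ.conj (d k) (d k) (hdη k) (hdη k)).mono (by ring_nf; rfl))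
  have h5 : - ∑ k, L (fun i => d k * Z i * d k) ≤ Fintype.card κ * (T * η ^ 2) := by
    rw [← Finset.sum_neg_distrib]
    refine (Finset.sum_le_card_nsmul _ _ (T * η ^ 2) fun k _ => ?_).trans (by simp)
    exact (neg_le_abs _).trans (h4 k)
  have := le_abs_self (L fun i => (∑ k, d k) * Z i * 1)
  have := le_abs_self (L fun i => 1 * Z i * (∑ k, d k))
  have := le_abs_self (L fun i => ∑ k, s k * Z i * s k)
  nlinarith

/-- perturbation direction -/
def dir (t : ℝ) (ζ : ℂ) (z : M) : M := (t : ℂ) • (ζ • z + star ζ • star z)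

lemma dir_star (t : ℝ) (ζ : ℂ) (z : M) : star (dir t ζ z) = dir t ζ z := by
  simp [dir, add_comm]

lemma dir_norm {t : ℝ} (ht : 0 ≤ t) {ζ : ℂ} (hζ : ‖ζ‖ = 1) {z : M} (hz : ‖z‖ ≤ 1) :
    ‖dir t ζ z‖ ≤ 2 * t := by
  unfold dir
  rw [norm_smul, Complex.norm_real, Real.norm_of_nonneg ht]
  have : ‖ζ • z + star ζ • star z‖ ≤ 2 := by
    refine (norm_add_le _ _).trans ?_
    rw [norm_smul, norm_smul, norm_star, norm_star, hζ]; linarith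
  nlinarith

lemma dir_sq (t : ℝ) (z : M) {ζ : ℂ} (hζ : ζ * ζ = -1) (h1 : star ζ = - ζ) :
    dir t ζ z * dir t ζ z + dir t 1 z * dir t 1 z =
      (2 * t ^ 2 : ℂ) • (z * star z) + (2 * t ^ 2 : ℂ) • (star z * z) := by
  unfold dir
  simp only [h1, star_one, one_smul, neg_smul, smul_mul_smul_comm, mul_add, add_mul, mul_neg, neg_mul, hζ, smul_add, smul_neg, neg_neg]
  module

variable (t : ℝ) in
/-- ζ parameter -/
def zt (b : Bool) : ℂ := if b then Complex.I else 1

lemma dirs_sum_le {t : ℝ} (Z : ι → M) (hZ : Adm 1 Z) :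
    ‖∑ k : ι × Bool, dir t (zt k.2) (Z k.1) * dir t (zt k.2) (Z k.1)‖ ≤ 4 * t ^ 2 ∧ 
    ‖∑ k : ι × Bool, dir t (star (zt k.2)) (Z k.1) * dir t (star (zt k.2)) (Z k.1)‖ ≤ 4 * t ^ 2 := by
  have hb : ‖(2 * t ^ 2 : ℂ) • (∑ i, Z i * star (Z i)) + (2 * t ^ 2 : ℂ) • (∑ i, star (Z i) * Z i)‖ ≤ 4 * t ^ 2 := by
    refine (norm_add_le _ _).trans ?_
    rw [norm_smul, norm_smul]
    have e : ‖(2 * t ^ 2 : ℂ)‖ = 2 * t ^ 2 := by simp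
    rw [e]
    have := hZ.1
    have := hZ.2
    unfold rsq csq at *
    nlinarith [sq_nonneg t]
  constructor
  · rw [Fintype.sum_prod_type]
    simp only [Fintype.sum_bool, zt, if_true, Bool.false_eq_true, if_false]
    simp only [dir_sq t _ Complex.I_mul_I (by simp), Finset.sum_add_distrib, ← Finset.smul_sum]
    exact hb
  · rw [Fintype.sum_prod_type]
    simp only [Fintype.sum_bool, zt, if_true, Bool.false_eq_true, if_false, star_one]
    simp only [dir_sq t _ (show star Complex.I * star Complex.I = -1 by simp) (by simp), Finset.sum_add_distrib, ← Finset.smul_sum]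
    exact hb

lemma dirs_exist {t : ℝ} (ht : 0 < t) (ht2 : 2 * t ≤ 1) (s : κ → M) (hs : ∀ k, star (s k) = s k)
    (hn : ∀ k, ‖s k‖ ≤ 2 * t) (hsum : ‖∑ k, s k * s k‖ ≤ 4 * t ^ 2) :
    ∃ d : κ → M, (∀ k, Trig (s k) (d k)) ∧ ‖∑ k, d k‖ ≤ 4 * t ^ 2 ∧ ∀ k, ‖d k‖ ≤ 4 * t ^ 2 := by
  letI := CStarAlgebra.spectralOrder M
  letI := CStarAlgebra.spectralOrderedRing M
  choose d h1 h2 h3 using fun k => exists_trig (s k) (hs k) ((hn k).trans ht2)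
  refine ⟨d, h1, ?_, ?_⟩
  · exact (row_le_of_le (Finset.sum_nonneg fun k _ => h2 k) (Finset.sum_le_sum fun k _ => h3 k)).trans hsum
  · intro k
    refine (h1 k).dle.trans ((norm_mul_le _ _).trans ?_)
    have := hn k
    nlinarith [norm_nonneg (s k)]

lemma FF_abs_le (Φ : M →ₗ[ℂ] N →ₗ[ℂ] ℂ) (T : ℝ) 
    (hT : ∀ (X : ι → M) (Y : ι → N), Adm 1 X → Adm 1 Y → FF Φ X Y ≤ T) {r : ℝ} (hr : 0 < r)
    (X : ι → M) (Y : ι → N) : (Adm (r ^ 2) X → Adm 1 Y → |FF Φ X Y| ≤ T * r) ∧ 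
    (Adm 1 X → Adm (r ^ 2) Y → |FF Φ X Y| ≤ T * r) := by
  have hc : ‖((r⁻¹ : ℝ) : ℂ)‖ ^ 2 * r ^ 2 = 1 := by
    rw [Complex.norm_real, norm_inv, Real.norm_of_nonneg hr.le]; field_simp
  have hc' : ‖(-(r⁻¹ : ℝ) : ℂ)‖ ^ 2 * r ^ 2 = 1 := by rw [norm_neg, hc]
  constructor
  · intro hX hY
    have h1 := hT _ Y ((hX.smul ((r⁻¹ : ℝ) : ℂ)).mono hc.le) hY
    have h2 := hT _ Y ((hX.smul (-(r⁻¹ : ℝ) : ℂ)).mono hc'.le) hY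
    have e1 : FF Φ (fun i => ((r⁻¹ : ℝ) : ℂ) • X i) Y = r⁻¹ * FF Φ X Y := by
      simp only [FF, map_smul, LinearMap.smul_apply, smul_eq_mul, Complex.re_ofReal_mul, Finset.mul_sum]
    have e2 : FF Φ (fun i => (-(r⁻¹ : ℝ) : ℂ) • X i) Y = - (r⁻¹ * FF Φ X Y) := by
      rw [← e1]
      simp [FF]
    rw [e1] at h1
    rw [e2] at h2
    have : |r⁻¹ * FF Φ X Y| ≤ T := abs_le.mpr ⟨by linarith, h1⟩
    rw [abs_mul, abs_of_pos (inv_pos.mpr hr), inv_mul_le_iff₀ hr] at this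
    linarith
  · intro hX hY
    have h1 := hT X _ hX ((hY.smul ((r⁻¹ : ℝ) : ℂ)).mono hc.le)
    have h2 := hT X _ hX ((hY.smul (-(r⁻¹ : ℝ) : ℂ)).mono hc'.le)
    have e1 : FF Φ X (fun i => ((r⁻¹ : ℝ) : ℂ) • Y i) = r⁻¹ * FF Φ X Y := by
      simp only [FF, map_smul, LinearMap.smul_apply, smul_eq_mul, Complex.re_ofReal_mul, Finset.mul_sum]
    have e2 : FF Φ X (fun i => (-(r⁻¹ : ℝ) : ℂ) • Y i) = - (r⁻¹ * FF Φ X Y) := by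
      rw [← e1]
      simp [FF]
    rw [e1] at h1
    rw [e2] at h2
    have : |r⁻¹ * FF Φ X Y| ≤ T := abs_le.mpr ⟨by linarith, h1⟩
    rw [abs_mul, abs_of_pos (inv_pos.mpr hr), inv_mul_le_iff₀ hr] at this
    linarith

/-- additive functional X ↦ F(X u*, Y) -/
def Lleft (Φ : M →ₗ[ℂ] N →ₗ[ℂ] ℂ) (u : M) (Y : ι → N) : (ι → M) →+ ℝ where
  toFun X := FF Φ (fun i => X i * u) Y
  map_zero' := by simp [FF]
  map_add' X X' := by simp [FF, add_mul, Finset.sum_add_distrib]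

def Lright (Φ : M →ₗ[ℂ] N →ₗ[ℂ] ℂ) (v : N) (X : ι → M) : (ι → N) →+ ℝ where
  toFun Y := FF Φ X (fun i => v * Y i)
  map_zero' := by simp [FF]
  map_add' X X' := by simp [FF, mul_add, Finset.sum_add_distrib]

end GT2
end PIS
end Part3

section Part4
namespace PIS

section GT3
variable {M N : Type*} [CStarAlgebra M] [CStarAlgebra N]
variable {ι κ : Type*} [Fintype ι] [Fintype κ]

/-- the local step -/
lemma gt_local (Φ : M →ₗ[ℂ] N →ₗ[ℂ] ℂ) (hΦ : ∀ x y, ‖Φ x y‖ ≤ ‖x‖ * ‖y‖)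
    (hh : ∀ x y, Φ (star x) (star y) = star (Φ x y))
    (T : ℝ) (hT0 : 0 < T)
    (hT : ∀ (X : ι → M) (Y : ι → N), Adm 1 X → Adm 1 Y → FF Φ X Y ≤ T)
    (X : ι → M) (Y : ι → N) (hX : Adm 1 X) (hY : Adm 1 Y) {t : ℝ} (ht : 0 < t) (ht2 : 2 * t ≤ 1)
    {u : M} {v : N} (hu : star u * u = 1) (hu' : u * star u = 1)
    (hv : star v * v = 1) (hv' : v * star v = 1)
    (hmax : ∀ u' v', star u' * u' = 1 → u' * star u' = 1 → star v' * v' = 1 → v' * star v' = 1 →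
      GG Φ X Y (4 / T) u' v' ≤ GG Φ X Y (4 / T) u v + t ^ 4) :
    FF Φ (fun i => star u * X i * star u) Y + FF Φ X (fun i => v * Y i * v) ≤
      52 + 145 * Fintype.card ι * t ^ 2 := by
  have nu := norm_unit_le hu
  have nu' : ‖star u‖ ≤ 1 := by rwa [norm_star]
  have nv := norm_unit_le hv
  set Z : ι → M := fun i => star u * X i with hZd
  set W : ι → N := fun i => Y i * v with hWd
  have hZ : Adm 1 Z := by
    have := (hX.conj (star u) 1 nu' norm_one_le).mono (r' := 1) (by simp)
    simpa using this
  have hW : Adm 1 W := by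
    have := (hY.conj 1 v norm_one_le nv).mono (r' := 1) (by simp)
    simpa using this
  set s : ι × Bool → M := fun k => dir t (zt k.2) (Z k.1) with hsd
  set s' : ι × Bool → N := fun k => - dir t (star (zt k.2)) (W k.1) with hsd'
  have nz : ∀ b, ‖zt b‖ = 1 := by intro b; cases b <;> simp [zt]
  have nz' : ∀ b, ‖star (zt b)‖ = 1 := by intro b; rw [norm_star, nz]
  obtain ⟨d, hd1, hd2, hd3⟩ := dirs_exist ht ht2 s (fun k => dir_star _ _ _)
    (fun k => dir_norm ht.le (nz _) (norm_le_of_rsq hZ.1 _)) (dirs_sum_le Z hZ).1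
  obtain ⟨d', hd1', hd2', hd3'⟩ := dirs_exist ht ht2 s' (fun k => by simp [hsd', dir_star])
    (fun k => by
      simp only [hsd', norm_neg]; exact dir_norm ht.le (nz' _) (norm_le_of_rsq hW.1 _))
    (by simp only [hsd', neg_mul_neg]; exact (dirs_sum_le W hW).2)
  have hp := fun k => pert Φ X Y (4 / T) (t ^ 4) hu hu' hv hv' (hd1 k) (hd1' k) hmax
  have hsum := Finset.sum_le_sum (s := Finset.univ) fun k _ => hp k
  have ssum1 : ‖∑ k, s k * s k‖ ≤ 4 * t ^ 2 := (dirs_sum_le Z hZ).1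
  have ssum2 : ‖∑ k, s' k * s' k‖ ≤ 4 * t ^ 2 := by
    simp only [hsd', neg_mul_neg]; exact (dirs_sum_le W hW).2
  have tp : 0 < 4 * t ^ 2 := by positivity
  -- error bounds
  have E1 := er_bound (Lleft Φ (star u) Y) T hT0.le (fun r hr X' hX' => by
      refine (FF_abs_le Φ T hT hr _ _).1 ?_ hY
      have := (hX'.conj 1 (star u) norm_one_le nu').mono (r' := r ^ 2) (by simp)
      simpa using this) Z hZ s d hd1 _ _ tp tp hd2 ssum1 hd3
  have E2 := er_bound (Lright Φ v X) T hT0.le (fun r hr X' hX' => by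
      refine (FF_abs_le Φ T hT hr _ _).2 hX ?_
      have := (hX'.conj v 1 nv norm_one_le).mono (r' := r ^ 2) (by simp)
      simpa using this) W hW s' d' hd1' _ _ tp tp hd2' ssum2 hd3'
  have B1 : ∑ k, (Φ (u * d k) v).re ≤ 4 * t ^ 2 := by
    rw [← Complex.re_sum, ← LinearMap.sum_apply, ← map_sum, ← Finset.mul_sum]
    refine (Complex.re_le_norm _).trans ((hΦ _ _).trans ?_)
    calc _ ≤ (1 * (4 * t ^ 2)) * 1 := by
          gcongr
          exact (norm_mul_le _ _).trans (by gcongr)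
      _ = _ := by ring
  have B2 : ∑ k, (Φ u (v * d' k)).re ≤ 4 * t ^ 2 := by
    rw [← Complex.re_sum, ← map_sum, ← Finset.mul_sum]
    refine (Complex.re_le_norm _).trans ((hΦ _ _).trans ?_)
    calc _ ≤ 1 * (1 * (4 * t ^ 2)) := by
          gcongr
          exact (norm_mul_le _ _).trans (by gcongr)
      _ = _ := by ring
  have B3 : - ∑ k, (Φ (u * d k) (v * d' k)).re ≤ 2 * Fintype.card ι * (4 * t ^ 2) ^ 2 := by
    rw [← Finset.sum_neg_distrib]
    refine (Finset.sum_le_card_nsmul _ _ ((4 * t ^ 2) ^ 2) fun k _ => ?_).trans ?_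
    · refine (neg_le_abs _).trans ((Complex.abs_re_le_norm _).trans ((hΦ _ _).trans ?_))
      calc _ ≤ (1 * (4 * t ^ 2)) * (1 * (4 * t ^ 2)) := by
            gcongr
            · exact (norm_mul_le _ _).trans (by gcongr; exact hd3 k)
            · exact (norm_mul_le _ _).trans (by gcongr; exact hd3' k)
        _ = _ := by ring
    · simp; linarith
  have C1 : ∑ k, - (Φ (u * s k) (v * s' k)).re =
      2 * t ^ 2 * (FF Φ (fun i => star u * X i * star u) Y + FF Φ X (fun i => v * Y i * v)) := by
    have e1 : ∀ i, u * Z i = X i := fun i => by simp [hZd, ← mul_assoc, hu']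
    have e2 : ∀ i, u * star (Z i) = u * star (X i) * u := fun i => by simp [hZd, mul_assoc]
    have e3 : ∀ i, v * star (W i) = star (Y i) := fun i => by simp [hWd, ← mul_assoc, hv']
    have e4 : ∀ i, v * W i = v * Y i * v := fun i => by simp [hWd, mul_assoc]
    have e5 : ∀ i, Φ (u * star (X i) * u) (star (Y i)) = star (Φ (star u * X i * star u) (Y i)) := by
      intro i
      rw [← hh]; simp [mul_assoc]
    rw [Fintype.sum_prod_type]
    simp only [Fintype.sum_bool]
    unfold FF
    rw [← Finset.sum_add_distrib, Finset.mul_sum]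
    refine Finset.sum_congr rfl fun i _ => ?_
    simp only [hsd, hsd', zt, if_true, Bool.false_eq_true, if_false, dir, mul_neg, mul_smul_comm, mul_add,
      e1, e2, e3, e4, map_neg, map_smul, map_add, LinearMap.smul_apply, LinearMap.add_apply, e5, star_one,
      one_smul, star_star, smul_eq_mul]
    simp
    ring
  have C2 : ∑ k, FF Φ (fun i => er (s k) (d k) (star u * X i) * star u) Y =
      Lleft Φ (star u) Y (fun i => ∑ k, er (s k) (d k) (Z i)) := by
    rw [← FF_sum_left]
    simp [Lleft, Finset.sum_mul, hZd]
  have C3 : ∑ k, FF Φ X (fun i => v * er (s' k) (d' k) (Y i * v)) =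
      Lright Φ v X (fun i => ∑ k, er (s' k) (d' k) (W i)) := by
    rw [← FF_sum_right]
    simp [Lright, Finset.mul_sum, hWd]
  rw [C1] at hsum
  simp only [Finset.sum_add_distrib, Finset.sum_sub_distrib, ← Finset.mul_sum, C2, C3,
    Finset.sum_const, nsmul_eq_mul, Finset.card_univ, Fintype.card_prod, Fintype.card_bool] at hsum
  simp only [Fintype.card_prod, Fintype.card_bool] at E1 E2
  have E3 : 4 / T * ((Lleft Φ (star u) Y) (fun i => ∑ k, er (s k) (d k) (Z i)) +
      (Lright Φ v X) (fun i => ∑ k, er (s' k) (d' k) (W i))) ≤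
      8 * (3 * (4 * t ^ 2) + (Fintype.card ι * 2 : ℕ) * (4 * t ^ 2) ^ 2) := by
    calc _ ≤ 4 / T * (T * (3 * (4 * t ^ 2) + (Fintype.card ι * 2 : ℕ) * (4 * t ^ 2) ^ 2) +
         T * (3 * (4 * t ^ 2) + (Fintype.card ι * 2 : ℕ) * (4 * t ^ 2) ^ 2)) := by gcongr
      _ = _ := by field_simp; ring
  push_cast at hsum E3
  have fin : 2 * t ^ 2 * (FF Φ (fun i => star u * X i * star u) Y + FF Φ X (fun i => v * Y i * v)) ≤
     2 * t ^ 2 * (52 + 145 * Fintype.card ι * t ^ 2) := by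
    nlinarith
  exact le_of_mul_le_mul_left fin (by positivity)

lemma gt_herm (Φ : M →ₗ[ℂ] N →ₗ[ℂ] ℂ) (hΦ : ∀ x y, ‖Φ x y‖ ≤ ‖x‖ * ‖y‖)
    (hh : ∀ x y, Φ (star x) (star y) = star (Φ x y))
    (X : ι → M) (Y : ι → N) (hX : Adm 1 X) (hY : Adm 1 Y) : FF Φ X Y ≤ 53 := by
  set S : Set ℝ := {r | ∃ (X : ι → M) (Y : ι → N), Adm 1 X ∧ Adm 1 Y ∧ r = FF Φ X Y} with hS
  have hbd : BddAbove S := by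
    refine ⟨Fintype.card ι, ?_⟩
    rintro r ⟨X, Y, hX, hY, rfl⟩
    refine (Finset.sum_le_card_nsmul _ _ 1 fun k _ => ?_).trans (by simp)
    refine (Complex.re_le_norm _).trans ((hΦ _ _).trans ?_)
    have h1 := norm_le_of_rsq hX.1 k
    have h2 := norm_le_of_rsq hY.1 k
    nlinarith [norm_nonneg (X k), norm_nonneg (Y k)]
  set T := sSup S with hTd
  have hT : ∀ (X : ι → M) (Y : ι → N), Adm 1 X → Adm 1 Y → FF Φ X Y ≤ T :=
    fun X Y hX hY => le_csSup hbd ⟨X, Y, hX, hY, rfl⟩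
  by_contra! hcon
  have hT53 : 53 < T := hcon.trans_le (hT X Y hX hY)
  have hT0 : 0 < T := by linarith
  obtain ⟨_, ⟨X, Y, hX, hY, rfl⟩, hB⟩ := exists_lt_of_lt_csSup (s := S) ⟨_, X, Y, hX, hY, rfl⟩
    (show 7 / 8 * T < sSup S by rw [← hTd]; linarith)
  obtain ⟨n, hn⟩ : ∃ n : ℝ, n = (Fintype.card ι : ℝ) := ⟨_, rfl⟩
  have hn0 : 0 ≤ n := by rw [hn]; positivity
  set t : ℝ := 1 / (20 * (n + 1)) with htd
  have ht : 0 < t := by positivity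
  have ht1 : t ≤ 1 / 20 := by
    rw [htd]; apply one_div_le_one_div_of_le <;> linarith
  have htn : t * (n + 1) = 1 / 20 := by rw [htd]; field_simp
  set Q : Set ℝ := {r | ∃ u v, star u * u = 1 ∧ u * star u = 1 ∧ star v * v = 1 ∧ v * star v = 1 ∧
    r = GG Φ X Y (4 / T) u v} with hQ
  have hadm : ∀ u : M, star u * u = 1 → Adm 1 (fun i => star u * X i * star u) := fun u hu => by
    have nu' : ‖star u‖ ≤ 1 := by rw [norm_star]; exact norm_unit_le hu
    exact (hX.conj (star u) (star u) nu' nu').mono (by simp)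
  have hadm' : ∀ v : N, star v * v = 1 → Adm 1 (fun i => v * Y i * v) := fun v hv => by
    have nv := norm_unit_le hv
    exact (hY.conj v v nv nv).mono (by simp)
  have hphi : ∀ u v, star u * u = 1 → star v * v = 1 → |(Φ u v).re| ≤ 1 := fun u v hu hv => by
    refine (Complex.abs_re_le_norm _).trans ((hΦ _ _).trans ?_)
    have h1 := norm_unit_le hu
    have h2 := norm_unit_le hv
    nlinarith [norm_nonneg u, norm_nonneg v]
  have hQb : BddAbove Q := by
    refine ⟨1 + 4 / T * (T + T), ?_⟩
    rintro r ⟨u, v, h1, h2, h3, h4, rfl⟩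
    unfold GG
    have a1 := hT _ _ (hadm u h1) hY
    have a2 := hT _ _ hX (hadm' v h3)
    have a3 := (abs_le.mp (hphi u v h1 h3)).2
    gcongr
  have hQm : GG Φ X Y (4 / T) 1 1 ∈ Q := ⟨1, 1, by simp, by simp, by simp, by simp, rfl⟩
  obtain ⟨_, ⟨u, v, hu, hu', hv, hv', rfl⟩, huv⟩ := exists_lt_of_lt_csSup (s := Q) ⟨_, hQm⟩
    (show sSup Q - t ^ 4 < sSup Q by have : 0 < t ^ 4 := by positivity
                                     linarith)
  have hloc := gt_local Φ hΦ hh T hT0 hT X Y hX hY ht (by linarith) hu hu' hv hv' (by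
    intro u' v' h1 h2 h3 h4
    have := le_csSup hQb ⟨u', v', h1, h2, h3, h4, rfl⟩
    linarith)
  rw [← hn] at hloc
  have h11 := le_csSup hQb hQm
  have hge : GG Φ X Y (4 / T) 1 1 ≤ GG Φ X Y (4 / T) u v + t ^ 4 := by linarith
  unfold GG at hge
  simp only [star_one, one_mul, mul_one] at hge
  have a3 := (abs_le.mp (hphi u v hu hv)).2
  have a4 := (abs_le.mp (hphi 1 1 (by simp) (by simp))).1
  have t4 : t ^ 4 ≤ 1 := pow_le_one₀ ht.le (by linarith)
  have hge2 : 4 / T * (2 * FF Φ X Y) ≤ 3 + 4 / T * (FF Φ (fun i => star u * X i * star u) Y + FF Φ X (fun i => v * Y i * v)) := by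
    linarith
  have hge3 : 2 * FF Φ X Y ≤ 3 * (T / 4) + (FF Φ (fun i => star u * X i * star u) Y + FF Φ X (fun i => v * Y i * v)) := by
    have := mul_le_mul_of_nonneg_left hge2 (show 0 ≤ T / 4 by positivity)
    have e : T / 4 * (4 / T) = 1 := by field_simp
    rw [mul_add (T / 4), ← mul_assoc (T / 4) (4 / T), ← mul_assoc (T / 4) (4 / T), e] at this
    linarith
  have : 145 * n * t ^ 2 ≤ 1 := by
    have : t ^ 2 * (n + 1) ≤ 1 / 400 := by
      calc t ^ 2 * (n + 1) = t * (t * (n + 1)) := by ring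
        _ ≤ 1 / 20 * (1 / 20) := by rw [htn]; gcongr
        _ = _ := by norm_num
    nlinarith [sq_nonneg t]
  linarith

lemma gt_unital (Φ : M →ₗ[ℂ] N →ₗ[ℂ] ℂ) (hΦ : ∀ x y, ‖Φ x y‖ ≤ ‖x‖ * ‖y‖)
    (X : ι → M) (Y : ι → N) (hX : Adm 1 X) (hY : Adm 1 Y) : FF Φ X Y ≤ 106 := by
  -- hermitian parts
  set Ψ : M →ₗ[ℂ] N →ₗ[ℂ] ℂ := LinearMap.mk₂ ℂ (fun x y => star (Φ (star x) (star y)))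
    (by simp) (by simp) (by simp) (by simp) with hΨ
  have hΨa : ∀ x y, Ψ x y = star (Φ (star x) (star y)) := fun x y => rfl
  have hΨn : ∀ x y, ‖Ψ x y‖ ≤ ‖x‖ * ‖y‖ := fun x y => by
    rw [hΨa, norm_star]; simpa using hΦ (star x) (star y)
  have h1 := gt_herm ((1 / 2 : ℂ) • (Φ + Ψ)) (fun x y => by
      simp only [LinearMap.smul_apply, LinearMap.add_apply, smul_eq_mul, norm_mul]
      have := norm_add_le (Φ x y) (Ψ x y)
      have := hΦ x y
      have := hΨn x y
      norm_num
      linarith) (fun x y => by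
      simp [hΨa]; ring) X Y hX hY
  have hY' : Adm 1 (fun i => Complex.I • Y i) := (hY.smul Complex.I).mono (by simp)
  have h2 := gt_herm ((Complex.I / 2 : ℂ) • (Ψ - Φ)) (fun x y => by
      simp only [LinearMap.smul_apply, LinearMap.sub_apply, smul_eq_mul, norm_mul]
      have := norm_sub_le (Ψ x y) (Φ x y)
      have := hΦ x y
      have := hΨn x y
      norm_num
      linarith) (fun x y => by
      simp [hΨa]; ring) X (fun i => Complex.I • Y i) hX hY'
  have : FF Φ X Y = FF ((1 / 2 : ℂ) • (Φ + Ψ)) X Y + FF ((Complex.I / 2 : ℂ) • (Ψ - Φ)) X (fun i => Complex.I • Y i) := by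
    unfold FF
    rw [← Finset.sum_add_distrib]
    refine Finset.sum_congr rfl fun i _ => ?_
    rw [← Complex.add_re]
    congr 1
    simp only [LinearMap.smul_apply, LinearMap.sub_apply, LinearMap.add_apply, smul_eq_mul, map_smul]
    have : Complex.I ^ 2 = -1 := Complex.I_sq
    linear_combination (-(1/2) * (Ψ (X i) (Y i) - Φ (X i) (Y i))) * this
  linarith

end GT3

section nonunital
variable {M N : Type*} [NonUnitalCStarAlgebra M] [NonUnitalCStarAlgebra N]
variable {ι : Type*} [Fintype ι]

lemma norm_snd_le (x : Unitization ℂ M) : ‖x.snd‖ ≤ 2 * ‖x‖ := by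
  have h1 : ‖x.fst‖ ≤ ‖x‖ := by
    have h := NonUnitalStarAlgHom.norm_apply_le (Unitization.fstHom ℂ M : Unitization ℂ M →⋆ₙₐ[ℂ] ℂ) x
    simpa using h
  have h2 : ((x.snd : M) : Unitization ℂ M) = x - algebraMap ℂ (Unitization ℂ M) x.fst := by
    rw [eq_sub_iff_add_eq', Unitization.algebraMap_eq_inl]
    exact Unitization.inl_fst_add_inr_snd_eq x
  rw [← Unitization.norm_inr (𝕜 := ℂ), h2]
  refine (norm_sub_le _ _).trans ?_
  rw [norm_algebraMap']
  linarith

theorem grothendieck (Φ : M →ₗ[ℂ] N →ₗ[ℂ] ℂ) (K : ℝ) (hK : 0 ≤ K) (hΦ : ∀ x y, ‖Φ x y‖ ≤ K * (‖x‖ * ‖y‖))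
    (X : ι → M) (Y : ι → N) (hX : Adm 1 X) (hY : Adm 1 Y) : ‖∑ i, Φ (X i) (Y i)‖ ≤ 424 * K := by
  -- positive K
  have main : ∀ K' : ℝ, 0 < K' → (∀ x y, ‖Φ x y‖ ≤ K' * (‖x‖ * ‖y‖)) → ‖∑ i, Φ (X i) (Y i)‖ ≤ 424 * K' := by
    intro K' hK' hΦ'
    obtain ⟨c, hc1, hc2⟩ : ∃ c : ℂ, ‖c‖ = 1 ∧ c * (∑ i, Φ (X i) (Y i)) = ‖∑ i, Φ (X i) (Y i)‖ := by
      by_cases h : (∑ i, Φ (X i) (Y i)) = 0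
      · exact ⟨1, by simp, by simp [h]⟩
      · refine ⟨‖∑ i, Φ (X i) (Y i)‖ / (∑ i, Φ (X i) (Y i)), ?_, ?_⟩
        · rw [norm_div]; simp [h]
        · field_simp
    set Ψ : Unitization ℂ M →ₗ[ℂ] Unitization ℂ N →ₗ[ℂ] ℂ := LinearMap.mk₂ ℂ
      (fun x y => (c / (4 * K')) * Φ x.snd y.snd)
      (by intros; simp [mul_add]) (by intros; simp; ring) (by intros; simp [mul_add]) (by intros; simp; ring) with hΨ
    have hΨa : ∀ x y, Ψ x y = (c / (4 * K')) * Φ x.snd y.snd := fun x y => rfl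
    have e1 : ∀ (i : ι), star (X i : Unitization ℂ M) = ((star (X i) : M) : Unitization ℂ M) := fun i => by simp
    have aX : Adm 1 (fun i => (X i : Unitization ℂ M)) := by
      constructor
      · have : ∑ i, (X i : Unitization ℂ M) * star (X i : Unitization ℂ M) = ((∑ i, X i * star (X i) : M) : Unitization ℂ M) := by
          simp [← Unitization.inr_mul, ← Unitization.inr_star]
          exact (map_sum (Unitization.inrNonUnitalStarAlgHom ℂ M) _ _).symm
        unfold rsq; rw [this, Unitization.norm_inr]; exact hX.1
      · have : ∑ i, star (X i : Unitization ℂ M) * (X i : Unitization ℂ M) = ((∑ i, star (X i) * X i : M) : Unitization ℂ M) := by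
          simp [← Unitization.inr_mul, ← Unitization.inr_star]
          exact (map_sum (Unitization.inrNonUnitalStarAlgHom ℂ M) _ _).symm
        unfold csq; rw [this, Unitization.norm_inr]; exact hX.2
    have aY : Adm 1 (fun i => (Y i : Unitization ℂ N)) := by
      constructor
      · have : ∑ i, (Y i : Unitization ℂ N) * star (Y i : Unitization ℂ N) = ((∑ i, Y i * star (Y i) : N) : Unitization ℂ N) := by
          simp [← Unitization.inr_mul, ← Unitization.inr_star]
          exact (map_sum (Unitization.inrNonUnitalStarAlgHom ℂ N) _ _).symm
        unfold rsq; rw [this, Unitization.norm_inr]; exact hY.1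
      · have : ∑ i, star (Y i : Unitization ℂ N) * (Y i : Unitization ℂ N) = ((∑ i, star (Y i) * Y i : N) : Unitization ℂ N) := by
          simp [← Unitization.inr_mul, ← Unitization.inr_star]
          exact (map_sum (Unitization.inrNonUnitalStarAlgHom ℂ N) _ _).symm
        unfold csq; rw [this, Unitization.norm_inr]; exact hY.2
    have := gt_unital Ψ (fun x y => by
      rw [hΨa, norm_mul, norm_div, hc1, norm_mul, Complex.norm_real, Real.norm_of_nonneg hK'.le]
      have a1 := hΦ' x.snd y.snd
      have a2 := norm_snd_le x
      have a3 := norm_snd_le y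
      have a4 : ‖Φ x.snd y.snd‖ ≤ K' * ((2 * ‖x‖) * (2 * ‖y‖)) := a1.trans (by gcongr)
      rw [div_mul_eq_mul_div, div_le_iff₀ (by simpa using hK')]
      norm_num
      linarith) _ _ aX aY
    have e : FF Ψ (fun i => (X i : Unitization ℂ M)) (fun i => (Y i : Unitization ℂ N)) = ‖∑ i, Φ (X i) (Y i)‖ / (4 * K') := by
      unfold FF
      rw [← Complex.re_sum]
      simp only [hΨa, Unitization.snd_inr]
      rw [← Finset.mul_sum, div_mul_eq_mul_div, hc2]
      rw [show (4 * (K' : ℂ)) = ((4 * K' : ℝ) : ℂ) by push_cast; rfl, ← Complex.ofReal_div, Complex.ofReal_re]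
    rw [e, div_le_iff₀ (by positivity)] at this
    linarith
  refine le_of_forall_pos_le_add fun ε hε => ?_
  have := main (K + ε / 424) (by positivity) (fun x y => (hΦ x y).trans (by gcongr; linarith [show 0 < ε / 424 by positivity]))
  linarith

end nonunital
end PIS
end Part4

section Part5
namespace PIS

section CN
variable {M : Type*} [NonUnitalCStarAlgebra M] {N : M → ℝ}

lemma cn_zero (h : IsCStarNorm N) : N 0 = 0 := by
  have := h.smul_eq 0 0; simpa using this

lemma cn_nonneg (h : IsCStarNorm N) (x : M) : 0 ≤ N x := by
  have h1 := h.add_le x ((-1 : ℂ) • x)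
  rw [h.smul_eq] at h1
  simp [cn_zero h] at h1
  linarith

lemma cn_half (h : IsCStarNorm N) (s : M) (hs : star s = s) (hn : ‖s‖ ≤ 1) (x : M) :
    N (s * x) ≤ N x := by
  letI := CStarAlgebra.spectralOrder (Unitization ℂ M)
  letI := CStarAlgebra.spectralOrderedRing (Unitization ℂ M)
  have hs' : star (s : Unitization ℂ M) = s := by rw [← Unitization.inr_star, hs]
  obtain ⟨d, hd, -, -⟩ := exists_trig (s : Unitization ℂ M) hs' (by rwa [Unitization.norm_inr])
  have key : ∀ e : ℂ, e = Complex.I ∨ e = -Complex.I →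
      ∃ y : M, (y : Unitization ℂ M) = (1 - d + e • (s : Unitization ℂ M)) * x ∧ N y = N x := by
    intro e he
    obtain ⟨a1, -, -⟩ := trig_unitary (u := 1) hd (by simp) (by simp) e he
    rw [one_mul] at a1
    set w := (1 - d + e • (s : Unitization ℂ M)) with hw
    have hy : (((w * (x : Unitization ℂ M)).snd : M) : Unitization ℂ M) = w * x := by
      apply Unitization.ext
      · simp
      · simp
    refine ⟨_, hy, ?_⟩
    set y := (w * (x : Unitization ℂ M)).snd with hyd
    have h2 : star y * y = star x * x := by
      apply Unitization.inr_injective (R := ℂ)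
      rw [Unitization.inr_mul, Unitization.inr_mul, Unitization.inr_star, Unitization.inr_star, hy, star_mul]
      rw [mul_assoc, ← mul_assoc (star w), a1, one_mul]
    have h3 := h.star_mul_self y
    rw [h2, h.star_mul_self x] at h3
    nlinarith [cn_nonneg h x, cn_nonneg h y]
  obtain ⟨y, hy, hNy⟩ := key _ (Or.inl rfl)
  obtain ⟨z, hz, hNz⟩ := key _ (Or.inr rfl)
  have e : s * x = (-Complex.I / 2) • y + (Complex.I / 2) • z := by
    apply Unitization.inr_injective (R := ℂ)
    rw [Unitization.inr_add, Unitization.inr_smul, Unitization.inr_smul, hy, hz, Unitization.inr_mul]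
    simp only [add_mul, sub_mul, smul_add, smul_sub, smul_mul_assoc, smul_smul]
    have : Complex.I * Complex.I = -1 := Complex.I_mul_I
    match_scalars <;> first | linear_combination this | linear_combination -this | (ring_nf; done) | (simp only [Complex.I_sq]; ring_nf; done) | linear_combination (0:ℂ) * this
  rw [e]
  refine (h.add_le _ _).trans ?_
  rw [h.smul_eq, h.smul_eq, hNy, hNz]
  simp
  linarith

lemma cn_le (h : IsCStarNorm N) (x : M) : N x ≤ ‖x‖ := by
  have hsa : ∀ s : M, star s = s → N s ≤ ‖s‖ := by
    intro s hs
    rcases eq_or_ne s 0 with rfl | h0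
    · simp [cn_zero h]
    have hp : 0 < ‖s‖ := norm_pos_iff.mpr h0
    set c : ℂ := ((‖s‖⁻¹ : ℝ) : ℂ) with hc
    have hcn : ‖c‖ = ‖s‖⁻¹ := by simp [hc]
    have h1 := cn_half h (c • s) (by simp [hc, hs]) (by rw [norm_smul, hcn]; field_simp; rfl) (c • s)
    have h2 := h.star_mul_self (c • s)
    rw [show star (c • s) = c • s by simp [hc, hs]] at h2
    rw [h2] at h1
    have h3 : N (c • s) ≤ 1 := by nlinarith [cn_nonneg h (c • s)]
    rw [h.smul_eq, hcn, inv_mul_le_iff₀ hp] at h3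
    linarith
  have h1 := hsa (star x * x) (by simp)
  rw [h.star_mul_self, CStarRing.norm_star_mul_self] at h1
  nlinarith [cn_nonneg h x, norm_nonneg x]

lemma cn_pow (h : IsCStarNorm N) (a : M) (ha : IsSelfAdjoint a) (g : ℝ → ℝ) (hg : Continuous g) (hg0 : g 0 = 0) (n : ℕ) :
    N (cfcₙ (fun t => t ^ n * g t) a) ≤ N a ^ n * N (cfcₙ g a) := by
  induction n with
  | zero => simp
  | succ n ih =>
    have e : cfcₙ (fun t => t ^ (n + 1) * g t) a = a * cfcₙ (fun t => t ^ n * g t) a := by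
      conv_rhs => rw [← cfcₙ_id' ℝ a]
      conv_rhs => enter [2]; rw [cfcₙ_id' ℝ a]
      rw [← cfcₙ_mul (fun t => t) (fun t => t ^ n * g t) a (by fun_prop) rfl (by fun_prop) (by simp [hg0])]
      congr 1; funext t; ring
    rw [e]
    refine (h.mul_le _ _).trans ?_
    rw [pow_succ']
    have := cn_nonneg h a
    nlinarith [mul_le_mul_of_nonneg_left ih this]

lemma cn_ge (h : IsCStarNorm N) (x : M) : ‖x‖ ≤ N x := by
  letI := CStarAlgebra.spectralOrder M
  letI := CStarAlgebra.spectralOrderedRing M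
  have hpos : ∀ a : M, 0 ≤ a → ‖a‖ ≤ N a := by
    intro a ha
    refine le_of_forall_gt_imp_ge_of_dense fun s hs => ?_
    have hs0 : 0 < s := (cn_nonneg h a).trans_lt hs
    have hsa := ha.isSelfAdjoint
    -- f
    have hf : cfcₙ (fun t : ℝ => max 0 (t - s)) a = 0 := by
      apply h.eq_zero_of
      have hb : ∀ n : ℕ, N (cfcₙ (fun t : ℝ => max 0 (t - s)) a) ≤ (N a / s) ^ n * ‖a‖ := by
        intro n
        set g : ℝ → ℝ := fun t => max 0 (t - s) / (max t s) ^ n with hg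
        have hgc : Continuous g := by
          apply Continuous.div (by fun_prop) (by fun_prop)
          intro t
          have : 0 < max t s := lt_max_of_lt_right hs0
          positivity
        have hg0 : g 0 = 0 := by simp [hg, hs0.le]
        have e : (fun t : ℝ => max 0 (t - s)) = fun t => t ^ n * g t := by
          funext t
          have : 0 < max t s := lt_max_of_lt_right hs0
          rcases le_total t s with h1 | h1
          · simp [hg, h1]
          · have : 0 < t := hs0.trans_le h1
            simp only [hg, max_eq_left h1]; field_simp
        rw [e]
        refine (cn_pow h a hsa g hgc hg0 n).trans ?_
        rw [div_pow, div_mul_eq_mul_div, mul_div_assoc]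
        refine mul_le_mul_of_nonneg_left ?_ (pow_nonneg (cn_nonneg h a) n)
        refine (cn_le h _).trans (norm_cfcₙ_le fun t ht => ?_)
        have ht0 : 0 ≤ t := quasispectrum_nonneg_of_nonneg a ha t ht
        have ht1 : t ≤ ‖a‖ := (le_abs_self t).trans (by
          have := norm_apply_le_norm_cfcₙ (𝕜 := ℝ) (fun x => x) a ht
          rwa [cfcₙ_id' ℝ a] at this)
        have : 0 < max t s := lt_max_of_lt_right hs0
        have hnn : 0 ≤ max 0 (t - s) := le_max_left _ _
        simp only [hg]
        rw [Real.norm_of_nonneg (by positivity)]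
        apply div_le_div₀ (norm_nonneg _)
        · exact max_le (norm_nonneg _) (by linarith)
        · positivity
        · gcongr; exact le_max_right _ _
      have hlim : Filter.Tendsto (fun n : ℕ => (N a / s) ^ n * ‖a‖) Filter.atTop (nhds (0 * ‖a‖)) := by
        apply Filter.Tendsto.mul_const
        apply tendsto_pow_atTop_nhds_zero_of_lt_one (div_nonneg (cn_nonneg h a) hs0.le)
        rwa [div_lt_one hs0]
      rw [zero_mul] at hlim
      exact le_antisymm (ge_of_tendsto' hlim hb) (cn_nonneg h _)
    have e : a = cfcₙ (fun t : ℝ => min t s) a := by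
      have e2 : cfcₙ (fun t : ℝ => min t s + max 0 (t - s)) a = cfcₙ (fun t : ℝ => min t s) a + 0 := by
        rw [← hf]
        exact cfcₙ_add _ _ a (by fun_prop) (by simp [hs0.le]) (by fun_prop) (by simp [hs0.le])
      rw [add_zero] at e2
      rw [← e2]
      conv_lhs => rw [← cfcₙ_id' ℝ a]
      congr 1; funext t
      rcases le_total t s with h1 | h1 <;> simp [h1]
    rw [e]
    refine norm_cfcₙ_le fun t ht => ?_
    have ht0 : 0 ≤ t := quasispectrum_nonneg_of_nonneg a ha t ht
    rw [Real.norm_of_nonneg (le_min ht0 hs0.le)]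
    exact min_le_right _ _
  have h1 := hpos (star x * x) (star_mul_self_nonneg x)
  rw [h.star_mul_self, CStarRing.norm_star_mul_self] at h1
  nlinarith [cn_nonneg h x, norm_nonneg x]

lemma cn_eq (h : IsCStarNorm N) (x : M) : N x = ‖x‖ := le_antisymm (cn_le h x) (cn_ge h x)

end CN
end PIS
end Part5

section Part6
namespace PIS

section S0
variable {A B : Type u} [NonUnitalCStarAlgebra A] [PartialOrder A] [StarOrderedRing A]
  [NonUnitalCStarAlgebra B] [PartialOrder B] [StarOrderedRing B]

lemma N_eq {p : ℕ} {N : Matrix (Fin p) (Fin p) A → ℝ} (h : IsCStarNorm N) (V : CStarMatrix (Fin p) (Fin p) A) :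
    N V = ‖V‖ := by
  have h' : IsCStarNorm (M := CStarMatrix (Fin p) (Fin p) A) N :=
    ⟨h.1, h.2, h.3, h.4, h.5⟩
  exact cn_eq h' V

lemma norm_reindex {I J : Type*} [Fintype I] [Fintype J] (e : I ≃ J) (V : CStarMatrix I I A) :
    ‖CStarMatrix.reindexₐ ℂ A e V‖ = ‖V‖ := by
  exact NonUnitalStarAlgHom.norm_map (CStarMatrix.reindexₐ ℂ A e) (CStarMatrix.reindexₐ ℂ A e).injective V

variable {NA : ∀ p : ℕ, Matrix (Fin p) (Fin p) A → ℝ}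
    {NB : ∀ q : ℕ, Matrix (Fin q) (Fin q) B → ℝ}
    (hNA : ∀ p, IsCStarNorm (NA p)) (hNB : ∀ q, IsCStarNorm (NB q))

lemma osBdd (hNA : ∀ p, IsCStarNorm (NA p)) (hNB : ∀ q, IsCStarNorm (NB q)) (u : A ⊗[ℂ] B) : BddBelow { r : ℝ | ∃ (p q : ℕ) (α : Fin p × Fin q → ℂ) (v : Matrix (Fin p) (Fin p) A)
      (w : Matrix (Fin q) (Fin q) B) (β : Fin p × Fin q → ℂ),
      u = ∑ ik : Fin p × Fin q, ∑ jl : Fin p × Fin q,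
            (α ik * β jl) • (v ik.1 jl.1 ⊗ₜ[ℂ] w ik.2 jl.2) ∧
      r = Real.sqrt (∑ ik, ‖α ik‖ ^ 2) * NA p v * NB q w *
            Real.sqrt (∑ jl, ‖β jl‖ ^ 2) } := by
  refine ⟨0, ?_⟩
  rintro r ⟨p, q, α, v, w, β, -, rfl⟩
  have h1 := N_eq (hNA p) v
  have h2 := N_eq (hNB q) w
  have h3 : 0 ≤ NA p v := h1 ▸ norm_nonneg (E := CStarMatrix (Fin p) (Fin p) A) v
  have h4 : 0 ≤ NB q w := h2 ▸ norm_nonneg (E := CStarMatrix (Fin q) (Fin q) B) w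
  positivity

lemma osProj_le (hNA : ∀ p, IsCStarNorm (NA p)) (hNB : ∀ q, IsCStarNorm (NB q))
    {I J : Type*} [Fintype I] [Fintype J] (V : CStarMatrix I I A) (W : CStarMatrix J J B)
    (α β : I × J → ℂ) :
    osProjNorm NA NB (∑ ik : I × J, ∑ jl : I × J, (α ik * β jl) • (V ik.1 jl.1 ⊗ₜ[ℂ] W ik.2 jl.2)) ≤
      Real.sqrt (∑ ik, ‖α ik‖ ^ 2) * ‖V‖ * ‖W‖ * Real.sqrt (∑ jl, ‖β jl‖ ^ 2) := by
  refine csInf_le (osBdd hNA hNB _) ?_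
  let eI := Fintype.equivFin I
  let eJ := Fintype.equivFin J
  let e := Equiv.prodCongr eI eJ
  refine ⟨_, _, α ∘ e.symm, CStarMatrix.reindexₐ ℂ A eI V, CStarMatrix.reindexₐ ℂ B eJ W, β ∘ e.symm, ?_, ?_⟩
  · rw [← Equiv.sum_comp e]
    refine Finset.sum_congr rfl fun ik _ => ?_
    rw [← Equiv.sum_comp e]
    refine Finset.sum_congr rfl fun jl _ => ?_
    have h1 : ∀ i j, CStarMatrix.reindexₐ ℂ A eI V (eI i) (eI j) = V i j := by
      intro i j
      show V (eI.symm (eI i)) (eI.symm (eI j)) = V i j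
      simp
    have h2 : ∀ i j, CStarMatrix.reindexₐ ℂ B eJ W (eJ i) (eJ j) = W i j := by
      intro i j
      show W (eJ.symm (eJ i)) (eJ.symm (eJ j)) = W i j
      simp
    show _ = (α (e.symm (e ik)) * β (e.symm (e jl))) • (CStarMatrix.reindexₐ ℂ A eI V (eI ik.1) (eI jl.1) ⊗ₜ[ℂ] CStarMatrix.reindexₐ ℂ B eJ W (eJ ik.2) (eJ jl.2))
    rw [h1, h2, Equiv.symm_apply_apply, Equiv.symm_apply_apply]
  · rw [N_eq (hNA _), N_eq (hNB _), norm_reindex, norm_reindex]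
    rw [← Equiv.sum_comp e, ← Equiv.sum_comp e]
    simp

lemma osProj_tmul_le (hNA : ∀ p, IsCStarNorm (NA p)) (hNB : ∀ q, IsCStarNorm (NB q)) (a : A) (b : B) :
    osProjNorm NA NB (a ⊗ₜ[ℂ] b) ≤ ‖a‖ * ‖b‖ := by
  have h := osProj_le hNA hNB (CStarMatrix.toOneByOne Unit ℂ A a) (CStarMatrix.toOneByOne Unit ℂ B b) (fun _ => 1) (fun _ => 1)
  have e1 : ‖CStarMatrix.toOneByOne Unit ℂ A a‖ = ‖a‖ :=
    NonUnitalStarAlgHom.norm_map (CStarMatrix.toOneByOne Unit ℂ A) (CStarMatrix.toOneByOne Unit ℂ A).injective a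
  have e2 : ‖CStarMatrix.toOneByOne Unit ℂ B b‖ = ‖b‖ :=
    NonUnitalStarAlgHom.norm_map (CStarMatrix.toOneByOne Unit ℂ B) (CStarMatrix.toOneByOne Unit ℂ B).injective b
  rw [e1, e2] at h
  have e3 : ∀ i j, CStarMatrix.toOneByOne Unit ℂ A a i j = a := fun i j => rfl
  have e4 : ∀ i j, CStarMatrix.toOneByOne Unit ℂ B b i j = b := fun i j => rfl
  simp only [e3, e4] at h
  simpa using h

end S0
end PIS
end Part6

section Part7
namespace PIS

section Emb

lemma sum_ite_le_one {n : ℕ} (f : Fin n → ℤ) (hf : Function.Injective f) (z : ℤ) :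
    ∑ r : Fin n, (if z = f r then (1:ℝ) else 0) ≤ 1 := by
  by_cases h : ∃ r, z = f r
  · obtain ⟨r, rfl⟩ := h
    rw [Finset.sum_eq_single r]
    · simp
    · intro b _ hb
      rw [if_neg]
      intro h; exact hb (hf h).symm
    · simp
  · rw [Finset.sum_eq_zero]
    · norm_num
    · intro r _
      rw [if_neg (fun h' => h ⟨r, h'⟩)]

lemma count_ge (n : ℕ) (k : ℤ) (hn : 2 * k.natAbs + 1 ≤ n) :
    (n : ℝ) / 2 ≤ ∑ r' : Fin n, ∑ r : Fin n, (if (r' : ℤ) = r + k then (1:ℝ) else 0) := by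
  have h1 : ∀ m : ℕ, 2 * m + 1 ≤ n → (n : ℝ) / 2 ≤ ∑ r : Fin n, (if (r : ℕ) + m < n then (1:ℝ) else 0) := by
    intro m hm
    rw [Fin.sum_univ_eq_sum_range (fun r => if r + m < n then (1:ℝ) else 0) n]
    calc (n : ℝ) / 2 ≤ ((n - m : ℕ) : ℝ) := by
          rw [Nat.cast_sub (by omega)]
          have : (2 * m + 1 : ℝ) ≤ n := by exact_mod_cast hm
          linarith
      _ = ∑ r ∈ Finset.range (n - m), (if r + m < n then (1:ℝ) else 0) := by
          rw [Finset.sum_congr rfl (g := fun _ => (1:ℝ))]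
          · simp
          · intro r hr
            rw [Finset.mem_range] at hr
            rw [if_pos (by omega)]
      _ ≤ _ := by
          apply Finset.sum_le_sum_of_subset_of_nonneg
          · intro r hr
            rw [Finset.mem_range] at *; omega
          · intro r _ _; split_ifs <;> norm_num
  rcases le_total 0 k with hk | hk
  · obtain ⟨m, rfl⟩ := Int.eq_ofNat_of_zero_le hk
    refine (h1 m (by simpa using hn)).trans ?_
    rw [Finset.sum_comm]
    refine Finset.sum_le_sum fun r _ => ?_
    split_ifs with h
    · refine le_trans ?_ (Finset.single_le_sum (f := fun r' : Fin n => if (r' : ℤ) = r + (m:ℤ) then (1:ℝ) else 0) (fun i _ => by split_ifs <;> norm_num) (Finset.mem_univ ⟨r + m, h⟩))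
      simp
    · exact Finset.sum_nonneg fun i _ => by split_ifs <;> norm_num
  · obtain ⟨m, hm⟩ := Int.eq_ofNat_of_zero_le (a := -k) (by omega)
    obtain rfl : k = -(m : ℤ) := by omega
    refine (h1 m (by simpa using hn)).trans ?_
    refine Finset.sum_le_sum fun r _ => ?_
    split_ifs with h
    · refine le_trans ?_ (Finset.single_le_sum (f := fun r' : Fin n => if (r : ℤ) = r' + -(m:ℤ) then (1:ℝ) else 0) (fun i _ => by split_ifs <;> norm_num) (Finset.mem_univ ⟨r + m, h⟩))
      simp
    · exact Finset.sum_nonneg fun i _ => by split_ifs <;> norm_num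

lemma embez (kmax : ℕ) : ∃ (I : Type) (_ : Fintype I) (ψ : I → ℝ), (∑ i, ψ i ^ 2 = 1) ∧
    ∀ k : ℤ, k.natAbs ≤ kmax → ∃ x y : I → I → ℝ,
      (∀ p, ∑ q, x p q ^ 2 ≤ 1) ∧ (∀ q, ∑ p, x p q ^ 2 ≤ (2:ℝ) ^ k) ∧
      (∀ p, ∑ q, y p q ^ 2 ≤ 4 * ((2:ℝ) ^ k)⁻¹) ∧ (∀ q, ∑ p, y p q ^ 2 ≤ 4) ∧
      ∑ p, ∑ q, ψ p * ψ q * (x p q * y p q) = 1 := by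
  set n := 2 * kmax + 1 with hn
  have hn0 : (0:ℝ) < n := by rw [hn]; positivity
  have t0 : (0:ℝ) < √2 := by positivity
  have t2 : ∀ r : ℕ, ((√2 ^ r)⁻¹)^2 = (2^r)⁻¹ := fun r => by
    rw [inv_pow, ← pow_mul, mul_comm, pow_mul, Real.sq_sqrt (by norm_num)]
  have S : ∀ f : Fin n → ℝ, ∑ i : (Σ r : Fin n, Fin (2 ^ (r:ℕ))), f i.1 = ∑ r : Fin n, 2 ^ (r:ℕ) * f r := by
    intro f
    rw [Fintype.sum_sigma]
    simp
  refine ⟨Σ r : Fin n, Fin (2 ^ (r:ℕ)), inferInstance, fun i => (√2 ^ (i.1:ℕ))⁻¹ / √n, ?_, ?_⟩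
  · rw [S (fun r => ((√2 ^ (r:ℕ))⁻¹ / √n)^2)]
    rw [Finset.sum_congr rfl (g := fun _ => (1/n : ℝ))]
    · simp
    · intro r _
      rw [div_pow, t2, Real.sq_sqrt hn0.le]
      field_simp
  intro k hk
  set N : ℝ := ∑ r' : Fin n, ∑ r : Fin n, (if (r' : ℤ) = r + k then (1:ℝ) else 0) with hN
  have hNn : (n:ℝ)/2 ≤ N := count_ge n k (by omega)
  have hNp : 0 < N := by linarith
  have hc : (n / N)^2 ≤ 4 := by
    have : n / N ≤ 2 := by rw [div_le_iff₀ hNp]; linarith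
    have : 0 ≤ n / N := by positivity
    nlinarith
  have zp : ∀ r' r : ℕ, (r' : ℤ) = r + k → (2:ℝ)^r' * (2^r)⁻¹ = 2^k := by
    intro r' r h
    have : k = (r':ℤ) - r := by omega
    rw [this, zpow_sub₀ (by norm_num)]
    simp; rfl
  have zp' : ∀ r' r : ℕ, (r' : ℤ) = r + k → (2:ℝ)^r * (2^r')⁻¹ = (2^k)⁻¹ := by
    intro r' r h
    rw [← zp r' r h]
    simp [mul_comm]
  have hi1 : Function.Injective (fun r : Fin n => (r : ℤ) + k) := by
    intro a b h; ext; simpa using h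
  have hs2 : ∀ q : Fin n, ∑ p : Fin n, (if (p : ℤ) = q + k then (1:ℝ) else 0) ≤ 1 := by
    intro q
    have := sum_ite_le_one (n := n) (fun r => (r : ℤ)) (by intro a b h; ext; simpa using h) ((q:ℤ)+k)
    simpa only [eq_comm] using this
  refine ⟨fun p q => if ((p.1:ℕ) : ℤ) = (q.1:ℕ) + k then (√2 ^ (q.1:ℕ))⁻¹ else 0,
    fun p q => if ((p.1:ℕ) : ℤ) = (q.1:ℕ) + k then (√2 ^ (p.1:ℕ))⁻¹ * (n / N) else 0, ?_, ?_, ?_, ?_, ?_⟩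
  · intro p
    rw [S (fun q => (if ((p.1:ℕ) : ℤ) = (q:ℕ) + k then (√2 ^ (q:ℕ))⁻¹ else 0)^2)]
    refine le_trans (Finset.sum_le_sum (g := fun q : Fin n => if ((p.1:ℕ) : ℤ) = q + k then (1:ℝ) else 0) fun q _ => ?_) (sum_ite_le_one _ hi1 _)
    split_ifs
    · rw [t2]; field_simp; rfl
    · simp
  · intro q
    rw [S (fun p => (if ((p:ℕ) : ℤ) = (q.1:ℕ) + k then (√2 ^ (q.1:ℕ))⁻¹ else 0)^2)]
    refine le_trans (Finset.sum_le_sum (g := fun p : Fin n => 2^k * if ((p:ℕ) : ℤ) = q.1 + k then (1:ℝ) else 0) fun p _ => ?_) ?_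
    · split_ifs with h
      · rw [t2, zp _ _ h, mul_one]
      · simp
    · rw [← Finset.mul_sum]
      have := hs2 q.1
      have h2 : (0:ℝ) < 2^k := by positivity
      nlinarith
  · intro p
    rw [S (fun q => (if ((p.1:ℕ) : ℤ) = (q:ℕ) + k then (√2 ^ (p.1:ℕ))⁻¹ * (n / N) else 0)^2)]
    refine le_trans (Finset.sum_le_sum (g := fun q : Fin n => (4 * (2^k)⁻¹) * if ((p.1:ℕ) : ℤ) = q + k then (1:ℝ) else 0) fun q _ => ?_) ?_
    · split_ifs with h
      · rw [mul_pow, t2, ← mul_assoc, zp' _ _ h, mul_one, mul_comm]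
        gcongr
      · simp
    · rw [← Finset.mul_sum]
      have := sum_ite_le_one _ hi1 ((p.1:ℕ) : ℤ)
      have h2 : (0:ℝ) < 4*(2^k)⁻¹ := by positivity
      nlinarith
  · intro q
    rw [S (fun p => (if ((p:ℕ) : ℤ) = (q.1:ℕ) + k then (√2 ^ (p:ℕ))⁻¹ * (n / N) else 0)^2)]
    refine le_trans (Finset.sum_le_sum (g := fun p : Fin n => 4 * if ((p:ℕ) : ℤ) = q.1 + k then (1:ℝ) else 0) fun p _ => ?_) ?_
    · split_ifs with h
      · rw [mul_pow, t2, ← mul_assoc]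
        rw [mul_inv_cancel₀ (by positivity)]; linarith
      · simp
    · rw [← Finset.mul_sum]
      have := hs2 q.1
      linarith
  · have e : ∀ p : Σ r : Fin n, Fin (2 ^ (r:ℕ)), ∑ q : Σ r : Fin n, Fin (2 ^ (r:ℕ)), (√2 ^ (p.1:ℕ))⁻¹ / √n * ((√2 ^ (q.1:ℕ))⁻¹ / √n) *
        ((if ((p.1:ℕ) : ℤ) = (q.1:ℕ) + k then (√2 ^ (q.1:ℕ))⁻¹ else 0) * (if ((p.1:ℕ) : ℤ) = (q.1:ℕ) + k then (√2 ^ (p.1:ℕ))⁻¹ * (n / N) else 0)) =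
        (2 ^ (p.1:ℕ))⁻¹ * (N⁻¹ * ∑ q : Fin n, if ((p.1:ℕ) : ℤ) = q + k then (1:ℝ) else 0) := by
      intro p
      rw [S (fun q => (√2 ^ (p.1:ℕ))⁻¹ / √n * ((√2 ^ (q:ℕ))⁻¹ / √n) *
        ((if ((p.1:ℕ) : ℤ) = (q:ℕ) + k then (√2 ^ (q:ℕ))⁻¹ else 0) * (if ((p.1:ℕ) : ℤ) = (q:ℕ) + k then (√2 ^ (p.1:ℕ))⁻¹ * (n / N) else 0)))]
      rw [Finset.mul_sum, Finset.mul_sum]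
      refine Finset.sum_congr rfl fun q _ => ?_
      split_ifs
      · rw [← t2]
        have h5 := t2 q
        have : √(n:ℝ) * √n = n := Real.mul_self_sqrt hn0.le
        have h6 : ((2:ℝ)^(q:ℕ)) * ((√2 ^ (q:ℕ))⁻¹)^2 = 1 := by rw [h5]; field_simp
        have hsn : √(n:ℝ) ≠ 0 := by positivity
        calc _ = ((2:ℝ)^(q:ℕ)) * ((√2 ^ (q:ℕ))⁻¹)^2 * ((√2 ^ (p.1:ℕ))⁻¹)^2 * N⁻¹ * (n / (√n * √n)) := by
              field_simp
          _ = _ := by rw [h6, this, div_self hn0.ne']; ring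
      · simp
    simp only [e]
    rw [S (fun p => (2 ^ (p:ℕ))⁻¹ * (N⁻¹ * ∑ q : Fin n, if ((p:ℕ) : ℤ) = q + k then (1:ℝ) else 0))]
    calc _ = N⁻¹ * N := by
          rw [hN, Finset.mul_sum]
          refine Finset.sum_congr rfl fun p _ => ?_
          rw [← mul_assoc, mul_inv_cancel₀ (by positivity), one_mul]
      _ = 1 := inv_mul_cancel₀ hNp.ne'

end Emb
end PIS
end Part7

section Part8
namespace PIS

section Diag
variable {A : Type*} [NonUnitalCStarAlgebra A] [PartialOrder A] [StarOrderedRing A]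
variable {I : Type*} [Fintype I]

open Classical in
def sE (p q : I) (a : A) : CStarMatrix I I A := CStarMatrix.ofMatrix (Matrix.single p q a)

open Classical in
def dHom : (I → A) →⋆ₙₐ[ℂ] CStarMatrix I I A where
  toFun d := CStarMatrix.ofMatrix (Matrix.diagonal d)
  map_smul' c d := by
    show _ = c • (Matrix.diagonal d : Matrix I I A)
    rw [← Matrix.diagonal_smul]; rfl
  map_zero' := by
    show (Matrix.diagonal (0 : I → A) : Matrix I I A) = 0
    exact Matrix.diagonal_zero
  map_add' d e := by
    show _ = (Matrix.diagonal d : Matrix I I A) + Matrix.diagonal e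
    rw [Matrix.diagonal_add]; rfl
  map_mul' d e := by
    show _ = (Matrix.diagonal d : Matrix I I A) * Matrix.diagonal e
    rw [Matrix.diagonal_mul_diagonal]; rfl
  map_star' d := by
    show _ = Matrix.conjTranspose (Matrix.diagonal d : Matrix I I A)
    rw [Matrix.diagonal_conjTranspose]; rfl

lemma norm_dHom_le (d : I → A) (r : ℝ) (hr : 0 ≤ r) (h : ∀ i, ‖d i‖ ≤ r) : ‖dHom d‖ ≤ r :=
  (NonUnitalStarAlgHom.norm_apply_le dHom d).trans ((pi_norm_le_iff_of_nonneg hr).mpr h)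

open Classical in
lemma sE_mul_star (p q : I) (a : A) : sE p q a * star (sE p q a) = dHom (Pi.single p (a * star a)) := by
  show Matrix.single p q a * Matrix.conjTranspose (Matrix.single p q a) = _
  rw [Matrix.conjTranspose_single, Matrix.single_mul_single_same]
  show _ = Matrix.diagonal _
  ext i j
  by_cases h : i = j
  · subst h
    by_cases h2 : p = i
    · subst h2; simp
    · rw [Matrix.single_apply_of_row_ne h2, Matrix.diagonal_apply_eq, Pi.single_eq_of_ne (Ne.symm h2)]
  · rw [Matrix.diagonal_apply_ne _ h]
    by_cases h2 : p = i
    · rw [Matrix.single_apply_of_col_ne]; rintro rfl; exact h h2.symm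
    · rw [Matrix.single_apply_of_row_ne h2]

lemma star_sE (p q : I) (a : A) : star (sE p q a) = sE q p (star a) := by
  classical
  show Matrix.conjTranspose (Matrix.single p q a) = _
  rw [Matrix.conjTranspose_single]; rfl

open Classical in
lemma star_mul_sE (p q : I) (a : A) : star (sE p q a) * sE p q a = dHom (Pi.single q (star a * a)) := by
  have := sE_mul_star q p (star a)
  rwa [star_sE, star_star, ← star_sE] at this

lemma sum_smul_mono {J : Type*} [Fintype J] (s t : J → ℝ) (h0 : ∀ j, 0 ≤ s j) (hst : ∀ j, s j ≤ t j) (P : J → A) (hP : ∀ j, 0 ≤ P j) :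
    ‖∑ j, s j • P j‖ ≤ ‖∑ j, t j • P j‖ := by
  apply row_le_of_le
  · exact Finset.sum_nonneg fun j _ => smul_nonneg (h0 j) (hP j)
  · exact Finset.sum_le_sum fun j _ => smul_le_smul_of_nonneg_right (hst j) (hP j)

lemma sE_rsq {J : Type*} [Fintype J] (x : J → I → I → ℝ) (a : J → A) (s : J → ℝ) (hs : ∀ j p, ∑ q, x j p q ^ 2 ≤ s j)
    (r : ℝ) (hr : ‖∑ j, s j • (a j * star (a j))‖ ≤ r) :
    rsq (fun i : J × I × I => sE i.2.1 i.2.2 (x i.1 i.2.1 i.2.2 • a i.1)) ≤ r := by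
  classical
  have e : ∑ i : J × I × I, sE i.2.1 i.2.2 (x i.1 i.2.1 i.2.2 • a i.1) * star (sE i.2.1 i.2.2 (x i.1 i.2.1 i.2.2 • a i.1)) =
      dHom (fun p => ∑ j, (∑ q, x j p q ^ 2) • (a j * star (a j))) := by
    simp only [sE_mul_star]
    rw [← map_sum]
    congr 1
    funext p
    rw [Finset.sum_apply, Fintype.sum_prod_type]
    refine Finset.sum_congr rfl fun j _ => ?_
    rw [Fintype.sum_prod_type, Finset.sum_eq_single p, Finset.sum_smul]
    · refine Finset.sum_congr rfl fun q _ => ?_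
      rw [Pi.single_eq_same, star_smul, smul_mul_smul_comm, star_trivial, pow_two]
    · intro b _ hb
      exact Finset.sum_eq_zero fun q _ => Pi.single_eq_of_ne (M := fun _ : I => A) hb.symm _
    · simp
  unfold rsq
  rw [e]
  refine norm_dHom_le _ _ ((norm_nonneg _).trans hr) fun p => ?_
  exact (sum_smul_mono _ _ (fun j => by positivity) (fun j => hs j p) _ (fun j => mul_star_self_nonneg _)).trans hr

lemma sE_csq {J : Type*} [Fintype J] (x : J → I → I → ℝ) (a : J → A) (s : J → ℝ) (hs : ∀ j q, ∑ p, x j p q ^ 2 ≤ s j)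
    (r : ℝ) (hr : ‖∑ j, s j • (star (a j) * a j)‖ ≤ r) :
    csq (fun i : J × I × I => sE i.2.1 i.2.2 (x i.1 i.2.1 i.2.2 • a i.1)) ≤ r := by
  classical
  have e : ∑ i : J × I × I, star (sE i.2.1 i.2.2 (x i.1 i.2.1 i.2.2 • a i.1)) * (sE i.2.1 i.2.2 (x i.1 i.2.1 i.2.2 • a i.1)) =
      dHom (fun q => ∑ j, (∑ p, x j p q ^ 2) • (star (a j) * a j)) := by
    simp only [star_mul_sE]
    rw [← map_sum]
    congr 1
    funext q
    rw [Finset.sum_apply, Fintype.sum_prod_type]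
    refine Finset.sum_congr rfl fun j _ => ?_
    rw [Fintype.sum_prod_type, Finset.sum_comm, Finset.sum_eq_single q, Finset.sum_smul]
    · refine Finset.sum_congr rfl fun p _ => ?_
      rw [Pi.single_eq_same, star_smul, smul_mul_smul_comm, star_trivial, pow_two]
    · intro b _ hb
      exact Finset.sum_eq_zero fun q _ => Pi.single_eq_of_ne (M := fun _ : I => A) hb.symm _
    · simp
  unfold csq
  rw [e]
  refine norm_dHom_le _ _ ((norm_nonneg _).trans hr) fun p => ?_
  exact (sum_smul_mono _ _ (fun j => by positivity) (fun j => hs j p) _ (fun j => star_mul_self_nonneg _)).trans hr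

end Diag

section Jcb
variable {A B : Type u} [NonUnitalCStarAlgebra A] [PartialOrder A] [StarOrderedRing A]
  [NonUnitalCStarAlgebra B] [PartialOrder B] [StarOrderedRing B]

def JCB (K : ℝ) (φ : A →ₗ[ℂ] B →ₗ[ℂ] ℂ) : Prop :=
  ∀ (I : Type) [Fintype I] (ψ : I → ℝ) (V : CStarMatrix I I A) (W : CStarMatrix I I B), ∑ i, ψ i ^ 2 = 1 →
    ‖∑ p, ∑ q, ((ψ p * ψ q : ℝ) : ℂ) • φ (V p q) (W p q)‖ ≤ K * (‖V‖ * ‖W‖)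

def hatφ {I : Type} [Fintype I] (φ : A →ₗ[ℂ] B →ₗ[ℂ] ℂ) (ψ : I → ℝ) : CStarMatrix I I A →ₗ[ℂ] CStarMatrix I I B →ₗ[ℂ] ℂ :=
  LinearMap.mk₂ ℂ (fun V W => ∑ p, ∑ q, ((ψ p * ψ q : ℝ) : ℂ) • φ (V p q) (W p q))
    (fun V V' W => by simp [mul_add, Finset.sum_add_distrib])
    (fun c V W => by
      simp only [CStarMatrix.smul_apply, map_smul, LinearMap.smul_apply, smul_eq_mul, Finset.mul_sum]
      exact Finset.sum_congr rfl fun p _ => Finset.sum_congr rfl fun q _ => by ring)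
    (fun V V' W => by simp [mul_add, Finset.sum_add_distrib])
    (fun c V W => by
      simp only [CStarMatrix.smul_apply, map_smul, LinearMap.smul_apply, smul_eq_mul, Finset.mul_sum]
      exact Finset.sum_congr rfl fun p _ => Finset.sum_congr rfl fun q _ => by ring)

lemma hatφ_sE {I : Type} [Fintype I] (φ : A →ₗ[ℂ] B →ₗ[ℂ] ℂ) (ψ : I → ℝ) (p q : I) (a : A) (b : B) :
    hatφ φ ψ (sE p q a) (sE p q b) = ((ψ p * ψ q : ℝ) : ℂ) • φ a b := by
  classical
  show ∑ p', ∑ q', ((ψ p' * ψ q' : ℝ) : ℂ) • φ (sE p q a p' q') (sE p q b p' q') = _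
  have e1 : ∀ p' q', sE p q a p' q' = if p = p' ∧ q = q' then a else 0 := fun p' q' => Matrix.single_apply p q a p' q'
  have e2 : ∀ p' q', sE p q b p' q' = if p = p' ∧ q = q' then b else 0 := fun p' q' => Matrix.single_apply p q b p' q'
  rw [Finset.sum_eq_single p, Finset.sum_eq_single q]
  · rw [e1, e2]; simp
  · intro q' _ hq; rw [e1]; simp [hq.symm]
  · simp
  · intro p' _ hp
    refine Finset.sum_eq_zero fun q' _ => ?_
    rw [e1]; simp [hp.symm]
  · simp

lemma exists_zpow_near (t : ℝ) (ht : 0 < t) : ∃ k : ℤ, (2:ℝ)^k ≤ t ∧ ((2:ℝ)^k)⁻¹ ≤ 2 * t⁻¹ := by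
  obtain ⟨k, h1, h2⟩ := exists_mem_Ico_zpow ht (by norm_num : (1:ℝ) < 2)
  refine ⟨k, h1, ?_⟩
  rw [zpow_add_one₀ (by norm_num)] at h2
  have : (0:ℝ) < 2^k := by positivity
  rw [inv_le_iff_one_le_mul₀ this]
  field_simp
  linarith

lemma jcb_bound {K : ℝ} (hK : 0 ≤ K) {φ : A →ₗ[ℂ] B →ₗ[ℂ] ℂ} (hφ : JCB K φ) {J : Type*} [Fintype J] (a : J → A) (b : J → B)
    (t : J → ℝ) (ht : ∀ j, 0 < t j) (r : ℝ) (hr : 0 < r)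
    (h1 : ‖∑ j, a j * star (a j)‖ ≤ r) (h2 : ‖∑ j, t j • (star (a j) * a j)‖ ≤ r)
    (h3 : ‖∑ j, star (b j) * b j‖ ≤ r) (h4 : ‖∑ j, (t j)⁻¹ • (b j * star (b j))‖ ≤ r) :
    ‖∑ j, φ (a j) (b j)‖ ≤ 424 * K * (3 * r) := by
  choose k hk1 hk2 using fun j => exists_zpow_near (t j) (ht j)
  obtain ⟨I, _, ψ, hψ, hI⟩ := embez (Finset.univ.sup fun j => (k j).natAbs)
  choose x y hx1 hx2 hy1 hy2 hxy using fun j => hI (k j) (Finset.le_sup (f := fun j => (k j).natAbs) (Finset.mem_univ j))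
  set X : J × I × I → CStarMatrix I I A := fun i => sE i.2.1 i.2.2 (x i.1 i.2.1 i.2.2 • a i.1) with hX
  set Y : J × I × I → CStarMatrix I I B := fun i => sE i.2.1 i.2.2 (y i.1 i.2.1 i.2.2 • b i.1) with hY
  have aX : Adm r X := by
    constructor
    · exact sE_rsq x a (fun _ => 1) hx1 r (by simpa using h1)
    · refine sE_csq x a (fun j => (2:ℝ)^(k j)) hx2 r (le_trans ?_ h2)
      exact sum_smul_mono _ _ (fun j => by positivity) hk1 _ (fun j => star_mul_self_nonneg _)
  have aY : Adm (9 * r) Y := by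
    constructor
    · refine sE_rsq y b (fun j => 4 * ((2:ℝ)^(k j))⁻¹) hy1 _ ?_
      refine (sum_smul_mono _ (fun j => 8 * (t j)⁻¹) (fun j => by positivity) (fun j => by linarith [hk2 j]) _ (fun j => mul_star_self_nonneg _)).trans ?_
      simp only [mul_smul]
      rw [← Finset.smul_sum, norm_smul]
      norm_num; linarith
    · refine sE_csq y b (fun j => 4) hy2 _ ?_
      rw [← Finset.smul_sum, norm_smul]
      norm_num; linarith
  have hs : 0 < √r := Real.sqrt_pos.mpr hr
  have hs2 : √r ^ 2 = r := Real.sq_sqrt hr.le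
  have aX' := aX.smul (((√r)⁻¹ : ℝ) : ℂ)
  have aY' := aY.smul (((3 * √r)⁻¹ : ℝ) : ℂ)
  have n1 : ‖(((√r)⁻¹ : ℝ) : ℂ)‖ ^ 2 * r = 1 := by
    rw [Complex.norm_real, Real.norm_of_nonneg (by positivity), inv_pow, hs2]; field_simp
  have n2 : ‖(((3 * √r)⁻¹ : ℝ) : ℂ)‖ ^ 2 * (9 * r) = 1 := by
    rw [Complex.norm_real, Real.norm_of_nonneg (by positivity), inv_pow, mul_pow, hs2]; field_simp; norm_num
  rw [n1] at aX'
  rw [n2] at aY'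
  have g := grothendieck (hatφ φ ψ) K hK (fun V W => hφ I ψ V W hψ) _ _ aX' aY'
  have e : ∑ i, hatφ φ ψ ((((√r)⁻¹ : ℝ) : ℂ) • X i) ((((3 * √r)⁻¹ : ℝ) : ℂ) • Y i) = (((3 * r)⁻¹ : ℝ) : ℂ) * ∑ j, φ (a j) (b j) := by
    have hrr : (3 * r)⁻¹ = (√r)⁻¹ * (3 * √r)⁻¹ := by
      rw [← mul_inv]; congr 1; rw [← hs2]; ring_nf; rw [Real.sqrt_sq hs.le]
    simp only [map_smul, LinearMap.smul_apply, smul_eq_mul]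
    rw [hrr]
    push_cast
    rw [← Finset.mul_sum, ← Finset.mul_sum, ← mul_assoc, mul_comm (3 * (√r : ℂ))⁻¹]
    congr 1
    rw [Fintype.sum_prod_type]
    refine Finset.sum_congr rfl fun j _ => ?_
    have e3 : ∀ p q, hatφ φ ψ (X (j, p, q)) (Y (j, p, q)) = ((ψ p * ψ q * (x j p q * y j p q) : ℝ) : ℂ) * φ (a j) (b j) := by
      intro p q
      simp only [hX, hY]
      rw [hatφ_sE]
      have er : ∀ (c : ℝ) (z : A), c • z = (c : ℂ) • z := fun c z => rfl
      have er' : ∀ (c : ℝ) (z : B), c • z = (c : ℂ) • z := fun c z => rfl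
      rw [er, er', map_smul, map_smul]
      simp only [LinearMap.smul_apply, smul_eq_mul]
      push_cast; ring
    simp only [Fintype.sum_prod_type, e3]
    simp only [← Finset.sum_mul]
    have := hxy j
    rw [show (∑ p, ∑ q, ((ψ p * ψ q * (x j p q * y j p q) : ℝ) : ℂ)) = ((∑ p, ∑ q, ψ p * ψ q * (x j p q * y j p q) : ℝ) : ℂ) by push_cast; rfl, this]
    simp
  rw [e, norm_mul, Complex.norm_real, Real.norm_of_nonneg (by positivity), inv_mul_le_iff₀ (by positivity)] at g
  linarith

end Jcb
end PIS
end Part8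

section Part9
namespace PIS

section Link
variable {A B X : Type u} [NonUnitalCStarAlgebra A] [PartialOrder A] [StarOrderedRing A]
  [NonUnitalCStarAlgebra B] [PartialOrder B] [StarOrderedRing B]
    [NonUnitalNormedRing X] [StarRing X] [NormedSpace ℂ X] [CompleteSpace X]
    {NA : ∀ p : ℕ, Matrix (Fin p) (Fin p) A → ℝ}
    {NB : ∀ q : ℕ, Matrix (Fin q) (Fin q) B → ℝ}
    (hNA : ∀ p, IsCStarNorm (NA p)) (hNB : ∀ q, IsCStarNorm (NB q))
    {ι : A ⊗[ℂ] B →ₗ[ℂ] X} (hX : IsTensorCompletion (osProjNorm NA NB) X ι)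

def phiOf (ι : A ⊗[ℂ] B →ₗ[ℂ] X) (Φ : X →L[ℂ] ℂ) : A →ₗ[ℂ] B →ₗ[ℂ] ℂ :=
  (TensorProduct.mk ℂ A B).compr₂ (Φ.toLinearMap ∘ₗ ι)

lemma phiOf_apply (ι : A ⊗[ℂ] B →ₗ[ℂ] X) (Φ : X →L[ℂ] ℂ) (a : A) (b : B) : phiOf ι Φ a b = Φ (ι (a ⊗ₜ b)) := rfl

include hNA hNB hX in
lemma jcb_phiOf (Φ : X →L[ℂ] ℂ) : JCB ‖Φ‖ (phiOf ι Φ) := by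
  classical
  intro I _ ψ V W hψ
  set α : I × I → ℂ := fun m => if m.1 = m.2 then (ψ m.1 : ℂ) else 0 with hα
  have key : ∀ (E : Type u) [AddCommGroup E] [Module ℂ E] (G : I → I → E), ∑ ik : I × I, (α ik) • G ik.1 ik.2 = ∑ i, (ψ i : ℂ) • G i i := by
    intro E _ _ G
    rw [Fintype.sum_prod_type]
    refine Finset.sum_congr rfl fun i _ => ?_
    rw [Finset.sum_eq_single i]
    · simp [hα]
    · intro j _ hj; simp [hα, hj.symm]
    · simp
  have hsum : ∑ ik : I × I, ‖α ik‖ ^ 2 = 1 := by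
    rw [← hψ, Fintype.sum_prod_type]
    refine Finset.sum_congr rfl fun i _ => ?_
    rw [Finset.sum_eq_single i]
    · simp [hα]
    · intro j _ hj; simp [hα, hj.symm]
    · simp
  have h := osProj_le hNA hNB V W α α
  rw [hsum, ← hX.norm_eq] at h
  simp only [mul_smul] at h
  have e : ∑ ik : I × I, ∑ jl : I × I, α ik • α jl • (V ik.1 jl.1 ⊗ₜ[ℂ] W ik.2 jl.2) =
      ∑ i, ∑ j, ((ψ i * ψ j : ℝ) : ℂ) • (V i j ⊗ₜ[ℂ] W i j) := by
    simp only [← Finset.smul_sum]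
    have : ∀ ik : I × I, ∑ jl : I × I, α jl • (V ik.1 jl.1 ⊗ₜ[ℂ] W ik.2 jl.2) = ∑ j, (ψ j : ℂ) • (V ik.1 j ⊗ₜ[ℂ] W ik.2 j) :=
      fun ik => key _ (fun j l => V ik.1 j ⊗ₜ[ℂ] W ik.2 l)
    simp only [this]
    rw [key _ (fun i k => ∑ j, (ψ j : ℂ) • (V i j ⊗ₜ[ℂ] W k j))]
    refine Finset.sum_congr rfl fun i _ => ?_
    rw [Finset.smul_sum]
    refine Finset.sum_congr rfl fun j _ => ?_
    rw [smul_smul]; push_cast; rfl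
  rw [e] at h
  have e2 : ∑ p, ∑ q, ((ψ p * ψ q : ℝ) : ℂ) • phiOf ι Φ (V p q) (W p q) = Φ (ι (∑ i, ∑ j, ((ψ i * ψ j : ℝ) : ℂ) • (V i j ⊗ₜ[ℂ] W i j))) := by
    simp only [map_sum, map_smul, phiOf_apply]
  rw [e2]
  refine (Φ.le_opNorm _).trans ?_
  have : 0 ≤ ‖Φ‖ := norm_nonneg _
  refine mul_le_mul_of_nonneg_left (h.trans ?_) this
  simp
end Link

section Lift
variable {A D : Type*} [NonUnitalCStarAlgebra A] [PartialOrder A] [StarOrderedRing A] [NonUnitalCStarAlgebra D]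

lemma lift_elem (π : A →⋆ₙₐ[ℂ] D) (h : A) (hh : 0 ≤ h) (r : ℝ) (hr : 0 < r) (hπ : ‖π h‖ ≤ r) :
    ∃ e : A, star e = e ∧ π e = 0 ∧ ‖h - e * h - h * e + e * h * e‖ ≤ r ∧ 0 ≤ e + e - e * e := by
  letI := CStarAlgebra.spectralOrder D
  letI := CStarAlgebra.spectralOrderedRing D
  set f : ℝ → ℝ := fun t => 1 - r / max t r with hf
  have hm : ∀ t, 0 < max t r := fun t => lt_max_of_lt_right hr
  have hfc : Continuous f := by
    refine continuous_const.sub (continuous_const.div (by fun_prop) fun t => (hm t).ne')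
  have hf0 : f 0 = 0 := by simp [hf, hr.le, hr.ne']
  have hf1 : ∀ t, 0 ≤ f t := fun t => by
    simp only [hf, sub_nonneg]; rw [div_le_one (hm t)]; exact le_max_right _ _
  have hf2 : ∀ t, f t ≤ 1 := fun t => by
    simp only [hf]; have : 0 ≤ r / max t r := by have := hm t; positivity
    linarith
  have hsa : IsSelfAdjoint h := hh.isSelfAdjoint
  set e := cfcₙ f h with he
  have hq : ∀ t ∈ quasispectrum ℝ (π h), t ≤ r := by
    intro t ht
    have hπsa : IsSelfAdjoint (π h) := hsa.map π
    have := norm_apply_le_norm_cfcₙ (𝕜 := ℝ) (fun x => x) (π h) ht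
    rw [cfcₙ_id' ℝ (π h)] at this
    exact (le_abs_self t).trans (this.trans hπ)
  have e1 : e * h = cfcₙ (fun t => f t * t) h := by
    rw [cfcₙ_mul f (fun t => t) h (by fun_prop) hf0 (by fun_prop) rfl, cfcₙ_id' ℝ h]
  have e2 : h * e = cfcₙ (fun t => f t * t) h := by
    rw [← e1]
    have := cfcₙ_commute_cfcₙ f (fun t => t) h
    rw [cfcₙ_id' ℝ h] at this
    exact this.eq.symm
  have e3 : e * h * e = cfcₙ (fun t => f t * (f t * t)) h := by
    rw [mul_assoc, e2, he, ← cfcₙ_mul f (fun t => f t * t) h (by fun_prop) hf0 (by fun_prop) (by simp)]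
  refine ⟨e, ?_, ?_, ?_, ?_⟩
  · exact (cfcₙ_predicate (p := IsSelfAdjoint) (R := ℝ) f h).star_eq
  · have hπc : Continuous π := map_continuous π
    have hπsa : IsSelfAdjoint (π h) := hsa.map π
    rw [he, NonUnitalStarAlgHomClass.map_cfcₙ (R := ℝ) (S := ℂ) π f h (by fun_prop) hf0 hπc hsa hπsa]
    rw [cfcₙ_congr (g := fun _ => 0), cfcₙ_const_zero]
    intro t ht
    have := hq t ht
    simp [hf, this, hr.ne']
  · have : h - e * h - h * e + e * h * e = cfcₙ (fun t => t - f t * t - f t * t + f t * (f t * t)) h := by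
      rw [e3, e1, e2]
      rw [cfcₙ_add (fun t => t - f t * t - f t * t) (fun t => f t * (f t * t)) h (by fun_prop) (by simp) (by fun_prop) (by simp)]
      rw [cfcₙ_sub (fun t => t - f t * t) (fun t => f t * t) h (by fun_prop) (by simp) (by fun_prop) (by simp)]
      rw [cfcₙ_sub (fun t => t) (fun t => f t * t) h (by fun_prop) (by simp) (by fun_prop) (by simp)]
      rw [cfcₙ_id' ℝ h]
    rw [this]
    refine norm_cfcₙ_le fun t ht => ?_
    have ht0 : 0 ≤ t := quasispectrum_nonneg_of_nonneg h hh t ht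
    have e4 : t - f t * t - f t * t + f t * (f t * t) = (r / max t r)^2 * t := by
      simp only [hf]; ring
    rw [e4, Real.norm_of_nonneg (by positivity)]
    have h1 := hm t
    rw [div_pow, div_mul_eq_mul_div, div_le_iff₀ (by positivity)]
    have h2 : t ≤ max t r := le_max_left _ _
    have h3 : r ≤ max t r := le_max_right _ _
    have : r * t ≤ max t r ^ 2 := by rw [pow_two]; exact mul_le_mul h3 h2 ht0 h1.le
    nlinarith
  · have : e + e - e * e = cfcₙ (fun t => f t + f t - f t * f t) h := by
      rw [cfcₙ_sub (fun t => f t + f t) (fun t => f t * f t) h (by fun_prop) (by simp [hf0]) (by fun_prop) (by simp [hf0])]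
      rw [cfcₙ_add f f h (by fun_prop) hf0 (by fun_prop) hf0]
      rw [cfcₙ_mul f f h (by fun_prop) hf0 (by fun_prop) hf0]
    rw [this]
    apply cfcₙ_nonneg
    intro t _
    nlinarith [hf1 t, hf2 t]

variable {J : Type*} [Fintype J]

lemma lift_half (π : A →⋆ₙₐ[ℂ] D) (a : J → A) (s t : J → ℝ) (hs : ∀ j, 0 ≤ s j) (ht : ∀ j, 0 ≤ t j) (r : ℝ) (hr : 0 < r)
    (h1 : ‖π (∑ j, s j • (a j * star (a j)))‖ ≤ r) :
    ∃ a' : J → A, (∀ j, π (a' j) = π (a j)) ∧ ‖∑ j, s j • (a' j * star (a' j))‖ ≤ r ∧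
      ‖∑ j, t j • (star (a' j) * a' j)‖ ≤ ‖∑ j, t j • (star (a j) * a j)‖ := by
  set h := ∑ j, s j • (a j * star (a j)) with hh
  obtain ⟨e, es, eπ, eh, en⟩ := lift_elem π h (Finset.sum_nonneg fun j _ => smul_nonneg (hs j) (mul_star_self_nonneg _)) r hr h1
  refine ⟨fun j => a j - e * a j, fun j => by simp [eπ], ?_, ?_⟩
  · convert eh using 2
    rw [hh]
    simp only [star_sub, star_mul, es, Finset.mul_sum, Finset.sum_mul, ← Finset.sum_sub_distrib, ← Finset.sum_add_distrib]
    refine Finset.sum_congr rfl fun j _ => ?_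
    simp only [mul_smul_comm, smul_mul_assoc, ← smul_sub, ← smul_add]
    congr 1
    noncomm_ring
  · apply row_le_of_le
    · exact Finset.sum_nonneg fun j _ => smul_nonneg (ht j) (star_mul_self_nonneg _)
    · refine Finset.sum_le_sum fun j _ => smul_le_smul_of_nonneg_left ?_ (ht j)
      have := star_left_conjugate_nonneg en (a j)
      rw [← sub_nonneg]
      convert this using 1
      simp only [star_sub, star_mul, es]
      noncomm_ring

lemma lift_family (π : A →⋆ₙₐ[ℂ] D) (a : J → A) (s t : J → ℝ) (hs : ∀ j, 0 ≤ s j) (ht : ∀ j, 0 ≤ t j) (r : ℝ) (hr : 0 < r)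
    (h1 : ‖π (∑ j, s j • (a j * star (a j)))‖ ≤ r) (h2 : ‖π (∑ j, t j • (star (a j) * a j))‖ ≤ r) :
    ∃ a' : J → A, (∀ j, π (a' j) = π (a j)) ∧ ‖∑ j, s j • (a' j * star (a' j))‖ ≤ r ∧
      ‖∑ j, t j • (star (a' j) * a' j)‖ ≤ r := by
  obtain ⟨a', ha', h3, -⟩ := lift_half π a s t hs ht r hr h1
  have er : ∀ (c : ℝ) (z : A), π (c • z) = c • π z := fun c z => map_smul π (c : ℂ) z
  have h4 : ‖π (∑ j, t j • (star (a' j) * star (star (a' j))))‖ ≤ r := by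
    convert h2 using 2
    simp [er, ha', map_star]
  obtain ⟨b, hb, h5, h6⟩ := lift_half π (fun j => star (a' j)) t s ht hs r hr h4
  refine ⟨fun j => star (b j), fun j => ?_, ?_, ?_⟩
  · simp [map_star, hb, ha']
  · simp only [star_star] at h6 ⊢; exact h6.trans h3
  · simpa using h5

end Lift

section S5
variable {A B : Type u} [NonUnitalCStarAlgebra A] [PartialOrder A] [StarOrderedRing A]
  [NonUnitalCStarAlgebra B] [PartialOrder B] [StarOrderedRing B] {D : Type*} [NonUnitalCStarAlgebra D]

lemma jcb_lift {K : ℝ} (hK : 0 ≤ K) {φ : A →ₗ[ℂ] B →ₗ[ℂ] ℂ} (hφ : JCB K φ) (π1 : A →⋆ₙₐ[ℂ] D) (π2 : B →⋆ₙₐ[ℂ] D)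
    (v1 : ∀ a b, π1 a = 0 → φ a b = 0) (v2 : ∀ a b, π2 b = 0 → φ a b = 0)
    {J : Type*} [Fintype J] (a : J → A) (b : J → B)
    (t : J → ℝ) (ht : ∀ j, 0 < t j) (r : ℝ) (hr : 0 < r)
    (h1 : ‖π1 (∑ j, a j * star (a j))‖ ≤ r) (h2 : ‖π1 (∑ j, t j • (star (a j) * a j))‖ ≤ r)
    (h3 : ‖π2 (∑ j, star (b j) * b j)‖ ≤ r) (h4 : ‖π2 (∑ j, (t j)⁻¹ • (b j * star (b j)))‖ ≤ r) :
    ‖∑ j, φ (a j) (b j)‖ ≤ 424 * K * (3 * r) := by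
  obtain ⟨a', ha, h1', h2'⟩ := lift_family π1 a (fun _ => 1) t (fun _ => zero_le_one) (fun j => (ht j).le) r hr (by simpa using h1) h2
  obtain ⟨b', hb, h4', h3'⟩ := lift_family π2 b (fun j => (t j)⁻¹) (fun _ => 1) (fun j => (inv_pos.mpr (ht j)).le) (fun _ => zero_le_one) r hr h4 (by simpa using h3)
  have := jcb_bound hK hφ a' b' t ht r hr (by simpa using h1') h2' (by simpa using h3') h4'
  have e : ∑ j, φ (a j) (b j) = ∑ j, φ (a' j) (b' j) := ?_
  · rwa [e]
  refine Finset.sum_congr rfl fun j _ => ?_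
  have e1 := v1 (a j - a' j) (b j) (by rw [map_sub, ha, sub_self])
  have e2 := v2 (a' j) (b j - b' j) (by rw [map_sub, hb, sub_self])
  simp only [map_sub, LinearMap.sub_apply] at e1 e2
  rw [sub_eq_zero.mp e1, sub_eq_zero.mp e2]

end S5
end PIS
end Part9

section Part10
namespace PIS

open Matrix ComplexOrder in
lemma diagonalize {n : Type*} [Fintype n] [DecidableEq n] (G : Matrix n n ℂ) (hG : G.PosDef) :
    ∃ (U : Matrix n n ℂ) (t : n → ℝ), (∀ i, 0 < t i) ∧ Uᴴ * U = 1 ∧ Uᴴ * G * U = diagonal (fun i => (t i : ℂ)) := by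
  refine ⟨hG.1.eigenvectorUnitary, hG.1.eigenvalues, hG.eigenvalues_pos, ?_, ?_⟩
  · exact Unitary.coe_star_mul_self hG.1.eigenvectorUnitary
  · have h := hG.1.spectral_theorem
    set U := hG.1.eigenvectorUnitary
    have hu : (U : Matrix n n ℂ)ᴴ * (U : Matrix n n ℂ) = 1 := Unitary.coe_star_mul_self U
    rw [Unitary.conjStarAlgAut_apply] at h
    set Dg := diagonal (RCLike.ofReal ∘ hG.1.eigenvalues : n → ℂ) with hD
    have : (U : Matrix n n ℂ)ᴴ * G * U = (U : Matrix n n ℂ)ᴴ * ((U : Matrix n n ℂ) * Dg * (U : Matrix n n ℂ)ᴴ) * U := by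
      conv_lhs => rw [h]
      rfl
    rw [this]
    calc _ = ((U : Matrix n n ℂ)ᴴ * (U : Matrix n n ℂ)) * Dg * ((U : Matrix n n ℂ)ᴴ * U) := by simp only [Matrix.mul_assoc]
      _ = _ := by rw [hu]; simp [hD]

open Matrix ComplexOrder in
lemma simul_diag {n : Type*} [Fintype n] [DecidableEq n] (G1 G2 : Matrix n n ℂ) (h1 : G1.PosDef) (h2 : G2.PosDef) :
    ∃ (P Q : Matrix n n ℂ) (t : n → ℝ), (∀ i, 0 < t i) ∧ P * Q = 1 ∧ Pᴴ * G1 * P = 1 ∧ Pᴴ * G2 * P = diagonal (fun i => (t i : ℂ)) := by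
  obtain ⟨U, d, hd, hU, hUG⟩ := diagonalize G1 h1
  set S := U * diagonal (fun i => (((√(d i))⁻¹ : ℝ) : ℂ)) with hS
  have hdg : (diagonal (fun i => (((√(d i))⁻¹ : ℝ) : ℂ)))ᴴ = diagonal (fun i => (((√(d i))⁻¹ : ℝ) : ℂ)) := by
    rw [diagonal_conjTranspose]; congr 1; funext i; simp
  have hSG : Sᴴ * G1 * S = 1 := by
    rw [hS, conjTranspose_mul, hdg]
    calc _ = diagonal (fun i => (((√(d i))⁻¹ : ℝ) : ℂ)) * (Uᴴ * G1 * U) * diagonal (fun i => (((√(d i))⁻¹ : ℝ) : ℂ)) := by simp only [Matrix.mul_assoc]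
      _ = 1 := by
        rw [hUG, diagonal_mul_diagonal, diagonal_mul_diagonal, ← diagonal_one]
        congr 1; funext i
        rw [← Complex.ofReal_mul, ← Complex.ofReal_mul]
        have := hd i
        have h3 : √(d i) * √(d i) = d i := Real.mul_self_sqrt this.le
        have : √(d i) ≠ 0 := by positivity
        rw [show (√(d i))⁻¹ * d i * (√(d i))⁻¹ = 1 by rw [← h3]; field_simp; simp [h3]]
        simp
  have hSinj : Function.Injective S.mulVec := by
    have hl : (Sᴴ * G1) * S = 1 := hSG
    intro x y hxy
    have := congrArg (fun z => (Sᴴ * G1).mulVec z) hxy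
    simpa [Matrix.mulVec_mulVec, hl] using this
  have h2' : (Sᴴ * G2 * S).PosDef := h2.conjTranspose_mul_mul_same hSinj
  obtain ⟨V, t, ht, hV, hVG⟩ := diagonalize _ h2'
  have e1 : (S * V)ᴴ * G1 * (S * V) = 1 := by
    rw [conjTranspose_mul]
    calc _ = Vᴴ * (Sᴴ * G1 * S) * V := by simp only [Matrix.mul_assoc]
      _ = 1 := by rw [hSG]; simpa using hV
  refine ⟨S * V, (S * V)ᴴ * G1, t, ht, ?_, e1, ?_⟩
  · exact mul_eq_one_comm.mp e1
  · rw [conjTranspose_mul]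
    calc _ = Vᴴ * (Sᴴ * G2 * S) * V := by simp only [Matrix.mul_assoc]
      _ = _ := hVG

section Bessel
variable {D : Type*} [NonUnitalCStarAlgebra D] {I L : Type*} [Fintype I] [Fintype L]

open Matrix

lemma comb_row (O : Matrix I L ℂ) (z : I → D) :
    ∑ l, (∑ i, star (O i l) • z i) * star (∑ i, star (O i l) • z i) = ∑ i, ∑ j, star ((O * Oᴴ) i j) • (z i * star (z j)) := by
  simp only [star_sum, star_smul, star_star, Finset.sum_mul_sum, smul_mul_smul_comm]
  rw [Finset.sum_comm]
  refine Finset.sum_congr rfl fun i _ => ?_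
  rw [Finset.sum_comm]
  refine Finset.sum_congr rfl fun j _ => ?_
  rw [← Finset.sum_smul]
  congr 1
  simp [Matrix.mul_apply, star_sum, mul_comm]

lemma bessel_r [DecidableEq L] (O : Matrix I L ℂ) (hO : Oᴴ * O = 1) (z : I → D) :
    rsq (fun l => ∑ i, star (O i l) • z i) ≤ rsq z := by
  classical
  letI := CStarAlgebra.spectralOrder D
  letI := CStarAlgebra.spectralOrderedRing D
  unfold rsq
  apply row_le_of_le (sum_mul_star_nonneg _)
  have hP : (O * Oᴴ) * (O * Oᴴ) = O * Oᴴ := by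
    calc _ = O * (Oᴴ * O) * Oᴴ := by simp only [Matrix.mul_assoc]
      _ = _ := by rw [hO, Matrix.mul_one]
  have hQ : O * Oᴴ + (1 - O * Oᴴ) * (1 - O * Oᴴ)ᴴ = 1 := by
    rw [conjTranspose_sub, conjTranspose_mul, conjTranspose_conjTranspose, conjTranspose_one, Matrix.sub_mul, Matrix.mul_sub, Matrix.mul_sub, hP]
    simp
  have e : ∑ i, z i * star (z i) = ∑ l, (∑ i, star (O i l) • z i) * star (∑ i, star (O i l) • z i) +
      ∑ l, (∑ i, star ((1 - O * Oᴴ : Matrix I I ℂ) i l) • z i) * star (∑ i, star ((1 - O * Oᴴ : Matrix I I ℂ) i l) • z i) := by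
    rw [comb_row, comb_row, ← Finset.sum_add_distrib]
    refine Finset.sum_congr rfl fun i _ => ?_
    rw [← Finset.sum_add_distrib]
    simp only [← add_smul, ← star_add, ← Matrix.add_apply, hQ]
    simp [Matrix.one_apply]
  rw [e]
  exact le_add_of_nonneg_right (sum_mul_star_nonneg _)

lemma bessel_c' [DecidableEq L] (O : Matrix I L ℂ) (hO : Oᴴ * O = 1) (z : I → D) :
    csq (fun l => ∑ i, (O i l) • z i) ≤ csq z := by
  have := bessel_r O hO (fun i => star (z i))
  rw [rsq_star] at this
  rw [← rsq_star]
  convert this using 2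
  funext l
  simp [star_sum]

lemma conj_isom [DecidableEq L] {O : Matrix I L ℂ} (hO : Oᴴ * O = 1) : (O.map star)ᴴ * (O.map star) = 1 := by
  have := congrArg (fun M => M.map (starRingEnd ℂ)) hO
  simp only [Matrix.map_mul] at this
  convert this using 1
  · congr 1
  · exact (Matrix.map_one _ (map_zero _) (map_one _)).symm

lemma bessel_c [DecidableEq L] (O : Matrix I L ℂ) (hO : Oᴴ * O = 1) (z : I → D) :
    csq (fun l => ∑ i, star (O i l) • z i) ≤ csq z := by
  simpa using bessel_c' (O.map star) (conj_isom hO) z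

lemma bessel_r' [DecidableEq L] (O : Matrix I L ℂ) (hO : Oᴴ * O = 1) (z : I → D) :
    rsq (fun l => ∑ i, (O i l) • z i) ≤ rsq z := by
  simpa using bessel_r (O.map star) (conj_isom hO) z

end Bessel
end PIS
end Part10

section Part11
namespace PIS
section S6
variable {A B : Type u} [NonUnitalCStarAlgebra A] [PartialOrder A] [StarOrderedRing A] [NonUnitalCStarAlgebra B] [PartialOrder B] [StarOrderedRing B]
variable {D : Type*} [NonUnitalCStarAlgebra D]

lemma comb_matrix {V I L M : Type*} [AddCommGroup V] [Module ℂ V] [Fintype I] [Fintype L] [Fintype M]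
    (X : Matrix L M ℂ) (Y : Matrix M I ℂ) (e : I → V) (l : L) :
    ∑ m, X l m • ∑ i, Y m i • e i = ∑ i, (X * Y) l i • e i := by
  simp only [Finset.smul_sum, smul_smul]
  rw [Finset.sum_comm]
  simp only [← Finset.sum_smul, Matrix.mul_apply]

open Matrix ComplexOrder in
lemma common_core {K : ℝ} {φ : A →ₗ[ℂ] B →ₗ[ℂ] ℂ} (hK : 0 ≤ K) (hφ : JCB K φ) (π1 : A →⋆ₙₐ[ℂ] D) (π2 : B →⋆ₙₐ[ℂ] D)
    (v1 : ∀ a b, π1 a = 0 → φ a b = 0) (v2 : ∀ a b, π2 b = 0 → φ a b = 0)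
    {I J L : Type} [Fintype I] [Fintype J] [Fintype L] [DecidableEq L]
    (a : I → A) (b : I → B) (c : J → A) (d : J → B) (e : L → A) (f : L → B)
    (α : Matrix I L ℂ) (γ : Matrix J L ℂ)
    (ha : ∀ i, a i = ∑ l, α i l • e l) (hc : ∀ k, c k = ∑ l, γ k l • e l)
    (hb : ∀ l, f l = ∑ i, α i l • b i) (hd : ∀ l, f l = ∑ k, γ k l • d k)
    (hα : Function.Injective α.mulVec) (hγ : Function.Injective γ.mulVec)
    (r : ℝ) (hr : 0 < r) (h1 : rsq (fun i => π1 (a i)) ≤ r) (h2 : csq (fun i => π1 (c i)) ≤ r)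
    (h3 : csq (fun i => π2 (b i)) ≤ r) (h4 : rsq (fun i => π2 (d i)) ≤ r) :
    ‖∑ i, φ (a i) (b i)‖ ≤ 424 * K * (3 * r) := by
  obtain ⟨P, Q, t, ht, hPQ, hP1, hP2⟩ := simul_diag (αᴴ * α) (γᴴ * γ)
    (Matrix.PosDef.conjTranspose_mul_self α hα) (Matrix.PosDef.conjTranspose_mul_self γ hγ)
  set O := α * P with hO
  set W := γ * P with hW
  have hOO : Oᴴ * O = 1 := by
    rw [hO, conjTranspose_mul, ← hP1]; simp only [Matrix.mul_assoc]
  have hWW : Wᴴ * W = diagonal (fun i => (t i : ℂ)) := by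
    rw [hW, conjTranspose_mul, ← hP2]; simp only [Matrix.mul_assoc]
  have hOQ : O * Q = α := by rw [hO, Matrix.mul_assoc, hPQ, Matrix.mul_one]
  have hWQ : W * Q = γ := by rw [hW, Matrix.mul_assoc, hPQ, Matrix.mul_one]
  set e' : L → A := fun l => ∑ j, Q l j • e j with he'
  set b' : L → B := fun l => ∑ i, O i l • b i with hb'
  have E1 : ∀ l, e' l = ∑ i, star (O i l) • a i := by
    intro l
    have := comb_matrix Oᴴ α e l
    simp only [← ha] at this
    rw [← hOQ, ← Matrix.mul_assoc, hOO, Matrix.one_mul] at this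
    exact this.symm
  have E2 : ∀ l, (t l : ℂ) • e' l = ∑ k, star (W k l) • c k := by
    intro l
    have := comb_matrix Wᴴ γ e l
    simp only [← hc] at this
    rw [← hWQ, ← Matrix.mul_assoc, hWW] at this
    simp only [Matrix.diagonal_mul, mul_smul, ← Finset.smul_sum] at this
    exact this.symm
  have E3 : ∀ l, b' l = ∑ k, W k l • d k := by
    intro l
    have x1 := comb_matrix Pᵀ αᵀ b l
    have x2 := comb_matrix Pᵀ γᵀ d l
    simp only [Matrix.transpose_apply, ← hb, ← hd, ← Matrix.transpose_mul, ← hO, ← hW] at x1 x2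
    rw [hb']; simp only
    rw [← x1, x2]
  have E4 : ∀ i, a i = ∑ l, O i l • e' l := by
    intro i
    have := comb_matrix O Q e i
    rw [hOQ] at this
    rw [ha i, ← this]
  have key : ∑ i, φ (a i) (b i) = ∑ l, φ (e' l) (b' l) := by
    simp only [E4, hb', map_sum, map_smul, LinearMap.sum_apply, LinearMap.smul_apply]
    rw [Finset.sum_comm]
  set s : L → ℝ := fun l => (√(t l))⁻¹ with hs
  have hst : ∀ l, s l * t l * s l = 1 := by
    intro l
    have h3 : √(t l) * √(t l) = t l := Real.mul_self_sqrt (ht l).le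
    have : √(t l) ≠ 0 := (Real.sqrt_pos.2 (ht l)).ne'
    simp only [hs]
    rw [← h3]; field_simp; simp [h3]
  set W' : Matrix J L ℂ := W * diagonal (fun l => (s l : ℂ)) with hW'
  have hWi : W'ᴴ * W' = 1 := by
    rw [hW', conjTranspose_mul, diagonal_conjTranspose]
    calc _ = diagonal (star fun l => (s l : ℂ)) * (Wᴴ * W) * diagonal (fun l => (s l : ℂ)) := by simp only [Matrix.mul_assoc]
      _ = 1 := by
        rw [hWW, diagonal_mul_diagonal, diagonal_mul_diagonal, ← diagonal_one]
        congr 1; funext l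
        simp only [Pi.star_apply, RCLike.star_def, Complex.conj_ofReal]
        rw [← Complex.ofReal_mul, ← Complex.ofReal_mul, hst]; simp
  have hW'a : ∀ k l, W' k l = W k l * s l := fun k l => by rw [hW', Matrix.mul_diagonal]
  have F2 : ∀ l, ((s l * t l : ℝ) : ℂ) • π1 (e' l) = ∑ k, star (W' k l) • π1 (c k) := by
    intro l
    have := congrArg (fun z => (s l : ℂ) • π1 z) (E2 l)
    simp only [map_smul, map_sum, smul_smul, Finset.smul_sum] at this
    rw [Complex.ofReal_mul, this]
    refine Finset.sum_congr rfl fun k _ => ?_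
    rw [hW'a]; simp [mul_comm]
  have F3 : ∀ l, (s l : ℂ) • π2 (b' l) = ∑ k, W' k l • π2 (d k) := by
    intro l
    have := congrArg (fun z => (s l : ℂ) • π2 z) (E3 l)
    simp only [map_smul, map_sum, smul_smul, Finset.smul_sum] at this
    rw [this]
    refine Finset.sum_congr rfl fun k _ => ?_
    rw [hW'a]; simp [mul_comm]
  rw [key]
  refine jcb_lift hK hφ π1 π2 v1 v2 e' b' t ht r hr ?_ ?_ ?_ ?_
  · have := (bessel_r O hOO (fun i => π1 (a i))).trans h1
    unfold rsq at this
    refine le_trans (le_of_eq (congrArg norm ?_)) this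
    simp only [map_sum, map_mul, map_star, E1, map_smul]
  · have := (bessel_c W' hWi (fun i => π1 (c i))).trans h2
    simp only [← F2] at this
    unfold csq at this
    refine le_trans (le_of_eq (congrArg norm ?_)) this
    rw [map_sum]
    refine Finset.sum_congr rfl fun l _ => ?_
    show π1 ((t l : ℂ) • _) = _
    rw [map_smul, map_mul, map_star, star_smul, smul_mul_smul_comm]
    congr 1
    simp only [RCLike.star_def, Complex.conj_ofReal]
    rw [← Complex.ofReal_mul]
    congr 1
    linear_combination (-t l) * hst l
  · have := (bessel_c' O hOO (fun i => π2 (b i))).trans h3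
    unfold csq at this
    refine le_trans (le_of_eq (congrArg norm ?_)) this
    simp only [map_sum, map_mul, map_star, hb', map_smul]
  · have := (bessel_r' W' hWi (fun i => π2 (d i))).trans h4
    simp only [← F3] at this
    unfold rsq at this
    refine le_trans (le_of_eq (congrArg norm ?_)) this
    rw [map_sum]
    refine Finset.sum_congr rfl fun l _ => ?_
    show π2 ((((t l)⁻¹ : ℝ) : ℂ) • _) = _
    rw [map_smul, map_mul, map_star, star_smul, smul_mul_smul_comm]
    congr 1
    simp only [RCLike.star_def, Complex.conj_ofReal]
    rw [← Complex.ofReal_mul]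
    congr 1
    have := hst l
    have h5 := (ht l).ne'
    field_simp
    linear_combination -hst l

lemma common_rep {K : ℝ} {φ : A →ₗ[ℂ] B →ₗ[ℂ] ℂ} (hK : 0 ≤ K) (hφ : JCB K φ) (π1 : A →⋆ₙₐ[ℂ] D) (π2 : B →⋆ₙₐ[ℂ] D)
    (v1 : ∀ a b, π1 a = 0 → φ a b = 0) (v2 : ∀ a b, π2 b = 0 → φ a b = 0)
    {I J : Type} [Fintype I] [Fintype J]
    (a : I → A) (b : I → B) (c : J → A) (d : J → B) (heq : ∑ i, a i ⊗ₜ[ℂ] b i = ∑ k, c k ⊗ₜ[ℂ] d k)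
    (r : ℝ) (hr : 0 < r) (h1 : rsq (fun i => π1 (a i)) ≤ r) (h2 : csq (fun i => π1 (c i)) ≤ r)
    (h3 : csq (fun i => π2 (b i)) ≤ r) (h4 : rsq (fun i => π2 (d i)) ≤ r) :
    ‖∑ i, φ (a i) (b i)‖ ≤ 424 * K * (3 * (2 * r)) := by
  classical
  set V : Submodule ℂ A := Submodule.span ℂ (Set.range a ∪ Set.range c) with hV
  haveI : FiniteDimensional ℂ V := FiniteDimensional.span_of_finite ℂ ((Set.finite_range a).union (Set.finite_range c))
  let bs := Module.finBasis ℂ V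
  set n := Module.finrank ℂ V
  have hext : ∀ j, ∃ g : A →ₗ[ℂ] ℂ, g ∘ₗ V.subtype = bs.coord j := fun j => LinearMap.exists_extend _
  choose ξ hξ using hext
  have haV : ∀ i, a i ∈ V := fun i => Submodule.subset_span (Or.inl ⟨i, rfl⟩)
  have hcV : ∀ i, c i ∈ V := fun i => Submodule.subset_span (Or.inr ⟨i, rfl⟩)
  have hrep : ∀ x ∈ V, x = ∑ j, ξ j x • (bs j : A) := by
    intro x hx
    have h := congrArg (Subtype.val) (bs.sum_repr ⟨x, hx⟩)
    simp only [Submodule.coe_sum, Submodule.coe_smul] at h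
    refine h.symm.trans (Finset.sum_congr rfl fun j _ => ?_)
    have := LinearMap.congr_fun (hξ j) ⟨x, hx⟩
    simp only [LinearMap.comp_apply, Submodule.subtype_apply, Module.Basis.coord_apply] at this
    rw [this]
  have hf : ∀ j, ∑ i, ξ j (a i) • b i = ∑ k, ξ j (c k) • d k := by
    intro j
    have := congrArg (fun z => TensorProduct.lid ℂ B (LinearMap.rTensor B (ξ j) z)) heq
    simpa [map_sum] using this
  set M := ‖∑ j, π1 (bs j : A) * star (π1 (bs j : A))‖ + ‖∑ j, star (π1 (bs j : A)) * π1 (bs j : A)‖ with hM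
  have hM0 : 0 ≤ M := by positivity
  set δ : ℝ := √(r / (M + 1)) with hδ
  have hδ0 : 0 < δ := Real.sqrt_pos.2 (by positivity)
  have hδ2 : δ * δ = r / (M + 1) := Real.mul_self_sqrt (by positivity)
  have hδM : δ * δ * M ≤ r := by
    rw [hδ2, div_mul_eq_mul_div, div_le_iff₀ (by positivity)]
    nlinarith
  have hδc : (δ : ℂ) ≠ 0 := by exact_mod_cast hδ0.ne'
  let a' : I ⊕ Fin n → A := Sum.elim a (fun j => (δ : ℂ) • (bs j : A))
  let b' : I ⊕ Fin n → B := Sum.elim b (fun _ => 0)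
  let c' : J ⊕ Fin n → A := Sum.elim c (fun j => (δ : ℂ) • (bs j : A))
  let d' : J ⊕ Fin n → B := Sum.elim d (fun _ => 0)
  let α : Matrix (I ⊕ Fin n) (Fin n) ℂ := Matrix.of (Sum.elim (fun i j => ξ j (a i)) (fun i j => if i = j then (δ : ℂ) else 0))
  let γ : Matrix (J ⊕ Fin n) (Fin n) ℂ := Matrix.of (Sum.elim (fun i j => ξ j (c i)) (fun i j => if i = j then (δ : ℂ) else 0))
  have hsum : ∑ i, φ (a i) (b i) = ∑ i, φ (a' i) (b' i) := by
    simp [Fintype.sum_sum_type, a', b']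
  rw [hsum]
  refine common_core hK hφ π1 π2 v1 v2 a' b' c' d' (fun j => (bs j : A)) (fun j => ∑ i, ξ j (a i) • b i) α γ ?_ ?_ ?_ ?_ ?_ ?_ (2 * r) (by linarith) ?_ ?_ ?_ ?_
  · rintro (i | j)
    · simpa [a', α] using hrep _ (haV i)
    · simp [a', α]
  · rintro (i | j)
    · simpa [c', γ] using hrep _ (hcV i)
    · simp [c', γ]
  · intro l; simp [Fintype.sum_sum_type, b', α]
  · intro l; rw [hf l]; simp [Fintype.sum_sum_type, d', γ]
  · intro x y hxy
    funext j
    have := congrFun hxy (Sum.inr j)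
    simpa [Matrix.mulVec, dotProduct, α, hδc] using this
  · intro x y hxy
    funext j
    have := congrFun hxy (Sum.inr j)
    simpa [Matrix.mulVec, dotProduct, γ, hδc] using this
  · unfold rsq at h1 ⊢
    rw [Fintype.sum_sum_type]
    refine (norm_add_le _ _).trans ?_
    have e : ∑ j, π1 (a' (Sum.inr j)) * star (π1 (a' (Sum.inr j))) = ((δ * δ : ℝ) : ℂ) • ∑ j, π1 (bs j : A) * star (π1 (bs j : A)) := by
      simp only [a', Sum.elim_inr, Finset.smul_sum, map_smul, star_smul, smul_mul_smul_comm, RCLike.star_def, Complex.conj_ofReal, Complex.ofReal_mul]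
    rw [e, norm_smul, Complex.norm_real, Real.norm_of_nonneg (by positivity)]
    have h9 : δ * δ * ‖∑ j, π1 (bs j : A) * star (π1 (bs j : A))‖ ≤ r := le_trans (by gcongr; rw [hM]; linarith [norm_nonneg (∑ j, star (π1 (bs j : A)) * π1 (bs j : A))]) hδM
    have h10 : ‖∑ i, π1 (a' (Sum.inl i)) * star (π1 (a' (Sum.inl i)))‖ ≤ r := h1
    linarith
  · unfold csq at h2 ⊢
    rw [Fintype.sum_sum_type]
    refine (norm_add_le _ _).trans ?_
    have e : ∑ j, star (π1 (c' (Sum.inr j))) * (π1 (c' (Sum.inr j))) = ((δ * δ : ℝ) : ℂ) • ∑ j, star (π1 (bs j : A)) * (π1 (bs j : A)) := by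
      simp only [c', Sum.elim_inr, Finset.smul_sum, map_smul, star_smul, smul_mul_smul_comm, RCLike.star_def, Complex.conj_ofReal, Complex.ofReal_mul]
    rw [e, norm_smul, Complex.norm_real, Real.norm_of_nonneg (by positivity)]
    have h9 : δ * δ * ‖∑ j, star (π1 (bs j : A)) * (π1 (bs j : A))‖ ≤ r := le_trans (by gcongr; rw [hM]; linarith [norm_nonneg (∑ j, (π1 (bs j : A)) * star (π1 (bs j : A)))]) hδM
    have h10 : ‖∑ i, star (π1 (c' (Sum.inl i))) * (π1 (c' (Sum.inl i)))‖ ≤ r := h2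
    linarith
  · unfold csq at h3 ⊢
    rw [Fintype.sum_sum_type]
    simp only [b', Sum.elim_inl, Sum.elim_inr, map_zero, mul_zero, Finset.sum_const_zero, add_zero]
    linarith
  · unfold rsq at h4 ⊢
    rw [Fintype.sum_sum_type]
    simp only [d', Sum.elim_inl, Sum.elim_inr, map_zero, zero_mul, Finset.sum_const_zero, add_zero]
    linarith

end S6
end PIS
end Part11

section Part12
namespace PIS
open Filter Topology

section SL
variable {H : Type*} [NormedAddCommGroup H] [InnerProductSpace ℂ H] [CompleteSpace H]

lemma strong_lim {Y : Type*} {l : Filter Y} [l.NeBot] (S : Y → H →L[ℂ] H) (C : ℝ) (hC : ∀ᶠ y in l, ‖S y‖ ≤ C)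
    (V : Set H) (hV : Dense (Submodule.span ℂ V : Set H)) (hl : ∀ v ∈ V, ∃ w, Tendsto (fun y => S y v) l (𝓝 w)) :
    ∃ T : H →L[ℂ] H, ∀ v, Tendsto (fun y => S y v) l (𝓝 (T v)) := by
  have hC0 : 0 ≤ C := by
    obtain ⟨y, hy⟩ := hC.exists
    exact (norm_nonneg _).trans hy
  have h1 : ∀ v ∈ Submodule.span ℂ V, ∃ w, Tendsto (fun y => S y v) l (𝓝 w) := by
    intro v hv
    induction hv using Submodule.span_induction with
    | mem x hx => exact hl x hx
    | zero => exact ⟨0, by simp⟩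
    | add x y _ _ hx hy =>
      obtain ⟨w, hw⟩ := hx
      obtain ⟨w', hw'⟩ := hy
      exact ⟨w + w', by simpa using hw.add hw'⟩
    | smul c x _ hx =>
      obtain ⟨w, hw⟩ := hx
      exact ⟨c • w, by simpa using hw.const_smul c⟩
  have h2 : ∀ v, ∃ w, Tendsto (fun y => S y v) l (𝓝 w) := by
    intro v
    have hcau : Cauchy (map (fun y => S y v) l) := by
      rw [Metric.cauchy_iff]
      refine ⟨inferInstance, fun ε hε => ?_⟩
      have hδ : 0 < ε / (4 * (C + 1)) := by positivity
      obtain ⟨v', hv', hd⟩ := Metric.dense_iff.1 hV v _ hδ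
      obtain ⟨w, hw⟩ := h1 v' hd
      rw [Metric.mem_ball, dist_comm, dist_eq_norm] at hv'
      have hw2 := (Metric.tendsto_nhds.1 hw) (ε / 4) (by positivity)
      refine ⟨_, image_mem_map (hw2.and hC), ?_⟩
      have key : ∀ y, (dist (S y v') w < ε / 4 ∧ ‖S y‖ ≤ C) → dist (S y v) w < ε / 2 := by
        rintro y ⟨h3, h4⟩
        have h5 : ‖S y v - S y v'‖ ≤ ε / 4 := by
          rw [← map_sub]
          refine ((S y).le_opNorm _).trans ?_
          calc ‖S y‖ * ‖v - v'‖ ≤ (C + 1) * (ε / (4 * (C + 1))) := by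
                gcongr
                linarith
            _ = ε / 4 := by field_simp
        have := dist_triangle (S y v) (S y v') w
        rw [dist_eq_norm (S y v) (S y v')] at this
        linarith
      rintro _ ⟨y, hy, rfl⟩ _ ⟨z, hz, rfl⟩
      have := dist_triangle_right (S y v) (S z v) w
      linarith [key y hy, key z hz]
    exact cauchy_map_iff_exists_tendsto.1 hcau
  choose f hf using h2
  let T0 : H →ₗ[ℂ] H := linearMapOfTendsto f (fun y => (S y : H →ₗ[ℂ] H)) (tendsto_pi_nhds.2 hf)
  refine ⟨T0.mkContinuous C ?_, hf⟩
  intro v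
  refine le_of_tendsto (hf v).norm ?_
  filter_upwards [hC] with y hy
  exact (S y).le_of_opNorm_le hy v

/-- abstract multiplier representation -/
lemma mult_rep {C R : Type*} [NonUnitalCStarAlgebra C] (P : R → H →L[ℂ] H)
    (hext : ∀ T T' : H →L[ℂ] H, (∀ i, T * P i = T' * P i) → T = T')
    (act : C → R → R) (hT : ∀ c, ∃ T : H →L[ℂ] H, ∀ i, T * P i = P (act c i))
    (hadd : ∀ c d i, P (act (c + d) i) = P (act c i) + P (act d i))
    (hsmul : ∀ (k : ℂ) c i, P (act (k • c) i) = k • P (act c i))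
    (hmul : ∀ c d i, act (c * d) i = act c (act d i))
    (hstar : ∀ c i j, star (P j) * P (act c i) = star (P (act (star c) j)) * P i) :
    ∃ σ : C →⋆ₙₐ[ℂ] (H →L[ℂ] H), ∀ c i, σ c * P i = P (act c i) := by
  choose T hT using hT
  refine ⟨{ toFun := T, map_smul' := ?_, map_zero' := ?_, map_add' := ?_, map_mul' := ?_, map_star' := ?_ }, hT⟩
  · intro k c
    apply hext; intro i
    simp only [MonoidHom.id_apply]
    rw [hT, hsmul, smul_mul_assoc, hT]
  · apply hext; intro i
    have := hsmul 0 0 i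
    rw [zero_smul, zero_smul] at this
    rw [hT, zero_mul, this]
  · intro c d
    apply hext; intro i
    rw [hT, add_mul, hT, hT, hadd]
  · intro c d
    apply hext; intro i
    rw [hT, mul_assoc, hT, hT, hmul]
  · intro c
    have h1 : ∀ j, star (P j) * T (star c) = star (P j) * star (T c) := by
      intro j
      apply hext; intro i
      rw [mul_assoc, hT, hstar, star_star, ← star_mul, hT]
    apply star_injective
    apply hext
    intro i
    have := congrArg star (h1 i)
    rwa [star_mul, star_mul, star_star] at this
end SL

section S1
variable {A B X : Type u} [NonUnitalCStarAlgebra A] [PartialOrder A] [StarOrderedRing A]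
  [NonUnitalCStarAlgebra B] [PartialOrder B] [StarOrderedRing B]
  [NonUnitalNormedRing X] [StarRing X] [NormedSpace ℂ X] [CompleteSpace X]
  [IsScalarTower ℂ X X] [SMulCommClass ℂ X X]
  {NA : ∀ p : ℕ, Matrix (Fin p) (Fin p) A → ℝ} {NB : ∀ q : ℕ, Matrix (Fin q) (Fin q) B → ℝ}
  (hNA : ∀ p, IsCStarNorm (NA p)) (hNB : ∀ q, IsCStarNorm (NB q))
  {ι : A ⊗[ℂ] B →ₗ[ℂ] X} (hX : IsTensorCompletion (osProjNorm NA NB) X ι)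
  {H : Type u} [NormedAddCommGroup H] [InnerProductSpace ℂ H] [CompleteSpace H]
  (π : X →⋆ₙₐ[ℂ] (H →L[ℂ] H)) (hc : Continuous π)
  (hnz : ∃ y, π y ≠ 0)
  (hirr : ∀ S : Submodule ℂ H, IsClosed (S : Set H) → (∀ y : X, ∀ v ∈ S, π y v ∈ S) → S = ⊥ ∨ S = ⊤)

include hNA hNB hX in
lemma norm_tmul_le (a : A) (b : B) : ‖ι (a ⊗ₜ[ℂ] b)‖ ≤ ‖a‖ * ‖b‖ := by
  rw [hX.norm_eq]; exact osProj_tmul_le hNA hNB a b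

include hNA hNB hX in
lemma cont_tmul_right (a : A) : Continuous (fun b : B => ι (a ⊗ₜ[ℂ] b)) := by
  let L : B →ₗ[ℂ] X := ι ∘ₗ (TensorProduct.mk ℂ A B a)
  exact (L.mkContinuous ‖a‖ (fun b => norm_tmul_le hNA hNB hX a b)).continuous

include hNA hNB hX in
lemma cont_tmul_left (b : B) : Continuous (fun a : A => ι (a ⊗ₜ[ℂ] b)) := by
  let L : A →ₗ[ℂ] X := ι ∘ₗ ((TensorProduct.mk ℂ A B).flip b)
  exact (L.mkContinuous ‖b‖ (fun a => (norm_tmul_le hNA hNB hX a b).trans (mul_comm _ _).le)).continuous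

include hX in
lemma mem_of_tmul (π : X →⋆ₙₐ[ℂ] (H →L[ℂ] H)) (hc : Continuous π) (S : Submodule ℂ H) (hS : IsClosed (S : Set H)) (v : H)
    (h : ∀ a b, π (ι (a ⊗ₜ[ℂ] b)) v ∈ S) (y : X) : π y v ∈ S := by
  have hcl : IsClosed {y : X | π y v ∈ S} := by
    have : Continuous fun y : X => π y v := by fun_prop
    exact hS.preimage this
  have : ∀ u, ι u ∈ {y : X | π y v ∈ S} := by
    intro u
    induction u using TensorProduct.induction_on with
    | zero => simp
    | tmul a b => exact h a b
    | add x y hx hy =>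
      simp only [Set.mem_setOf_eq, map_add, ContinuousLinearMap.add_apply] at *
      exact S.add_mem hx hy
  have h2 : closure (Set.range ι) ⊆ {y : X | π y v ∈ S} := closure_minimal (by rintro _ ⟨u, rfl⟩; exact this u) hcl
  exact h2 (by rw [hX.dense.closure_range]; trivial)

include hX hc hirr in
lemma irr_tmul (S : Submodule ℂ H) (hS : IsClosed (S : Set H))
    (h : ∀ a b, ∀ v ∈ S, π (ι (a ⊗ₜ[ℂ] b)) v ∈ S) : S = ⊥ ∨ S = ⊤ :=
  hirr S hS fun y v hv => mem_of_tmul hX π hc S hS v (fun a b => h a b v hv) y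

include hX hc hirr hnz in
lemma dense_tmul : Dense (Submodule.span ℂ {w : H | ∃ a b v, w = π (ι (a ⊗ₜ[ℂ] b)) v} : Set H) := by
  set V : Set H := {w : H | ∃ a b v, w = π (ι (a ⊗ₜ[ℂ] b)) v}
  have hV : ∀ a b v, π (ι (a ⊗ₜ[ℂ] b)) v ∈ (Submodule.span ℂ V).topologicalClosure := fun a b v =>
    Submodule.le_topologicalClosure _ (Submodule.subset_span ⟨a, b, v, rfl⟩)
  rcases irr_tmul hX π hc hirr (Submodule.span ℂ V).topologicalClosure (Submodule.isClosed_topologicalClosure _) (fun a b v _ => hV a b v) with h | h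
  · exfalso
    obtain ⟨y, hy⟩ := hnz
    apply hy
    ext v
    have := mem_of_tmul hX π hc ⊥ (by simp) v (fun a b => by have := hV a b v; rwa [h] at this) y
    simpa using this
  · rw [dense_iff_closure_eq]
    have := congrArg (fun W : Submodule ℂ H => (W : Set H)) h
    simpa using this

include hX hc hirr hnz in
lemma ext_tmul (T T' : H →L[ℂ] H) (h : ∀ i : A × B, T * π (ι (i.1 ⊗ₜ[ℂ] i.2)) = T' * π (ι (i.1 ⊗ₜ[ℂ] i.2))) : T = T' := by
  have hd := dense_tmul hX π hc hnz hirr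
  apply ContinuousLinearMap.ext_on hd
  rintro _ ⟨a, b, v, rfl⟩
  exact congrArg (fun S : H →L[ℂ] H => S v) (h (a, b))

include hc in
lemma exists_bound : ∃ C : ℝ, 0 ≤ C ∧ ∀ x, ‖π x‖ ≤ C * ‖x‖ := by
  let L : X →L[ℂ] (H →L[ℂ] H) := ⟨{ toFun := π, map_add' := map_add π, map_smul' := fun c x => map_smul π c x }, hc⟩
  exact ⟨‖L‖, norm_nonneg _, fun x => L.le_opNorm x⟩

include hNA hNB hX hc hirr hnz in
theorem exists_factors : ∃ (π1 : A →⋆ₙₐ[ℂ] (H →L[ℂ] H)) (π2 : B →⋆ₙₐ[ℂ] (H →L[ℂ] H)),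
    (∀ a b, π (ι (a ⊗ₜ[ℂ] b)) = π1 a * π2 b) ∧ (∀ a b, π1 a * π2 b = π2 b * π1 a) := by
  obtain ⟨C, hC0, hC⟩ := exists_bound π hc
  have hd := dense_tmul hX π hc hnz hirr
  have hext := ext_tmul hX π hc hnz hirr
  obtain ⟨π1, h1⟩ : ∃ σ : A →⋆ₙₐ[ℂ] (H →L[ℂ] H), ∀ (c : A) (i : A × B), σ c * π (ι (i.1 ⊗ₜ[ℂ] i.2)) = π (ι ((c * i.1) ⊗ₜ[ℂ] i.2)) := by
    refine mult_rep (fun i : A × B => π (ι (i.1 ⊗ₜ[ℂ] i.2))) hext (fun c i => (c * i.1, i.2)) ?_ ?_ ?_ ?_ ?_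
    · intro c
      have hl := CStarAlgebra.increasingApproximateUnit B
      haveI := hl.neBot
      have hlim : ∀ (i : A × B) v, Tendsto (fun f : B => π (ι (c ⊗ₜ[ℂ] f)) (π (ι (i.1 ⊗ₜ[ℂ] i.2)) v)) (CStarAlgebra.approximateUnit B)
          (𝓝 (π (ι ((c * i.1) ⊗ₜ[ℂ] i.2)) v)) := by
        intro i v
        have e : ∀ f : B, π (ι (c ⊗ₜ[ℂ] f)) (π (ι (i.1 ⊗ₜ[ℂ] i.2)) v) = π (ι ((c * i.1) ⊗ₜ[ℂ] (f * i.2))) v := by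
          intro f
          rw [← hX.mul_tmul, map_mul]; rfl
        simp only [e]
        have hcont : Continuous fun b : B => π (ι ((c * i.1) ⊗ₜ[ℂ] b)) v := by
          have := hc.comp (cont_tmul_right hNA hNB hX (c * i.1))
          exact this.clm_apply continuous_const
        exact (hcont.tendsto i.2).comp (hl.tendsto_mul_right i.2)
      obtain ⟨T, hT⟩ := strong_lim (l := CStarAlgebra.approximateUnit B) (fun f : B => π (ι (c ⊗ₜ[ℂ] f))) (C * ‖c‖) (by
        filter_upwards [hl.eventually_norm] with f hf
        refine (hC _).trans ?_
        gcongr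
        refine (norm_tmul_le hNA hNB hX c f).trans ?_
        nlinarith [norm_nonneg c]) _ hd (by
        rintro _ ⟨a, b, v, rfl⟩
        exact ⟨_, hlim (a, b) v⟩)
      refine ⟨T, fun i => ?_⟩
      ext v
      exact tendsto_nhds_unique (hT _) (hlim i v)
    · intro c d i; simp [add_mul, TensorProduct.add_tmul]
    · intro k c i; simp [smul_mul_assoc, ← TensorProduct.smul_tmul', map_smul]
    · intro c d i; simp [mul_assoc]
    · intro c i j
      simp only [← map_star, ← map_mul, hX.star_tmul, hX.mul_tmul, star_mul, star_star, mul_assoc]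
  obtain ⟨π2, h2⟩ : ∃ σ : B →⋆ₙₐ[ℂ] (H →L[ℂ] H), ∀ (c : B) (i : A × B), σ c * π (ι (i.1 ⊗ₜ[ℂ] i.2)) = π (ι (i.1 ⊗ₜ[ℂ] (c * i.2))) := by
    refine mult_rep (fun i : A × B => π (ι (i.1 ⊗ₜ[ℂ] i.2))) hext (fun c i => (i.1, c * i.2)) ?_ ?_ ?_ ?_ ?_
    · intro c
      have hl := CStarAlgebra.increasingApproximateUnit A
      haveI := hl.neBot
      have hlim : ∀ (i : A × B) v, Tendsto (fun f : A => π (ι (f ⊗ₜ[ℂ] c)) (π (ι (i.1 ⊗ₜ[ℂ] i.2)) v)) (CStarAlgebra.approximateUnit A)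
          (𝓝 (π (ι (i.1 ⊗ₜ[ℂ] (c * i.2))) v)) := by
        intro i v
        have e : ∀ f : A, π (ι (f ⊗ₜ[ℂ] c)) (π (ι (i.1 ⊗ₜ[ℂ] i.2)) v) = π (ι ((f * i.1) ⊗ₜ[ℂ] (c * i.2))) v := by
          intro f
          rw [← hX.mul_tmul, map_mul]; rfl
        simp only [e]
        have hcont : Continuous fun a : A => π (ι (a ⊗ₜ[ℂ] (c * i.2))) v := by
          have := hc.comp (cont_tmul_left hNA hNB hX (c * i.2))
          exact this.clm_apply continuous_const
        exact (hcont.tendsto i.1).comp (hl.tendsto_mul_right i.1)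
      obtain ⟨T, hT⟩ := strong_lim (l := CStarAlgebra.approximateUnit A) (fun f : A => π (ι (f ⊗ₜ[ℂ] c))) (C * ‖c‖) (by
        filter_upwards [hl.eventually_norm] with f hf
        refine (hC _).trans ?_
        gcongr
        refine (norm_tmul_le hNA hNB hX f c).trans ?_
        nlinarith [norm_nonneg c]) _ hd (by
        rintro _ ⟨a, b, v, rfl⟩
        exact ⟨_, hlim (a, b) v⟩)
      refine ⟨T, fun i => ?_⟩
      ext v
      exact tendsto_nhds_unique (hT _) (hlim i v)
    · intro c d i; simp [add_mul, TensorProduct.tmul_add]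
    · intro k c i; simp [smul_mul_assoc, map_smul]
    · intro c d i; simp [mul_assoc]
    · intro c i j
      simp only [← map_star, ← map_mul, hX.star_tmul, hX.mul_tmul, star_mul, star_star, mul_assoc]
  have e1 : ∀ a b (i : A × B), π1 a * π2 b * π (ι (i.1 ⊗ₜ[ℂ] i.2)) = π (ι ((a * i.1) ⊗ₜ[ℂ] (b * i.2))) := by
    intro a b i
    rw [mul_assoc, h2]; exact h1 a (i.1, b * i.2)
  have e2 : ∀ a b (i : A × B), π2 b * π1 a * π (ι (i.1 ⊗ₜ[ℂ] i.2)) = π (ι ((a * i.1) ⊗ₜ[ℂ] (b * i.2))) := by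
    intro a b i
    rw [mul_assoc, h1]; exact h2 b (a * i.1, i.2)
  refine ⟨π1, π2, fun a b => ?_, fun a b => ?_⟩
  · apply hext; intro i
    rw [e1, ← hX.mul_tmul, map_mul]
  · apply hext; intro i
    rw [e1, e2]
end S1
end PIS
end Part12

section Part13
namespace PIS
open Filter Topology

section S2
variable {A B : Type u} [NonUnitalCStarAlgebra A] [NonUnitalCStarAlgebra B]
  {H : Type u} [NormedAddCommGroup H] [InnerProductSpace ℂ H] [CompleteSpace H]

structure IrrPair (π1 : A →⋆ₙₐ[ℂ] (H →L[ℂ] H)) (π2 : B →⋆ₙₐ[ℂ] (H →L[ℂ] H)) : Prop where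
  comm : ∀ a b, π1 a * π2 b = π2 b * π1 a
  irr : ∀ S : Submodule ℂ H, IsClosed (S : Set H) → (∀ a b, ∀ v ∈ S, (π1 a * π2 b) v ∈ S) → S = ⊥ ∨ S = ⊤
  nz : ∃ a b, π1 a * π2 b ≠ 0

variable {π1 : A →⋆ₙₐ[ℂ] (H →L[ℂ] H)} {π2 : B →⋆ₙₐ[ℂ] (H →L[ℂ] H)}

lemma IrrPair.symm (h : IrrPair π1 π2) : IrrPair π2 π1 where
  comm := fun a b => (h.comm b a).symm
  irr := fun S hS hi => h.irr S hS fun a b v hv => by rw [h.comm]; exact hi b a v hv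
  nz := by
    obtain ⟨a, b, hab⟩ := h.nz
    exact ⟨b, a, by rwa [← h.comm]⟩

/-- A set of vectors invariant under everything has total span, or is zero. -/
lemma IrrPair.total (h : IrrPair π1 π2) (V : Set H) (hV : ∀ a b, ∀ v ∈ V, (π1 a * π2 b) v ∈ V) (hne : ∃ v ∈ V, v ≠ 0) :
    Dense (Submodule.span ℂ V : Set H) := by
  have inv1 : ∀ a b, ∀ v ∈ Submodule.span ℂ V, (π1 a * π2 b) v ∈ Submodule.span ℂ V := by
    intro a b v hv
    induction hv using Submodule.span_induction with
    | mem x hx => exact Submodule.subset_span (hV a b x hx)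
    | zero => simp
    | add x y _ _ hx hy => rw [map_add]; exact Submodule.add_mem _ hx hy
    | smul c x _ hx => rw [map_smul]; exact Submodule.smul_mem _ _ hx
  have inv2 : ∀ a b, ∀ v ∈ (Submodule.span ℂ V).topologicalClosure, (π1 a * π2 b) v ∈ (Submodule.span ℂ V).topologicalClosure := by
    intro a b v hv
    exact map_mem_closure (π1 a * π2 b).continuous hv (fun v hv => inv1 a b v hv)
  rcases h.irr _ (Submodule.isClosed_topologicalClosure _) inv2 with h0 | h1
  · exfalso
    obtain ⟨v, hv, hv0⟩ := hne
    have : v ∈ (Submodule.span ℂ V).topologicalClosure := Submodule.le_topologicalClosure _ (Submodule.subset_span hv)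
    rw [h0] at this
    exact hv0 (by simpa using this)
  · rw [dense_iff_closure_eq]
    have := congrArg (fun W : Submodule ℂ H => (W : Set H)) h1
    simpa using this

lemma IrrPair.nondeg (h : IrrPair π1 π2) : Dense (Submodule.span ℂ {w : H | ∃ a b v, w = π1 a (π2 b v)} : Set H) := by
  apply h.total
  · rintro a b _ ⟨a', b', v, rfl⟩
    exact ⟨a, b, _, rfl⟩
  · obtain ⟨a, b, hab⟩ := h.nz
    by_contra hcon
    push Not at hcon
    apply hab
    ext v
    exact hcon _ ⟨a, b, v, rfl⟩

lemma IrrPair.kill (h : IrrPair π1 π2) (T S : H →L[ℂ] H) (hT : ∀ a b, Commute T (π1 a * π2 b)) (hT0 : T ≠ 0) (hS : S * T = 0) : S = 0 := by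
  have hd : Dense (Submodule.span ℂ (Set.range T) : Set H) := by
    apply h.total
    · rintro a b _ ⟨v, rfl⟩
      exact ⟨(π1 a * π2 b) v, congrArg (fun Z : H →L[ℂ] H => Z v) (hT a b).eq⟩
    · by_contra hcon
      push Not at hcon
      apply hT0
      ext v
      exact hcon _ ⟨v, rfl⟩
  apply ContinuousLinearMap.ext_on hd
  rintro _ ⟨v, rfl⟩
  exact congrArg (fun Z : H →L[ℂ] H => Z v) hS

lemma IrrPair.schur_sa (h : IrrPair π1 π2) (T : H →L[ℂ] H) (hsa : IsSelfAdjoint T) (hT : ∀ a b, Commute T (π1 a * π2 b)) :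
    ∃ c : ℂ, T = c • (1 : H →L[ℂ] H) := by
  by_cases hsub : (spectrum ℝ T).Subsingleton
  · obtain ⟨c, hc⟩ : ∃ c : ℝ, ∀ x ∈ spectrum ℝ T, x = c := by
      rcases hsub.eq_empty_or_singleton with h0 | ⟨c, h1⟩
      · exact ⟨0, by simp [h0]⟩
      · exact ⟨c, by simp [h1]⟩
    refine ⟨(c : ℂ), ?_⟩
    have h1 : cfc (fun x : ℝ => x) T = cfc (fun _ : ℝ => c) T := cfc_congr hc
    rw [cfc_id' ℝ T, cfc_const c T] at h1
    rw [h1, Algebra.algebraMap_eq_smul_one]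
    rfl
  · exfalso
    obtain ⟨s, hs, t, ht, hst⟩ : ∃ s ∈ spectrum ℝ T, ∃ t ∈ spectrum ℝ T, s < t := by
      rw [Set.not_subsingleton_iff] at hsub
      exact hsub.exists_lt
    set m := (s + t) / 2 with hm
    set f : ℝ → ℝ := fun x => max (m - x) 0
    set g : ℝ → ℝ := fun x => max (x - m) 0
    have hf : Continuous f := by fun_prop
    have hg : Continuous g := by fun_prop
    have hfg : cfc f T * cfc g T = 0 := by
      rw [← cfc_mul f g T hf.continuousOn hg.continuousOn]
      have : (fun x => f x * g x) = fun _ => (0:ℝ) := by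
        funext x
        rcases le_total x m with hx | hx
        · simp [f, g, max_eq_right (sub_nonpos.2 hx)]
        · simp [f, g, max_eq_right (sub_nonpos.2 hx)]
      rw [this, cfc_const_zero]
    have hf0 : cfc f T ≠ 0 := by
      intro h0
      have := norm_apply_le_norm_cfc f T hs hf.continuousOn
      rw [h0, norm_zero] at this
      have h2 : 0 < f s := lt_max_of_lt_left (by rw [hm]; linarith)
      rw [Real.norm_of_nonneg h2.le] at this
      linarith
    have hg0 : cfc g T ≠ 0 := by
      intro h0
      have := norm_apply_le_norm_cfc g T ht hg.continuousOn
      rw [h0, norm_zero] at this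
      have h2 : 0 < g t := lt_max_of_lt_left (by rw [hm]; linarith)
      rw [Real.norm_of_nonneg h2.le] at this
      linarith
    exact hf0 (h.kill _ _ (fun a b => (hT a b).cfc_real g) hg0 hfg)

lemma IrrPair.schur (h : IrrPair π1 π2) (T : H →L[ℂ] H) (hT : ∀ a b, Commute T (π1 a * π2 b)) :
    ∃ c : ℂ, T = c • (1 : H →L[ℂ] H) := by
  have hT' : ∀ a b, Commute (star T) (π1 a * π2 b) := by
    intro a b
    have := (hT (star a) (star b)).star_star
    rw [star_mul, ← map_star, ← map_star, star_star, star_star, ← h.comm] at this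
    exact this
  obtain ⟨c, hc⟩ := h.schur_sa (T + star T) (IsSelfAdjoint.add_star_self T) (fun a b => (hT a b).add_left (hT' a b))
  have hsa : IsSelfAdjoint (Complex.I • (T - star T)) := by
    rw [IsSelfAdjoint, star_smul, star_sub, star_star]
    simp only [RCLike.star_def, Complex.conj_I]
    rw [neg_smul, ← smul_neg, neg_sub]
  obtain ⟨d, hd⟩ := h.schur_sa _ hsa (fun a b => ((hT a b).sub_left (hT' a b)).smul_left _)
  refine ⟨(c - Complex.I * d) / 2, ?_⟩
  have h1 : T - star T = (-Complex.I * d) • (1 : H →L[ℂ] H) := by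
    rw [mul_smul, ← hd, smul_smul]; simp
  have h2 : (2:ℂ) • T = (c - Complex.I * d) • (1 : H →L[ℂ] H) := by
    rw [sub_smul, ← hc, show (Complex.I * d) • (1 : H →L[ℂ] H) = -(T - star T) by rw [h1, ← neg_smul]; simp]
    rw [two_smul]; abel
  rw [div_eq_inv_mul, mul_smul, ← h2, smul_smul]; simp

lemma IrrPair.prime (h : IrrPair π1 π2) : IsClosedPrimeIdeal (TwoSidedIdeal.ker π1) := by
  refine ⟨?_, ?_, ?_⟩
  · have : ((TwoSidedIdeal.ker π1 : TwoSidedIdeal A) : Set A) = π1 ⁻¹' {0} := by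
      ext x; simp [TwoSidedIdeal.mem_ker]
    rw [this]
    have hcc : Continuous (fun a : A => π1 a) := AddMonoidHomClass.continuous_of_bound π1 1 fun a => by simpa using NonUnitalStarAlgHom.norm_apply_le π1 a
    exact isClosed_singleton.preimage hcc
  · intro huniv
    obtain ⟨a, b, hab⟩ := h.nz
    have : a ∈ ((TwoSidedIdeal.ker π1 : TwoSidedIdeal A) : Set A) := by rw [huniv]; trivial
    have : π1 a = 0 := (TwoSidedIdeal.mem_ker π1).1 this
    exact hab (by rw [this, zero_mul])
  · intro I J _ _ hIJ
    by_cases hJ : (J : Set A) ⊆ ((TwoSidedIdeal.ker π1 : TwoSidedIdeal A) : Set A)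
    · exact Or.inr hJ
    left
    intro x hx
    show x ∈ TwoSidedIdeal.ker π1
    rw [TwoSidedIdeal.mem_ker]
    have hd : Dense (Submodule.span ℂ {w : H | ∃ y ∈ J, ∃ v, w = π1 y v} : Set H) := by
      apply h.total
      · rintro a b _ ⟨y, hy, v, rfl⟩
        refine ⟨a * y, J.mul_mem_left _ _ hy, π2 b v, ?_⟩
        rw [map_mul]
        exact congrArg (fun Z : H →L[ℂ] H => π1 a (Z v)) (h.comm y b).symm
      · by_contra hcon
        push Not at hcon
        apply hJ
        intro y hy
        show y ∈ TwoSidedIdeal.ker π1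
        rw [TwoSidedIdeal.mem_ker]
        ext v
        exact hcon _ ⟨y, hy, v, rfl⟩
    apply ContinuousLinearMap.ext_on hd
    rintro _ ⟨y, hy, v, rfl⟩
    have := (TwoSidedIdeal.mem_ker π1).1 (hIJ x hx y hy)
    rw [map_mul] at this
    exact congrArg (fun Z : H →L[ℂ] H => Z v) this
end S2
end PIS
end Part13

section Part14
namespace PIS
open Filter Topology

section S8a
variable {A : Type*} [NonUnitalCStarAlgebra A] [PartialOrder A] [StarOrderedRing A]
  {I J K : Type*} [Fintype I] [Fintype J] [Fintype K]

lemma rsq_comp_le {D : Type*} [NonUnitalCStarAlgebra D] (π : A →⋆ₙₐ[ℂ] D) (a : I → A) : rsq (fun i => π (a i)) ≤ rsq a := by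
  unfold rsq
  refine le_trans (le_of_eq (congrArg norm ?_)) (NonUnitalStarAlgHom.norm_apply_le π _)
  simp [map_sum, map_star]

lemma csq_comp_le {D : Type*} [NonUnitalCStarAlgebra D] (π : A →⋆ₙₐ[ℂ] D) (a : I → A) : csq (fun i => π (a i)) ≤ csq a := by
  unfold csq
  refine le_trans (le_of_eq (congrArg norm ?_)) (NonUnitalStarAlgHom.norm_apply_le π _)
  simp [map_sum, map_star]

lemma row_le (V : CStarMatrix I J A) (α : I → ℂ) :
    rsq (fun j => ∑ i, α i • V i j) ≤ (∑ i, ‖α i‖ ^ 2) * ‖V‖ ^ 2 := by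
  have hl := CStarAlgebra.increasingApproximateUnit A
  haveI := hl.neBot
  set a : J → A := fun j => ∑ i, α i • V i j with ha
  have hlim : Tendsto (fun e : A => ‖∑ j, (e * a j) * star (e * a j)‖) (CStarAlgebra.approximateUnit A) (𝓝 (rsq a)) := by
    unfold rsq
    apply Tendsto.norm
    apply tendsto_finsetSum
    intro j _
    have h1 := hl.tendsto_mul_right (a j)
    exact h1.mul ((continuous_star.tendsto _).comp h1)
  refine le_of_tendsto hlim ?_
  filter_upwards [hl.eventually_norm] with e he
  let v : WithCStarModule A (I → A) := (WithCStarModule.equiv _ _).symm (fun i => α i • e)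
  have h1 : ‖v‖ ^ 2 ≤ ∑ i, ‖α i‖ ^ 2 := by
    rw [WithCStarModule.pi_norm_sq]
    refine (norm_sum_le _ _).trans ?_
    refine Finset.sum_le_sum fun i _ => ?_
    have : v i = α i • e := rfl
    rw [this, CStarModule.norm_sq_eq A |>.symm]
    rw [norm_smul, mul_pow]
    nlinarith [norm_nonneg e, sq_nonneg ‖α i‖, mul_le_of_le_one_right (sq_nonneg ‖α i‖) (pow_le_one₀ (norm_nonneg e) he (n := 2))]
  have h2 : ‖∑ j, (e * a j) * star (e * a j)‖ = ‖CStarMatrix.toCLM V v‖ ^ 2 := by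
    rw [CStarMatrix.toCLM_apply_eq_sum, WithCStarModule.pi_norm_sq]
    congr 1
    refine Finset.sum_congr rfl fun j _ => ?_
    have e1 : ∑ i, v i * V i j = e * a j := by
      rw [ha]; simp only [Finset.mul_sum]
      refine Finset.sum_congr rfl fun i _ => ?_
      show (α i • e) * _ = _
      rw [smul_mul_assoc, mul_smul_comm]
    rw [WithCStarModule.equiv_symm_pi_apply, e1, WithCStarModule.inner_def]
  rw [h2]
  have h3 : ‖CStarMatrix.toCLM V v‖ ≤ ‖V‖ * ‖v‖ := (CStarMatrix.toCLM V).le_opNorm v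
  calc ‖CStarMatrix.toCLM V v‖ ^ 2 ≤ (‖V‖ * ‖v‖) ^ 2 := by gcongr
    _ = ‖v‖ ^ 2 * ‖V‖ ^ 2 := by ring
    _ ≤ _ := by gcongr

lemma col_le (V : CStarMatrix I I A) (β : I → ℂ) :
    csq (fun i => ∑ j, β j • V i j) ≤ (∑ i, ‖β i‖ ^ 2) * ‖V‖ ^ 2 := by
  have := row_le (star V) (fun j => star (β j))
  rw [norm_star] at this
  rw [← rsq_star]
  simp only [norm_star] at this
  convert this using 3 with i
  rw [star_sum]
  refine Finset.sum_congr rfl fun j _ => ?_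
  rw [star_smul]; rfl

lemma rsq_prod (x : J × K → A) : rsq x ≤ ∑ k, rsq (fun j => x (j, k)) := by
  unfold rsq
  rw [Fintype.sum_prod_type_right]
  exact norm_sum_le _ _

lemma csq_prod (x : J × K → A) : csq x ≤ ∑ j, csq (fun k => x (j, k)) := by
  unfold csq
  rw [Fintype.sum_prod_type]
  exact norm_sum_le _ _

lemma rsq_prod' (x : J × K → A) : rsq x ≤ ∑ j, rsq (fun k => x (j, k)) := by
  unfold rsq
  rw [Fintype.sum_prod_type]
  exact norm_sum_le _ _

lemma csq_prod' (x : J × K → A) : csq x ≤ ∑ k, csq (fun j => x (j, k)) := by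
  unfold csq
  rw [Fintype.sum_prod_type_right]
  exact norm_sum_le _ _

lemma rsq_smul (t : ℝ) (x : I → A) : rsq (fun i => (t : ℂ) • x i) = t ^ 2 * rsq x := by
  unfold rsq
  simp only [star_smul, smul_mul_smul_comm, ← Finset.smul_sum, norm_smul]
  simp [pow_two]

lemma csq_smul (t : ℝ) (x : I → A) : csq (fun i => (t : ℂ) • x i) = t ^ 2 * csq x := by
  unfold csq
  simp only [star_smul, smul_mul_smul_comm, ← Finset.smul_sum, norm_smul]
  simp [pow_two]

lemma balance (p q ε : ℝ) (hp : 0 ≤ p) (hq : 0 ≤ q) (hε : 0 < ε) (h : p * q ≤ ε ^ 2) :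
    ∃ t : ℝ, 0 < t ∧ t ^ 2 * p ≤ ε ∧ (t⁻¹) ^ 2 * q ≤ ε := by
  rcases hq.eq_or_lt with h0 | h0
  · refine ⟨√(ε / (p + 1)), by positivity, ?_, ?_⟩
    · rw [Real.sq_sqrt (by positivity), div_mul_eq_mul_div, div_le_iff₀ (by positivity)]
      nlinarith
    · rw [← h0]; simp [hε.le]
  · refine ⟨√(q / ε), by positivity, ?_, ?_⟩
    · rw [Real.sq_sqrt (by positivity), div_mul_eq_mul_div, div_le_iff₀ (by positivity)]
      nlinarith
    · rw [inv_pow, Real.sq_sqrt (by positivity), inv_div, div_mul_cancel₀ _ h0.ne']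
end S8a

section S8
variable {A B : Type u} [NonUnitalCStarAlgebra A] [PartialOrder A] [StarOrderedRing A]
  [NonUnitalCStarAlgebra B] [PartialOrder B] [StarOrderedRing B]
  {NA : ∀ p : ℕ, Matrix (Fin p) (Fin p) A → ℝ} {NB : ∀ q : ℕ, Matrix (Fin q) (Fin q) B → ℝ}
  (hNA : ∀ p, IsCStarNorm (NA p)) (hNB : ∀ q, IsCStarNorm (NB q))

omit [PartialOrder A] [StarOrderedRing A] [PartialOrder B] [StarOrderedRing B] in
lemma diag_sum {m : ℕ} (a : Fin m → A) (b : Fin m → B) : ∑ i, a i ⊗ₜ[ℂ] b i =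
    ∑ i, ∑ j, Matrix.diagonal a i j ⊗ₜ[ℂ] Matrix.diagonal b i j := by
  refine Finset.sum_congr rfl fun i _ => ?_
  rw [Finset.sum_eq_single i]
  · rw [Matrix.diagonal_apply_eq, Matrix.diagonal_apply_eq]
  · intro j _ hj
    rw [Matrix.diagonal_apply_ne _ hj.symm, TensorProduct.zero_tmul]
  · simp

lemma osProj_rep (u : A ⊗[ℂ] B) (ε : ℝ) (hu : osProjNorm NA NB u < ε) :
    ∃ (p q : ℕ) (α : Fin p × Fin q → ℂ) (v : Matrix (Fin p) (Fin p) A)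
      (w : Matrix (Fin q) (Fin q) B) (β : Fin p × Fin q → ℂ),
      u = ∑ ik : Fin p × Fin q, ∑ jl : Fin p × Fin q,
            (α ik * β jl) • (v ik.1 jl.1 ⊗ₜ[ℂ] w ik.2 jl.2) ∧
      Real.sqrt (∑ ik, ‖α ik‖ ^ 2) * NA p v * NB q w *
            Real.sqrt (∑ jl, ‖β jl‖ ^ 2) < ε := by
  by_cases hne : Set.Nonempty { r : ℝ | ∃ (p q : ℕ) (α : Fin p × Fin q → ℂ) (v : Matrix (Fin p) (Fin p) A)
      (w : Matrix (Fin q) (Fin q) B) (β : Fin p × Fin q → ℂ),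
      u = ∑ ik : Fin p × Fin q, ∑ jl : Fin p × Fin q,
            (α ik * β jl) • (v ik.1 jl.1 ⊗ₜ[ℂ] w ik.2 jl.2) ∧
      r = Real.sqrt (∑ ik, ‖α ik‖ ^ 2) * NA p v * NB q w *
            Real.sqrt (∑ jl, ‖β jl‖ ^ 2) }
  · obtain ⟨r, ⟨p, q, α, v, w, β, h1, h2⟩, h3⟩ := exists_lt_of_csInf_lt hne hu
    exact ⟨p, q, α, v, w, β, h1, h2 ▸ h3⟩
  · exfalso
    apply hne
    obtain ⟨m, a, b, hab⟩ := TensorProduct.exists_sum_tmul_eq u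
    refine ⟨_, m, m, fun ik => if ik.1 = ik.2 then 1 else 0, Matrix.diagonal a, Matrix.diagonal b, fun ik => if ik.1 = ik.2 then 1 else 0, ?_, rfl⟩
    rw [hab]
    trans ∑ ik : Fin m × Fin m, ∑ jl : Fin m × Fin m, if ik.1 = ik.2 then (if jl.1 = jl.2 then Matrix.diagonal a ik.1 jl.1 ⊗ₜ[ℂ] Matrix.diagonal b ik.2 jl.2 else 0) else 0
    swap
    · refine Finset.sum_congr rfl fun i _ => Finset.sum_congr rfl fun j _ => ?_
      by_cases h1 : i.1 = i.2 <;> by_cases h2 : j.1 = j.2 <;> simp [h1, h2]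
    simp only [Fintype.sum_prod_type, Finset.sum_ite_irrel, Finset.sum_const_zero, ite_mul, mul_ite, one_mul, zero_mul, mul_one, mul_zero, ite_smul, zero_smul, one_smul, Finset.sum_ite_eq, Finset.mem_univ, if_true]
    exact diag_sum a b

include hNA hNB in
lemma type1_rep (u : A ⊗[ℂ] B) (ε : ℝ) (hu : osProjNorm NA NB u < ε) :
    ∃ (I : Type) (_ : Fintype I) (a : I → A) (b : I → B), u = ∑ i, a i ⊗ₜ[ℂ] b i ∧ rsq a ≤ ε ∧ csq b ≤ ε := by
  obtain ⟨p, q, α, v, w, β, hu', hlt⟩ := osProj_rep u ε hu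
  rw [N_eq (hNA p) v, N_eq (hNB q) w] at hlt
  let V : CStarMatrix (Fin p) (Fin p) A := v
  let W : CStarMatrix (Fin q) (Fin q) B := w
  have hlt : √(∑ ik, ‖α ik‖ ^ 2) * ‖V‖ * ‖W‖ * √(∑ jl, ‖β jl‖ ^ 2) < ε := hlt
  have hε : 0 < ε := lt_of_le_of_lt (by positivity) hlt
  let a : Fin p × Fin q → A := fun jk => ∑ i, α (i, jk.2) • v i jk.1
  let b : Fin p × Fin q → B := fun jk => ∑ l, β (jk.1, l) • w jk.2 l
  have ha : rsq a ≤ (∑ ik, ‖α ik‖ ^ 2) * ‖V‖ ^ 2 := by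
    refine (rsq_prod a).trans ?_
    rw [Fintype.sum_prod_type_right, Finset.sum_mul]
    exact Finset.sum_le_sum fun k _ => row_le V (fun i => α (i, k))
  have hb : csq b ≤ (∑ jl, ‖β jl‖ ^ 2) * ‖W‖ ^ 2 := by
    refine (csq_prod b).trans ?_
    rw [Fintype.sum_prod_type, Finset.sum_mul]
    exact Finset.sum_le_sum fun j _ => col_le W (fun l => β (j, l))
  have hsum : u = ∑ jk, a jk ⊗ₜ[ℂ] b jk := by
    rw [hu']
    have hj : ∀ jk, a jk ⊗ₜ[ℂ] b jk = ∑ i, ∑ l, (α (i, jk.2) * β (jk.1, l)) • (v i jk.1 ⊗ₜ[ℂ] w jk.2 l) := by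
      intro jk
      simp only [a, b, TensorProduct.sum_tmul]
      refine Finset.sum_congr rfl fun i _ => ?_
      rw [TensorProduct.tmul_sum]
      refine Finset.sum_congr rfl fun l _ => ?_
      rw [TensorProduct.smul_tmul_smul]
    rw [Finset.sum_congr rfl fun jk _ => hj jk]
    simp only [Fintype.sum_prod_type]
    rw [Finset.sum_comm, Finset.sum_comm (s := (Finset.univ : Finset (Fin p)))]
    refine Finset.sum_congr rfl fun k _ => ?_
    rw [Finset.sum_comm]
  obtain ⟨t, ht, h1, h2⟩ := balance _ _ ε (rsq_nonneg a) (csq_nonneg b) hε (by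
    calc rsq a * csq b ≤ ((∑ ik, ‖α ik‖ ^ 2) * ‖V‖ ^ 2) * ((∑ jl, ‖β jl‖ ^ 2) * ‖W‖ ^ 2) := by
          gcongr
          exact csq_nonneg _
      _ = (√(∑ ik, ‖α ik‖ ^ 2) * ‖V‖ * ‖W‖ * √(∑ jl, ‖β jl‖ ^ 2)) ^ 2 := by
        rw [mul_pow, mul_pow, mul_pow, Real.sq_sqrt (by positivity), Real.sq_sqrt (by positivity)]; ring
      _ ≤ ε ^ 2 := by
        gcongr)
  refine ⟨Fin p × Fin q, inferInstance, fun i => (t : ℂ) • a i, fun i => ((t⁻¹ : ℝ) : ℂ) • b i, ?_, ?_, ?_⟩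
  · rw [hsum]
    refine Finset.sum_congr rfl fun i _ => ?_
    rw [TensorProduct.smul_tmul_smul, ← Complex.ofReal_mul, mul_inv_cancel₀ ht.ne']; simp
  · rw [rsq_smul]; exact h1
  · rw [csq_smul]; exact h2

include hNA hNB in
lemma type2_rep (u : A ⊗[ℂ] B) (ε : ℝ) (hu : osProjNorm NA NB u < ε) :
    ∃ (I : Type) (_ : Fintype I) (a : I → A) (b : I → B), u = ∑ i, a i ⊗ₜ[ℂ] b i ∧ csq a ≤ ε ∧ rsq b ≤ ε := by
  obtain ⟨p, q, α, v, w, β, hu', hlt⟩ := osProj_rep u ε hu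
  rw [N_eq (hNA p) v, N_eq (hNB q) w] at hlt
  let V : CStarMatrix (Fin p) (Fin p) A := v
  let W : CStarMatrix (Fin q) (Fin q) B := w
  have hlt : √(∑ ik, ‖α ik‖ ^ 2) * ‖V‖ * ‖W‖ * √(∑ jl, ‖β jl‖ ^ 2) < ε := hlt
  have hε : 0 < ε := lt_of_le_of_lt (by positivity) hlt
  let a : Fin p × Fin q → A := fun il => ∑ j, β (j, il.2) • v il.1 j
  let b : Fin p × Fin q → B := fun il => ∑ k, α (il.1, k) • w k il.2
  have ha : csq a ≤ (∑ ik, ‖β ik‖ ^ 2) * ‖V‖ ^ 2 := by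
    refine (csq_prod' a).trans ?_
    rw [Fintype.sum_prod_type_right, Finset.sum_mul]
    exact Finset.sum_le_sum fun k _ => col_le V (fun i => β (i, k))
  have hb : rsq b ≤ (∑ jl, ‖α jl‖ ^ 2) * ‖W‖ ^ 2 := by
    refine (rsq_prod' b).trans ?_
    rw [Fintype.sum_prod_type, Finset.sum_mul]
    exact Finset.sum_le_sum fun j _ => row_le W (fun l => α (j, l))
  have hsum : u = ∑ jk, a jk ⊗ₜ[ℂ] b jk := by
    rw [hu']
    have hj : ∀ il, a il ⊗ₜ[ℂ] b il = ∑ k, ∑ j, (α (il.1, k) * β (j, il.2)) • (v il.1 j ⊗ₜ[ℂ] w k il.2) := by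
      intro il
      simp only [a, b, TensorProduct.tmul_sum]
      refine Finset.sum_congr rfl fun i _ => ?_
      rw [TensorProduct.sum_tmul]
      refine Finset.sum_congr rfl fun l _ => ?_
      rw [TensorProduct.smul_tmul_smul, mul_comm]
    rw [Finset.sum_congr rfl fun jk _ => hj jk]
    simp only [Fintype.sum_prod_type]
    refine Finset.sum_congr rfl fun i _ => ?_
    rw [Finset.sum_comm (s := (Finset.univ : Finset (Fin q))) (t := (Finset.univ : Finset (Fin q)))]
    refine Finset.sum_congr rfl fun k _ => ?_
    rw [Finset.sum_comm]
  obtain ⟨t, ht, h1, h2⟩ := balance _ _ ε (csq_nonneg a) (rsq_nonneg b) hε (by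
    calc csq a * rsq b ≤ ((∑ ik, ‖β ik‖ ^ 2) * ‖V‖ ^ 2) * ((∑ jl, ‖α jl‖ ^ 2) * ‖W‖ ^ 2) := by
          gcongr
          exact rsq_nonneg _
      _ = (√(∑ ik, ‖α ik‖ ^ 2) * ‖V‖ * ‖W‖ * √(∑ jl, ‖β jl‖ ^ 2)) ^ 2 := by
        rw [mul_pow, mul_pow, mul_pow, Real.sq_sqrt (by positivity), Real.sq_sqrt (by positivity)]; ring
      _ ≤ ε ^ 2 := by
        gcongr)
  refine ⟨Fin p × Fin q, inferInstance, fun i => (t : ℂ) • a i, fun i => ((t⁻¹ : ℝ) : ℂ) • b i, ?_, ?_, ?_⟩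
  · rw [hsum]
    refine Finset.sum_congr rfl fun i _ => ?_
    rw [TensorProduct.smul_tmul_smul, ← Complex.ofReal_mul, mul_inv_cancel₀ ht.ne']; simp
  · rw [csq_smul]; exact h1
  · rw [rsq_smul]; exact h2
end S8
end PIS
end Part14

section Part15
namespace PIS
open Filter Topology

section S7a
variable {H : Type*} [NormedAddCommGroup H] [InnerProductSpace ℂ H] [CompleteSpace H] {κ : Type*}

abbrev L2 (κ : Type*) (H : Type*) [NormedAddCommGroup H] [InnerProductSpace ℂ H] := lp (fun _ : κ => H) 2

omit [CompleteSpace H] in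
lemma mem_l2 (f : κ → H) (C : ℝ) (h : ∀ s : Finset κ, ∑ i ∈ s, ‖f i‖ ^ 2 ≤ C) : Memℓp (E := fun _ : κ => H) f 2 := by
  apply memℓp_gen' (C := C)
  intro s
  simpa using h s

omit [CompleteSpace H] in
lemma l2_sum_le (f : L2 κ H) (s : Finset κ) : ∑ i ∈ s, ‖f i‖ ^ 2 ≤ ‖f‖ ^ 2 := by
  have := lp.sum_rpow_le_norm_rpow (p := 2) (by simp) f s
  simpa using this

omit [CompleteSpace H] in
lemma l2_norm_le (f : L2 κ H) (C : ℝ) (hC : 0 ≤ C) (h : ∀ s : Finset κ, ∑ i ∈ s, ‖f i‖ ^ 2 ≤ C ^ 2) : ‖f‖ ≤ C := by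
  apply lp.norm_le_of_forall_sum_le (p := 2) (by simp) hC
  intro s
  simpa using h s

omit [CompleteSpace H] in
lemma l2_diag_aux (T : H →L[ℂ] H) (f : L2 κ H) (s : Finset κ) : ∑ i ∈ s, ‖T (f i)‖ ^ 2 ≤ (‖T‖ * ‖f‖) ^ 2 := by
  calc ∑ i ∈ s, ‖T (f i)‖ ^ 2 ≤ ∑ i ∈ s, ‖T‖ ^ 2 * ‖f i‖ ^ 2 := by
        gcongr with i _
        rw [← mul_pow]; gcongr; exact T.le_opNorm _
    _ = ‖T‖ ^ 2 * ∑ i ∈ s, ‖f i‖ ^ 2 := by rw [Finset.mul_sum]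
    _ ≤ ‖T‖ ^ 2 * ‖f‖ ^ 2 := by gcongr; exact l2_sum_le f s
    _ = _ := by ring

def dg (T : H →L[ℂ] H) : L2 κ H →L[ℂ] L2 κ H :=
  LinearMap.mkContinuous
    { toFun := fun f => (⟨fun i => T (f i), mem_l2 _ _ (l2_diag_aux T f)⟩ : L2 κ H)
      map_add' := fun f g => by ext i; simp; rfl
      map_smul' := fun c f => by ext i; simp } ‖T‖ (fun f => l2_norm_le _ _ (by positivity) (l2_diag_aux T f))

omit [CompleteSpace H] in
@[simp] lemma dg_apply (T : H →L[ℂ] H) (f : L2 κ H) (i : κ) : dg T f i = T (f i) := rfl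

lemma dg_inner (T : H →L[ℂ] H) (f g : L2 κ H) : inner ℂ f (dg T g) = inner ℂ (dg (star T) f) g := by
  rw [lp.inner_eq_tsum, lp.inner_eq_tsum]
  refine tsum_congr fun i => ?_
  rw [dg_apply, dg_apply, ContinuousLinearMap.star_eq_adjoint, ContinuousLinearMap.adjoint_inner_left]

def ev (i : κ) : L2 κ H →L[ℂ] H :=
  LinearMap.mkContinuous
    { toFun := fun f => f i
      map_add' := fun f g => by simp
      map_smul' := fun c f => by simp } 1 (fun f => by rw [one_mul]; exact lp.norm_apply_le_norm (by simp) f i)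

omit [CompleteSpace H] in
@[simp] lemma ev_apply (i : κ) (f : L2 κ H) : ev i f = f i := rfl

def sgl [DecidableEq κ] (i : κ) : H →L[ℂ] L2 κ H :=
  LinearMap.mkContinuous
    { toFun := fun x => lp.single 2 i x
      map_add' := fun f g => by simp
      map_smul' := fun c f => by simp } 1 (fun f => by simp [lp.norm_single])

omit [CompleteSpace H] in
lemma sgl_apply [DecidableEq κ] (i : κ) (x : H) (j : κ) : sgl i x j = if j = i then x else 0 := by
  show lp.single (E := fun _ : κ => H) 2 i x j = _
  split_ifs with h
  · subst h; simp
  · simp [lp.single_apply, h]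

omit [CompleteSpace H] in
lemma dg_sgl [DecidableEq κ] (T : H →L[ℂ] H) (i : κ) (x : H) : dg T (sgl i x) = sgl i (T x) := by
  ext j
  rw [dg_apply, sgl_apply, sgl_apply]; split_ifs <;> simp

omit [CompleteSpace H] in
lemma sgl_inner [DecidableEq κ] (f : L2 κ H) (i : κ) (x : H) : inner ℂ (sgl i x) f = inner ℂ x (f i) :=
  lp.inner_single_left i x f

/-- the abstract projection trick -/
lemma proj_trick (Tset : Set (H →L[ℂ] H)) (hTs : ∀ T ∈ Tset, star T ∈ Tset)
    (schur : ∀ X : H →L[ℂ] H, (∀ T ∈ Tset, Commute X T) → ∃ c : ℂ, X = c • (1 : H →L[ℂ] H))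
    (C : Set (H →L[ℂ] H)) (hC1 : 1 ∈ C) (Y Z : κ → H →L[ℂ] H) (RY RZ : H → ℝ)
    (hY : ∀ ξ (s : Finset κ), ∑ i ∈ s, ‖Y i ξ‖ ^ 2 ≤ RY ξ)
    (hZ : ∀ ξ (s : Finset κ), ∑ i ∈ s, ‖Z i ξ‖ ^ 2 ≤ RZ ξ)
    (hzero : ∀ S ∈ C, ∀ ξ η, HasSum (fun i => inner ℂ (Z i η) (S (Y i ξ))) (0 : ℂ))
    (hinv : ∀ T ∈ Tset, ∀ S ∈ C, ∃ S' ∈ C, ∃ T' : H →L[ℂ] H, ∀ i ξ, T (S (Y i ξ)) = S' (Y i (T' ξ))) :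
    ∃ q : κ → κ → ℂ, (∀ i j, q j i = star (q i j)) ∧
      (∀ (F G : Finset κ) ξ δ, 0 ≤ δ → (∀ G' : Finset κ, Disjoint G' F → ∑ i ∈ G', ‖Y i ξ‖ ^ 2 ≤ δ) →
        ∑ i ∈ G, ‖Y i ξ - ∑ j ∈ F, q i j • Y j ξ‖ ^ 2 ≤ δ) ∧
      (∀ (F G : Finset κ) ξ δ, 0 ≤ δ → (∀ G' : Finset κ, Disjoint G' F → ∑ i ∈ G', ‖Z i ξ‖ ^ 2 ≤ δ) →
        ∑ i ∈ G, ‖∑ j ∈ F, q i j • Z j ξ‖ ^ 2 ≤ δ) := by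
  classical
  let y : H → L2 κ H := fun ξ => ⟨fun i => Y i ξ, mem_l2 _ _ (hY ξ)⟩
  let z : H → L2 κ H := fun ξ => ⟨fun i => Z i ξ, mem_l2 _ _ (hZ ξ)⟩
  have hy : ∀ ξ i, y ξ i = Y i ξ := fun _ _ => rfl
  have hz : ∀ ξ i, z ξ i = Z i ξ := fun _ _ => rfl
  let V : Set (L2 κ H) := {w | ∃ S ∈ C, ∃ ξ, w = dg S (y ξ)}
  let W : Submodule ℂ (L2 κ H) := (Submodule.span ℂ V).topologicalClosure
  haveI : CompleteSpace W := (Submodule.isClosed_topologicalClosure _).completeSpace_coe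
  let Q := W.starProjection
  have invW : ∀ T ∈ Tset, ∀ w ∈ W, dg T w ∈ W := by
    intro T hT w hw
    have h1 : Submodule.span ℂ V ≤ W.comap (dg T : L2 κ H →L[ℂ] L2 κ H).toLinearMap := by
      rw [Submodule.span_le]
      rintro _ ⟨S, hS, ξ, rfl⟩
      obtain ⟨S', hS', T', h⟩ := hinv T hT S hS
      have : dg T (dg S (y ξ)) = dg S' (y (T' ξ)) := by
        ext i; simp only [dg_apply, hy]; exact h i ξ
      show dg T (dg S (y ξ)) ∈ W
      rw [this]
      exact Submodule.le_topologicalClosure _ (Submodule.subset_span ⟨S', hS', _, rfl⟩)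
    have hcl : IsClosed ((W.comap (dg T : L2 κ H →L[ℂ] L2 κ H).toLinearMap : Submodule ℂ (L2 κ H)) : Set (L2 κ H)) :=
      (Submodule.isClosed_topologicalClosure _).preimage (dg T).continuous
    exact Submodule.topologicalClosure_minimal _ h1 hcl hw
  have invWp : ∀ T ∈ Tset, ∀ w ∈ Wᗮ, dg T w ∈ Wᗮ := by
    intro T hT w hw
    rw [Submodule.mem_orthogonal] at hw ⊢
    intro x hx
    rw [dg_inner]
    exact hw _ (invW _ (hTs T hT) _ hx)
  have hQT : ∀ T ∈ Tset, ∀ w, Q (dg T w) = dg T (Q w) := by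
    intro T hT w
    refine (Submodule.eq_starProjection_of_mem_orthogonal ?_ ?_)
    · exact invW T hT _ (Submodule.starProjection_apply_mem _ _)
    · rw [← map_sub]
      exact invWp T hT _ (Submodule.sub_starProjection_mem_orthogonal _)
  have hq : ∀ i j, ∃ c : ℂ, (ev i) ∘L Q ∘L (sgl j) = c • (1 : H →L[ℂ] H) := by
    intro i j
    apply schur
    intro T hT
    ext x
    show (Q (sgl j (T x))) i = T ((Q (sgl j x)) i)
    rw [← dg_sgl, hQT T hT, dg_apply]
  choose q hq using hq
  have hq' : ∀ i j x, (Q (sgl j x)) i = q i j • x := fun i j x => by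
    have := congrArg (fun X : H →L[ℂ] H => X x) (hq i j)
    simpa using this
  have hQy : ∀ ξ, Q (y ξ) = y ξ := by
    intro ξ
    refine Submodule.starProjection_eq_self_iff.2 ?_
    have : y ξ = dg 1 (y ξ) := by ext i; simp
    exact Submodule.le_topologicalClosure _ (Submodule.subset_span ⟨1, hC1, ξ, this⟩)
  have hQz : ∀ η, Q (z η) = 0 := by
    intro η
    refine (Submodule.starProjection_apply_eq_zero_iff W).2 ?_
    rw [Submodule.orthogonal_closure, Submodule.mem_orthogonal]
    intro w hw
    refine Submodule.span_induction ?_ (by simp) ?_ ?_ hw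
    · rintro _ ⟨S, hS, ξ, rfl⟩
      have h1 := lp.hasSum_inner (𝕜 := ℂ) (z η) (dg S (y ξ))
      have h2 := h1.unique (hzero S hS ξ η)
      exact inner_eq_zero_symm.1 h2
    · intro x y _ _ hx hy
      rw [inner_add_left, hx, hy, add_zero]
    · intro c x _ hx
      rw [inner_smul_left, hx, mul_zero]
  have hnorm : ∀ w, ‖Q w‖ ≤ ‖w‖ := fun w => Submodule.norm_starProjection_apply_le _ _
  have tail : ∀ (w : L2 κ H) (F : Finset κ) δ, 0 ≤ δ → (∀ G' : Finset κ, Disjoint G' F → ∑ i ∈ G', ‖w i‖ ^ 2 ≤ δ) →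
      ∀ G : Finset κ, ∑ i ∈ G, ‖(Q (w - ∑ j ∈ F, sgl j (w j))) i‖ ^ 2 ≤ δ := by
    intro w F δ hδ h G
    refine (l2_sum_le _ G).trans ?_
    have : ‖w - ∑ j ∈ F, sgl j (w j)‖ ≤ √δ := by
      apply l2_norm_le _ _ (Real.sqrt_nonneg _)
      intro s
      rw [Real.sq_sqrt hδ]
      refine le_trans (le_of_eq ?_) (h (s \ F) Finset.sdiff_disjoint)
      have hv : ∀ i, (w - ∑ j ∈ F, sgl j (w j)) i = if i ∈ F then 0 else w i := by
        intro i
        rw [lp.coeFn_sub, Pi.sub_apply, lp.coeFn_sum, Finset.sum_apply]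
        simp only [sgl_apply, Finset.sum_ite_eq]
        split_ifs <;> simp
      rw [← Finset.sum_sdiff (Finset.inter_subset_left : s ∩ F ⊆ s), Finset.sdiff_inter_self_left]
      rw [Finset.sum_eq_zero (s := s ∩ F), add_zero]
      · refine Finset.sum_congr rfl fun i hi => ?_
        rw [hv, if_neg (Finset.mem_sdiff.1 hi).2]
      · intro i hi
        rw [hv, if_pos (Finset.mem_inter.1 hi).2]; simp
    calc ‖Q (w - ∑ j ∈ F, sgl j (w j))‖ ^ 2 ≤ (√δ) ^ 2 := by
          gcongr; exact (hnorm _).trans this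
      _ = δ := Real.sq_sqrt hδ
  have hco : ∀ (w : L2 κ H) (F : Finset κ) i, (Q (w - ∑ j ∈ F, sgl j (w j))) i = (Q w) i - ∑ j ∈ F, q i j • w j := by
    intro w F i
    rw [map_sub, map_sum, lp.coeFn_sub, Pi.sub_apply, lp.coeFn_sum, Finset.sum_apply]
    simp only [hq']
  by_cases hH : Subsingleton H
  · refine ⟨fun _ _ => 0, by simp, ?_, ?_⟩
    · intro F G ξ δ hδ _
      refine le_trans (le_of_eq (Finset.sum_eq_zero fun i _ => ?_)) hδ
      rw [Subsingleton.elim (Y i ξ - _) 0]; simp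
    · intro F G ξ δ hδ _
      simpa using hδ
  haveI : Nontrivial H := not_subsingleton_iff_nontrivial.1 hH
  refine ⟨q, ?_, ?_, ?_⟩
  · intro i j
    obtain ⟨x, hx⟩ := exists_ne (0 : H)
    have h1 : inner ℂ (sgl j x) (Q (sgl i x)) = q j i * inner ℂ x x := by
      rw [sgl_inner, hq', inner_smul_right]
    have h2 : inner ℂ (Q (sgl j x)) (sgl i x) = star (q i j) * inner ℂ x x := by
      rw [← inner_conj_symm, sgl_inner, hq', inner_smul_right, map_mul, inner_conj_symm]; rfl
    have h3 : inner ℂ (Q (sgl j x)) (sgl i x) = inner ℂ (sgl j x) (Q (sgl i x)) :=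
      Submodule.inner_starProjection_left_eq_right W _ _
    rw [h1, h2] at h3
    exact (mul_right_cancel₀ (inner_self_ne_zero.2 hx) h3).symm
  · intro F G ξ δ hδ h
    have := tail (y ξ) F δ hδ h G
    simp only [hco, hQy] at this
    exact this
  · intro F G ξ δ hδ h
    have := tail (z ξ) F δ hδ h G
    simp only [hco, hQz] at this
    simpa [hz] using this
end S7a
end PIS
end Part15

section Part16
namespace PIS
open Filter Topology

section S7b
variable {H : Type*} [NormedAddCommGroup H] [InnerProductSpace ℂ H] [CompleteSpace H] {κ : Type*}

lemma vec_eq (s : Finset κ) (x : κ → H →L[ℂ] H) (ξ η : H) :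
    ∑ i ∈ s, inner ℂ (x i ξ) (x i η) = inner ℂ ξ ((∑ i ∈ s, star (x i) * x i) η) := by
  rw [ContinuousLinearMap.sum_apply, inner_sum]
  refine Finset.sum_congr rfl fun i _ => ?_
  rw [ContinuousLinearMap.mul_apply, ContinuousLinearMap.star_eq_adjoint, ContinuousLinearMap.adjoint_inner_right]

lemma vec_le (s : Finset κ) (x : κ → H →L[ℂ] H) (ξ : H) :
    ∑ i ∈ s, ‖x i ξ‖ ^ 2 ≤ ‖∑ i ∈ s, star (x i) * x i‖ * ‖ξ‖ ^ 2 := by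
  have h := vec_eq s x ξ ξ
  have h2 : ((∑ i ∈ s, ‖x i ξ‖ ^ 2 : ℝ) : ℂ) = ∑ i ∈ s, inner ℂ (x i ξ) (x i ξ) := by
    push_cast
    refine Finset.sum_congr rfl fun i _ => ?_
    rw [inner_self_eq_norm_sq_to_K]; rfl
  rw [h] at h2
  have h3 := congrArg norm h2
  rw [Complex.norm_real, Real.norm_of_nonneg (by positivity)] at h3
  rw [h3]
  refine (norm_inner_le_norm _ _).trans ?_
  calc ‖ξ‖ * ‖(∑ i ∈ s, star (x i) * x i) ξ‖ ≤ ‖ξ‖ * (‖∑ i ∈ s, star (x i) * x i‖ * ‖ξ‖) := by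
        gcongr; exact ContinuousLinearMap.le_opNorm _ _
    _ = _ := by ring

lemma norm_le_of_vec (s : Finset κ) (x : κ → H →L[ℂ] H) (r : ℝ) (hr : 0 ≤ r)
    (h : ∀ ξ, ∑ i ∈ s, ‖x i ξ‖ ^ 2 ≤ r * ‖ξ‖ ^ 2) : ‖∑ i ∈ s, star (x i) * x i‖ ≤ r := by
  apply ContinuousLinearMap.opNorm_le_bound _ hr
  intro ξ
  set T := ∑ i ∈ s, star (x i) * x i
  have h1 := vec_eq s x (T ξ) ξ
  have h2 : ‖T ξ‖ ^ 2 ≤ ∑ i ∈ s, ‖x i (T ξ)‖ * ‖x i ξ‖ := by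
    have : (‖T ξ‖ ^ 2 : ℝ) = ‖inner ℂ (T ξ) (T ξ)‖ := by
      rw [inner_self_eq_norm_sq_to_K]; simp
    rw [this, ← h1]
    refine (norm_sum_le _ _).trans (Finset.sum_le_sum fun i _ => norm_inner_le_norm _ _)
  have h3 : (∑ i ∈ s, ‖x i (T ξ)‖ * ‖x i ξ‖) ^ 2 ≤ (r * ‖T ξ‖ ^ 2) * (r * ‖ξ‖ ^ 2) := by
    refine (Finset.sum_mul_sq_le_sq_mul_sq s _ _).trans ?_
    gcongr
    · exact h _
    · exact h _
  by_cases h0 : ‖T ξ‖ = 0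
  · rw [h0]; positivity
  have h4 : 0 < ‖T ξ‖ := lt_of_le_of_ne (norm_nonneg _) (Ne.symm h0)
  have h5 : ‖T ξ‖ ^ 2 ≤ ‖T ξ‖ * (r * ‖ξ‖) := by
    apply le_of_sq_le_sq
    calc (‖T ξ‖ ^ 2) ^ 2 ≤ (∑ i ∈ s, ‖x i (T ξ)‖ * ‖x i ξ‖) ^ 2 := by gcongr
      _ ≤ _ := h3
      _ = _ := by ring
    positivity
  rw [pow_two] at h5
  exact le_of_mul_le_mul_left h5 h4
end S7b
section S7c
variable {H : Type u} [NormedAddCommGroup H] [InnerProductSpace ℂ H] [CompleteSpace H]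
variable {A B : Type u} [NonUnitalCStarAlgebra A] [NonUnitalCStarAlgebra B]
  {π1 : A →⋆ₙₐ[ℂ] (H →L[ℂ] H)} {π2 : B →⋆ₙₐ[ℂ] (H →L[ℂ] H)}

lemma vec_b {κ : Type} (π : A →⋆ₙₐ[ℂ] (H →L[ℂ] H)) (s : Finset κ) (b : κ → A) (ξ : H) (r : ℝ) (h : ‖∑ i ∈ s, star (b i) * b i‖ ≤ r) :
    ∑ i ∈ s, ‖π (b i) ξ‖ ^ 2 ≤ r * ‖ξ‖ ^ 2 := by
  refine (vec_le s (fun i => π (b i)) ξ).trans ?_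
  gcongr
  refine le_trans (le_trans (le_of_eq (congrArg norm ?_)) (NonUnitalStarAlgHom.norm_apply_le π _)) h
  simp [map_sum, map_star]

lemma csq_sum {I J : Type} [Fintype I] [Fintype J] {D : Type*} [NonUnitalCStarAlgebra D] (x : I → D) (y : J → D) :
    csq (Sum.elim x y) ≤ csq x + csq y := by
  unfold csq
  rw [Fintype.sum_sum_type]
  exact norm_add_le _ _

lemma rsq_sum {I J : Type} [Fintype I] [Fintype J] {D : Type*} [NonUnitalCStarAlgebra D] (x : I → D) (y : J → D) :
    rsq (Sum.elim x y) ≤ rsq x + rsq y := by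
  unfold rsq
  rw [Fintype.sum_sum_type]
  exact norm_add_le _ _

lemma trick (h : IrrPair π1 π2) {κ : Type} (a : κ → A) (b : κ → B) (F : ℕ → Finset κ) (hF : Tendsto F atTop atTop)
    (R : ℝ) (δ : ℕ → ℝ) (hR : 0 ≤ R) (hδ : ∀ N, 0 ≤ δ N)
    (ha : ∀ s : Finset κ, ‖∑ i ∈ s, a i * star (a i)‖ ≤ R) (hb : ∀ s : Finset κ, ‖∑ i ∈ s, star (b i) * b i‖ ≤ R)
    (ha' : ∀ N (s : Finset κ), Disjoint s (F N) → ‖∑ i ∈ s, a i * star (a i)‖ ≤ δ N)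
    (hb' : ∀ N (s : Finset κ), Disjoint s (F N) → ‖∑ i ∈ s, star (b i) * b i‖ ≤ δ N)
    (h0 : ∀ ξ, Tendsto (fun N => ∑ i ∈ F N, π1 (a i) (π2 (b i) ξ)) atTop (𝓝 0))
    (N : ℕ) (ε : ℝ) (hε : 0 < ε) (hN : R * δ N ≤ ε ^ 2) :
    ∃ (I : Type) (_ : Fintype I) (c : I → A) (d : I → B), ∑ i ∈ F N, a i ⊗ₜ[ℂ] b i = ∑ i, c i ⊗ₜ[ℂ] d i ∧
      rsq (fun i => π1 (c i)) ≤ 2 * ε ∧ csq (fun i => π2 (d i)) ≤ 2 * ε := by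
  have va : ∀ (s : Finset κ) r η, ‖∑ i ∈ s, a i * star (a i)‖ ≤ r → ∑ i ∈ s, ‖π1 (star (a i)) η‖ ^ 2 ≤ r * ‖η‖ ^ 2 := by
    intro s r η hr
    exact vec_b π1 s (fun i => star (a i)) η r (by simpa using hr)
  obtain ⟨q, hq1, hq2, hq3⟩ := proj_trick (κ := κ) {T | ∃ a b, T = π1 a * π2 b}
    (by
      rintro _ ⟨a, b, rfl⟩
      refine ⟨star a, star b, ?_⟩
      rw [star_mul, ← map_star, ← map_star, h.comm])
    (fun X hX => h.schur X fun a b => hX _ ⟨a, b, rfl⟩)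
    {S | ∀ a, π1 a * S = S * π1 a} (by simp)
    (fun i => π2 (b i)) (fun i => π1 (star (a i))) (fun ξ => R * ‖ξ‖ ^ 2) (fun ξ => R * ‖ξ‖ ^ 2)
    (fun ξ s => vec_b π2 s b ξ R (hb s))
    (fun ξ s => va s R ξ (ha s))
    (by
      intro S hS ξ η
      have e1 : ∀ i, inner ℂ (π1 (star (a i)) η) (S (π2 (b i) ξ)) = inner ℂ (star S η) (π1 (a i) (π2 (b i) ξ)) := by
        intro i
        rw [map_star, ContinuousLinearMap.star_eq_adjoint, ContinuousLinearMap.star_eq_adjoint, ContinuousLinearMap.adjoint_inner_left,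
          ContinuousLinearMap.adjoint_inner_left, ← ContinuousLinearMap.mul_apply, hS (a i)]; rfl
      have hs : Summable (fun i => inner ℂ (π1 (star (a i)) η) (S (π2 (b i) ξ))) := by
        have := lp.summable_inner (𝕜 := ℂ) (⟨fun i => π1 (star (a i)) η, mem_l2 _ _ (fun s => va s R η (ha s))⟩ : L2 κ H)
          (dg S ⟨fun i => π2 (b i) ξ, mem_l2 _ _ (fun s => vec_b π2 s b ξ R (hb s))⟩)
        exact this
      have h1 := hs.hasSum.comp hF
      have h2 : Tendsto (fun N => ∑ i ∈ F N, inner ℂ (π1 (star (a i)) η) (S (π2 (b i) ξ))) atTop (𝓝 0) := by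
        simp only [e1]
        simp only [← inner_sum]
        have := (tendsto_const_nhds (x := star S η)).inner (𝕜 := ℂ) (h0 ξ)
        simpa using this
      have := tendsto_nhds_unique h1 h2
      rw [← this]
      exact hs.hasSum)
    (by
      rintro _ ⟨a', b', rfl⟩ S hS
      refine ⟨π2 b' * S, ?_, π1 a', ?_⟩
      · intro a''
        rw [← mul_assoc, h.comm, mul_assoc, hS, mul_assoc]
      · intro i ξ
        simp only [← ContinuousLinearMap.mul_apply]
        congr 1
        rw [h.comm, mul_assoc, ← mul_assoc (π1 a'), hS, mul_assoc, mul_assoc, h.comm])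
  obtain ⟨t, ht, ht1, ht2⟩ := balance R (δ N) ε hR (hδ N) hε hN
  let I := {i // i ∈ F N}
  let a0 : I → A := fun i => a i
  let b0 : I → B := fun i => b i
  let c0 : I → A := fun i => ∑ j ∈ F N, q j i • a j
  let d0 : I → B := fun i => b i - ∑ j ∈ F N, q i j • b j
  have hsum : ∑ i ∈ F N, a i ⊗ₜ[ℂ] b i = ∑ i, a0 i ⊗ₜ[ℂ] d0 i + ∑ i, c0 i ⊗ₜ[ℂ] b0 i := by
    have e1 : ∑ i, a0 i ⊗ₜ[ℂ] d0 i = ∑ i ∈ F N, a i ⊗ₜ[ℂ] (b i - ∑ j ∈ F N, q i j • b j) :=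
      Finset.sum_coe_sort (F N) (fun i => a i ⊗ₜ[ℂ] (b i - ∑ j ∈ F N, q i j • b j))
    have e2 : ∑ i, c0 i ⊗ₜ[ℂ] b0 i = ∑ i ∈ F N, (∑ j ∈ F N, q j i • a j) ⊗ₜ[ℂ] b i :=
      Finset.sum_coe_sort (F N) (fun i => (∑ j ∈ F N, q j i • a j) ⊗ₜ[ℂ] b i)
    rw [e1, e2]
    simp only [TensorProduct.tmul_sub, TensorProduct.tmul_sum, TensorProduct.sum_tmul, Finset.sum_sub_distrib, TensorProduct.tmul_smul, TensorProduct.smul_tmul']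
    rw [Finset.sum_comm (s := F N) (t := F N) (f := fun i j => (q j i • a j) ⊗ₜ[ℂ] b i)]
    abel
  have ha0 : rsq (fun i => π1 (a0 i)) ≤ R := by
    refine le_trans (le_trans (le_of_eq ?_) (NonUnitalStarAlgHom.norm_apply_le π1 _)) (ha (F N))
    unfold rsq
    rw [map_sum]
    simp only [map_mul, map_star]
    exact congrArg norm (Finset.sum_coe_sort (F N) (fun i => π1 (a i) * star (π1 (a i))))
  have hb0 : csq (fun i => π2 (b0 i)) ≤ R := by
    refine le_trans (le_trans (le_of_eq ?_) (NonUnitalStarAlgHom.norm_apply_le π2 _)) (hb (F N))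
    unfold csq
    rw [map_sum]
    simp only [map_mul, map_star]
    exact congrArg norm (Finset.sum_coe_sort (F N) (fun i => star (π2 (b i)) * π2 (b i)))
  have hd0 : csq (fun i => π2 (d0 i)) ≤ δ N := by
    apply norm_le_of_vec Finset.univ _ _ (hδ N)
    intro ξ
    have := hq2 (F N) (F N) ξ (δ N * ‖ξ‖ ^ 2) (by have := hδ N; positivity) (fun G' hG' => vec_b π2 G' b ξ (δ N) (hb' N G' hG'))
    refine le_trans (le_of_eq ?_) this
    rw [← Finset.sum_coe_sort (F N)]
    refine Finset.sum_congr rfl fun i _ => ?_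
    simp [d0, map_sub, map_sum, map_smul]
  have hc0 : rsq (fun i => π1 (c0 i)) ≤ δ N := by
    rw [← csq_star]
    apply norm_le_of_vec Finset.univ _ _ (hδ N)
    intro ξ
    have := hq3 (F N) (F N) ξ (δ N * ‖ξ‖ ^ 2) (by have := hδ N; positivity) (fun G' hG' => va G' (δ N) ξ (ha' N G' hG'))
    refine le_trans (le_of_eq ?_) this
    rw [← Finset.sum_coe_sort (F N)]
    refine Finset.sum_congr rfl fun i _ => ?_
    congr 2
    simp only [c0, map_sum, map_smul, star_sum, star_smul, ← hq1, ContinuousLinearMap.sum_apply, map_star]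
    rfl
  refine ⟨I ⊕ I, inferInstance, Sum.elim (fun i => (t : ℂ) • a0 i) (fun i => ((t⁻¹ : ℝ) : ℂ) • c0 i),
    Sum.elim (fun i => ((t⁻¹ : ℝ) : ℂ) • d0 i) (fun i => (t : ℂ) • b0 i), ?_, ?_, ?_⟩
  · rw [hsum, Fintype.sum_sum_type]
    congr 1
    · refine Finset.sum_congr rfl fun i _ => ?_
      rw [Sum.elim_inl, Sum.elim_inl, TensorProduct.smul_tmul_smul, ← Complex.ofReal_mul, mul_inv_cancel₀ ht.ne']; simp
    · refine Finset.sum_congr rfl fun i _ => ?_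
      rw [Sum.elim_inr, Sum.elim_inr, TensorProduct.smul_tmul_smul, ← Complex.ofReal_mul, inv_mul_cancel₀ ht.ne']; simp
  · have e : (fun i => π1 (Sum.elim (fun i => (t : ℂ) • a0 i) (fun i => ((t⁻¹ : ℝ) : ℂ) • c0 i) i)) =
        Sum.elim (fun i => (t : ℂ) • π1 (a0 i)) (fun i => ((t⁻¹ : ℝ) : ℂ) • π1 (c0 i)) := by
      funext i
      rcases i with i | i
      · simp only [Sum.elim_inl, map_smul]
      · simp only [Sum.elim_inr, map_smul]
    rw [e]
    refine (rsq_sum _ _).trans ?_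
    rw [rsq_smul, rsq_smul]
    have e1 : t ^ 2 * rsq (fun i => π1 (a0 i)) ≤ t ^ 2 * R := by gcongr
    have e2 : t⁻¹ ^ 2 * rsq (fun i => π1 (c0 i)) ≤ t⁻¹ ^ 2 * δ N := by gcongr
    linarith
  · have e : (fun i => π2 (Sum.elim (fun i => ((t⁻¹ : ℝ) : ℂ) • d0 i) (fun i => (t : ℂ) • b0 i) i)) =
        Sum.elim (fun i => ((t⁻¹ : ℝ) : ℂ) • π2 (d0 i)) (fun i => (t : ℂ) • π2 (b0 i)) := by
      funext i
      rcases i with i | i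
      · simp only [Sum.elim_inl, map_smul]
      · simp only [Sum.elim_inr, map_smul]
    rw [e]
    refine (csq_sum _ _).trans ?_
    rw [csq_smul, csq_smul]
    have e1 : t ^ 2 * csq (fun i => π2 (b0 i)) ≤ t ^ 2 * R := by gcongr
    have e2 : t⁻¹ ^ 2 * csq (fun i => π2 (d0 i)) ≤ t⁻¹ ^ 2 * δ N := by gcongr
    linarith
end S7c
end PIS
end Part16

section Part17
namespace PIS
open Filter Topology

section S7d
lemma sigma_bound {A : Type*} [NonUnitalCStarAlgebra A] {I : ℕ → Type} [∀ n, Fintype (I n)]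
    (x : ∀ n, I n → A) (r : ℕ → ℝ) (hx : ∀ n, rsq (x n) ≤ r n) (s : Finset (Σ n, I n)) :
    ‖∑ i ∈ s, x i.1 i.2 * star (x i.1 i.2)‖ ≤ ∑ n ∈ s.image Sigma.fst, r n := by
  classical
  letI := CStarAlgebra.spectralOrder A
  letI := CStarAlgebra.spectralOrderedRing A
  have hsub : s ⊆ (s.image Sigma.fst).sigma (fun _ => Finset.univ) := by
    intro i hi
    simp only [Finset.mem_sigma, Finset.mem_univ, and_true]
    exact Finset.mem_image_of_mem _ hi
  have h1 : ∑ i ∈ s, x i.1 i.2 * star (x i.1 i.2) ≤ ∑ i ∈ (s.image Sigma.fst).sigma (fun _ => Finset.univ), x i.1 i.2 * star (x i.1 i.2) :=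
    Finset.sum_le_sum_of_subset_of_nonneg hsub fun i _ _ => mul_star_self_nonneg _
  refine (row_le_of_le (Finset.sum_nonneg fun i _ => mul_star_self_nonneg _) h1).trans ?_
  rw [Finset.sum_sigma]
  refine (norm_sum_le _ _).trans (Finset.sum_le_sum fun n _ => hx n)

variable {H : Type u} [NormedAddCommGroup H] [InnerProductSpace ℂ H] [CompleteSpace H]
variable {A B : Type u} [NonUnitalCStarAlgebra A] [NonUnitalCStarAlgebra B]
  {π1 : A →⋆ₙₐ[ℂ] (H →L[ℂ] H)} {π2 : B →⋆ₙₐ[ℂ] (H →L[ℂ] H)}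

lemma approx1 (h : IrrPair π1 π2) (un : ℕ → A ⊗[ℂ] B) (r : ℕ → ℝ) (hr0 : ∀ n, 0 ≤ r n) (hr : Summable r)
    (rep : ∀ n, ∃ (I : Type) (_ : Fintype I) (a : I → A) (b : I → B), un n = ∑ i, a i ⊗ₜ[ℂ] b i ∧ rsq a ≤ r n ∧ csq b ≤ r n)
    (P : A ⊗[ℂ] B →ₗ[ℂ] (H →L[ℂ] H)) (hP : ∀ a b, P (a ⊗ₜ[ℂ] b) = π1 a * π2 b)
    (h0 : ∀ ξ, Tendsto (fun N => P (∑ n ∈ Finset.range N, un n) ξ) atTop (𝓝 0)) (ε : ℝ) (hε : 0 < ε) :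
    ∀ᶠ N in atTop, ∃ (I : Type) (_ : Fintype I) (c : I → A) (d : I → B), ∑ n ∈ Finset.range N, un n = ∑ i, c i ⊗ₜ[ℂ] d i ∧
      rsq (fun i => π1 (c i)) ≤ ε ∧ csq (fun i => π2 (d i)) ≤ ε := by
  classical
  choose I hI a b hu ha hb using rep
  let F : ℕ → Finset (Σ n, I n) := fun N => (Finset.range N).sigma (fun _ => Finset.univ)
  have hF : Tendsto F atTop atTop := by
    apply tendsto_atTop_finset_of_monotone
    · intro M N hMN
      exact Finset.sigma_mono (Finset.range_mono hMN) fun _ => le_rfl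
    · intro i
      exact ⟨i.1 + 1, by simp [F]⟩
  have hsum : ∀ N, ∑ i ∈ F N, a i.1 i.2 ⊗ₜ[ℂ] b i.1 i.2 = ∑ n ∈ Finset.range N, un n := by
    intro N
    rw [Finset.sum_sigma]
    exact Finset.sum_congr rfl fun n _ => (hu n).symm
  set R := ∑' n, r n with hR
  let δ : ℕ → ℝ := fun N => R - ∑ n ∈ Finset.range N, r n
  have hδ0 : ∀ N, 0 ≤ δ N := fun N => sub_nonneg.2 (hr.sum_le_tsum _ fun i _ => hr0 i)
  have hδ : Tendsto δ atTop (𝓝 0) := by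
    have := (tendsto_const_nhds (x := R)).sub hr.hasSum.tendsto_sum_nat
    rwa [← hR, sub_self] at this
  have bR : ∀ s : Finset (Σ n, I n), ∑ n ∈ s.image Sigma.fst, r n ≤ R := fun s => hr.sum_le_tsum _ fun i _ => hr0 i
  have bδ : ∀ N (s : Finset (Σ n, I n)), Disjoint s (F N) → ∑ n ∈ s.image Sigma.fst, r n ≤ δ N := by
    intro N s hs
    have hd : Disjoint (s.image Sigma.fst) (Finset.range N) := by
      rw [Finset.disjoint_left] at hs ⊢
      intro n hn hn2
      obtain ⟨i, hi, rfl⟩ := Finset.mem_image.1 hn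
      exact hs hi (by simp only [F, Finset.mem_sigma, Finset.mem_univ, and_true]; exact hn2)
    rw [le_sub_iff_add_le, ← Finset.sum_union hd]
    exact hr.sum_le_tsum _ fun i _ => hr0 i
  have hb2 : ∀ n, rsq (fun i => star (b n i)) ≤ r n := fun n => by rw [rsq_star]; exact hb n
  have sa := sigma_bound a r ha
  have sb : ∀ s : Finset (Σ n, I n), ‖∑ i ∈ s, star (b i.1 i.2) * b i.1 i.2‖ ≤ ∑ n ∈ s.image Sigma.fst, r n := by
    intro s
    have := sigma_bound (fun n i => star (b n i)) r hb2 s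
    simpa using this
  have hev : ∀ᶠ N in atTop, R * δ N < (ε / 2) ^ 2 := by
    have : Tendsto (fun N => R * δ N) atTop (𝓝 0) := by simpa using hδ.const_mul R
    exact this.eventually_lt_const (by positivity)
  filter_upwards [hev] with N hN
  obtain ⟨J, hJ, c, d, e1, e2, e3⟩ := trick h (fun i : Σ n, I n => a i.1 i.2) (fun i => b i.1 i.2) F hF R δ
    (tsum_nonneg hr0) hδ0 (fun s => (sa s).trans (bR s)) (fun s => (sb s).trans (bR s))
    (fun N s hs => (sa s).trans (bδ N s hs)) (fun N s hs => (sb s).trans (bδ N s hs))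
    (by
      intro ξ
      refine (h0 ξ).congr fun N => ?_
      rw [← hsum, map_sum, ContinuousLinearMap.sum_apply]
      refine Finset.sum_congr rfl fun i _ => ?_
      rw [hP]; rfl) N (ε / 2) (by positivity) hN.le
  refine ⟨J, hJ, c, d, ?_, by linarith, by linarith⟩
  rw [← hsum]; exact e1

lemma approx2 (h : IrrPair π1 π2) (un : ℕ → A ⊗[ℂ] B) (r : ℕ → ℝ) (hr0 : ∀ n, 0 ≤ r n) (hr : Summable r)
    (rep : ∀ n, ∃ (I : Type) (_ : Fintype I) (a : I → A) (b : I → B), un n = ∑ i, a i ⊗ₜ[ℂ] b i ∧ csq a ≤ r n ∧ rsq b ≤ r n)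
    (P : A ⊗[ℂ] B →ₗ[ℂ] (H →L[ℂ] H)) (hP : ∀ a b, P (a ⊗ₜ[ℂ] b) = π1 a * π2 b)
    (h0 : ∀ ξ, Tendsto (fun N => P (∑ n ∈ Finset.range N, un n) ξ) atTop (𝓝 0)) (ε : ℝ) (hε : 0 < ε) :
    ∀ᶠ N in atTop, ∃ (I : Type) (_ : Fintype I) (c : I → A) (d : I → B), ∑ n ∈ Finset.range N, un n = ∑ i, c i ⊗ₜ[ℂ] d i ∧
      csq (fun i => π1 (c i)) ≤ ε ∧ rsq (fun i => π2 (d i)) ≤ ε := by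
  let σ := TensorProduct.comm ℂ A B
  have key := approx1 h.symm (fun n => σ (un n)) r hr0 hr
    (by
      intro n
      obtain ⟨I, hI, a, b, h1, h2, h3⟩ := rep n
      exact ⟨I, hI, b, a, by rw [h1, map_sum]; rfl, h3, h2⟩)
    (P ∘ₗ σ.symm.toLinearMap)
    (by
      intro b a
      show P (σ.symm (b ⊗ₜ a)) = _
      rw [TensorProduct.comm_symm_tmul, hP, h.comm])
    (by
      intro ξ
      refine (h0 ξ).congr fun N => ?_
      show _ = P (σ.symm _) ξ
      rw [← map_sum, LinearEquiv.symm_apply_apply]) ε hε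
  filter_upwards [key] with N hN
  obtain ⟨I, hI, c, d, h1, h2, h3⟩ := hN
  refine ⟨I, hI, d, c, ?_, h3, h2⟩
  apply σ.injective
  rw [map_sum, h1, map_sum]; rfl
end S7d
end PIS
end Part17

section Part18
namespace PIS
open Filter Topology

section S8
variable {A B X : Type u} [NonUnitalCStarAlgebra A] [PartialOrder A] [StarOrderedRing A]
  [NonUnitalCStarAlgebra B] [PartialOrder B] [StarOrderedRing B]
  [NonUnitalNormedRing X] [StarRing X] [NormedSpace ℂ X] [CompleteSpace X]
  [IsScalarTower ℂ X X] [SMulCommClass ℂ X X]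
  {NA : ∀ p : ℕ, Matrix (Fin p) (Fin p) A → ℝ} {NB : ∀ q : ℕ, Matrix (Fin q) (Fin q) B → ℝ}
  {ι : A ⊗[ℂ] B →ₗ[ℂ] X}
  {H : Type u} [NormedAddCommGroup H] [InnerProductSpace ℂ H] [CompleteSpace H]

theorem phi_vanish (hNA : ∀ p, IsCStarNorm (NA p)) (hNB : ∀ q, IsCStarNorm (NB q))
    (hX : IsTensorCompletion (osProjNorm NA NB) X ι)
    (π : X →⋆ₙₐ[ℂ] (H →L[ℂ] H)) (hc : Continuous π)
    {π1 : A →⋆ₙₐ[ℂ] (H →L[ℂ] H)} {π2 : B →⋆ₙₐ[ℂ] (H →L[ℂ] H)} (h : IrrPair π1 π2)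
    (hπ : ∀ a b, π (ι (a ⊗ₜ[ℂ] b)) = π1 a * π2 b)
    (Φ : X →L[ℂ] ℂ) (v1 : ∀ a b, π1 a = 0 → Φ (ι (a ⊗ₜ[ℂ] b)) = 0)
    (v2 : ∀ a b, π2 b = 0 → Φ (ι (a ⊗ₜ[ℂ] b)) = 0)
    (x : X) (hx : π x = 0) : Φ x = 0 := by
  have hmem : x ∈ closure ((ι.toAddMonoidHom.range : AddSubgroup X) : Set X) := by
    have : ((ι.toAddMonoidHom.range : AddSubgroup X) : Set X) = Set.range ι := by
      ext y; simp
    rw [this, hX.dense.closure_range]; trivial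
  obtain ⟨v, hv, hvr, hv0, hvn⟩ := controlled_sum_of_mem_closure hmem (b := fun n => (1/2 : ℝ)^n) (fun n => by positivity)
  have : ∀ n, ∃ t : A ⊗[ℂ] B, ι t = v n := fun n => by
    obtain ⟨t, ht⟩ := hvr n
    exact ⟨t, ht⟩
  choose un hun using this
  set r : ℕ → ℝ := fun n => (‖x‖ + 2) * (1/2)^n with hr
  have hr0 : ∀ n, 0 ≤ r n := fun n => by positivity
  have hrs : Summable r := (summable_geometric_two).mul_left _
  have hlt : ∀ n, osProjNorm NA NB (un n) < r n := by
    intro n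
    rw [← hX.norm_eq, hun]
    rcases Nat.eq_zero_or_pos n with rfl | hn
    · have h1 : ‖v 0‖ ≤ ‖v 0 - x‖ + ‖x‖ := by simpa using norm_add_le (v 0 - x) x
      have h2 : ‖v 0 - x‖ < 1 := by rw [norm_sub_rev]; simpa [sub_eq_neg_add] using hv0
      simp only [hr, pow_zero, mul_one]
      linarith
    · refine (hvn n hn).trans_le ?_
      have : 0 ≤ (1/2 : ℝ)^n := by positivity
      have h3 := norm_nonneg x
      simp only [hr]
      nlinarith
  let P : A ⊗[ℂ] B →ₗ[ℂ] (H →L[ℂ] H) :=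
    { toFun := fun t => π (ι t), map_add' := fun s t => by simp, map_smul' := fun c t => by simp }
  have hs : Tendsto (fun N => ι (∑ n ∈ Finset.range N, un n)) atTop (𝓝 x) := by
    rw [← tendsto_add_atTop_iff_nat 1]
    simpa [map_sum, hun] using hv
  have h0 : ∀ ξ, Tendsto (fun N => P (∑ n ∈ Finset.range N, un n) ξ) atTop (𝓝 0) := by
    intro ξ
    have hcc : Continuous (fun y : X => π y ξ) := (ContinuousLinearMap.apply ℂ H ξ).continuous.comp hc
    have := (hcc.tendsto x).comp hs
    simp only [hx, ContinuousLinearMap.zero_apply] at this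
    exact this
  have a1 := approx1 h un r hr0 hrs (fun n => type1_rep hNA hNB _ _ (hlt n)) P hπ h0
  have a2 := approx2 h un r hr0 hrs (fun n => type2_rep hNA hNB _ _ (hlt n)) P hπ h0
  have hΦ : Tendsto (fun N => ‖Φ (ι (∑ n ∈ Finset.range N, un n))‖) atTop (𝓝 ‖Φ x‖) :=
    ((Φ.continuous.tendsto x).comp hs).norm
  have key : ∀ ε > 0, ‖Φ x‖ ≤ 424 * ‖Φ‖ * (3 * (2 * ε)) := by
    intro ε hε
    refine le_of_tendsto hΦ ?_
    filter_upwards [a1 ε hε, a2 ε hε] with N h1 h2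
    obtain ⟨I, _, a, b, e1, p1, q1⟩ := h1
    obtain ⟨J, _, c, d, e2, p2, q2⟩ := h2
    have := common_rep (norm_nonneg _) (jcb_phiOf hNA hNB hX Φ) π1 π2
      (fun a b hab => by rw [phiOf_apply]; exact v1 a b hab)
      (fun a b hab => by rw [phiOf_apply]; exact v2 a b hab) a b c d (e1.symm.trans e2) ε hε p1 p2 q1 q2
    refine le_trans (le_of_eq (congrArg norm ?_)) this
    rw [e1, map_sum, map_sum]
    rfl
  have hz : Tendsto (fun ε : ℝ => 424 * ‖Φ‖ * (3 * (2 * ε))) (𝓝[>] 0) (𝓝 0) := by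
    have : Continuous (fun ε : ℝ => 424 * ‖Φ‖ * (3 * (2 * ε))) := by fun_prop
    have := (this.tendsto 0).mono_left (nhdsWithin_le_nhds (s := Set.Ioi 0))
    simpa using this
  have : ‖Φ x‖ ≤ 0 := ge_of_tendsto hz (by filter_upwards [self_mem_nhdsWithin] with ε hε using key ε hε)
  exact norm_le_zero_iff.1 this

end S8
end PIS
end Part18

section Part19
namespace PIS
open Filter Topology

section S9
variable {A B X : Type u} [NonUnitalCStarAlgebra A] [PartialOrder A] [StarOrderedRing A]
  [NonUnitalCStarAlgebra B] [PartialOrder B] [StarOrderedRing B]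
  [NonUnitalNormedRing X] [StarRing X] [NormedSpace ℂ X] [CompleteSpace X]
  [IsScalarTower ℂ X X] [SMulCommClass ℂ X X]
  {NA : ∀ p : ℕ, Matrix (Fin p) (Fin p) A → ℝ} {NB : ∀ q : ℕ, Matrix (Fin q) (Fin q) B → ℝ}
  {ι : A ⊗[ℂ] B →ₗ[ℂ] X}
  {H : Type u} [NormedAddCommGroup H] [InnerProductSpace ℂ H] [CompleteSpace H]

lemma ker_unit (π1 : A →⋆ₙₐ[ℂ] (H →L[ℂ] H)) {I : Type} [Fintype I] (a : I → A) (ha : ∀ i, π1 (a i) = 0)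
    (δ : ℝ) (hδ : 0 < δ) : ∃ e, π1 e = 0 ∧ ‖e‖ ≤ 2 ∧ ∀ i, ‖a i - e * a i‖ ≤ δ := by
  obtain ⟨e, he, hk, hn, h2⟩ := lift_elem π1 (∑ i, a i * star (a i)) (Finset.sum_nonneg fun i _ => mul_star_self_nonneg _)
    (δ^2) (by positivity) (by simp [map_sum, ha]; positivity)
  refine ⟨e, hk, ?_, ?_⟩
  · have h3 : ‖e * e‖ ≤ ‖e + e‖ := row_le_of_le (by have := star_mul_self_nonneg e; rwa [he] at this) (sub_nonneg.1 h2)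
    have h4 : ‖e * e‖ = ‖e‖ * ‖e‖ := by have := CStarRing.norm_star_mul_self (x := e); rwa [he] at this
    have h5 : ‖e + e‖ ≤ ‖e‖ + ‖e‖ := norm_add_le _ _
    by_contra! hcon
    nlinarith [norm_nonneg e]
  · intro i
    have h3 : ∑ j, (a j - e * a j) * star (a j - e * a j) =
        (∑ i, a i * star (a i)) - e * (∑ i, a i * star (a i)) - (∑ i, a i * star (a i)) * e + e * (∑ i, a i * star (a i)) * e := by
      simp only [Finset.mul_sum, Finset.sum_mul, ← Finset.sum_sub_distrib, ← Finset.sum_add_distrib]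
      refine Finset.sum_congr rfl fun j _ => ?_
      simp only [star_sub, star_mul, he]
      noncomm_ring
    have h4 : (a i - e * a i) * star (a i - e * a i) ≤ ∑ j, (a j - e * a j) * star (a j - e * a j) :=
      Finset.single_le_sum (f := fun j => (a j - e * a j) * star (a j - e * a j)) (fun j _ => mul_star_self_nonneg _) (Finset.mem_univ i)
    have h5 := row_le_of_le (mul_star_self_nonneg _) h4
    rw [h3, CStarRing.norm_self_mul_star] at h5
    have h6 := h5.trans hn
    rw [← sq] at h6
    exact (sq_le_sq₀ (norm_nonneg _) hδ.le).1 h6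

lemma alg_unit {I : Type} [Fintype I] (b : I → B) (δ : ℝ) (hδ : 0 < δ) :
    ∃ f : B, ‖f‖ ≤ 1 ∧ ∀ i, ‖b i - f * b i‖ ≤ δ := by
  have hl := CStarAlgebra.increasingApproximateUnit B
  haveI := hl.neBot
  have h1 : ∀ᶠ f in CStarAlgebra.approximateUnit B, ∀ i, ‖b i - f * b i‖ ≤ δ := by
    rw [Filter.eventually_all]
    intro i
    have := (hl.tendsto_mul_right (b i))
    have := (Metric.tendsto_nhds.1 this) δ hδ
    filter_upwards [this] with f hf
    rw [norm_sub_rev, ← dist_eq_norm]; exact hf.le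
  obtain ⟨f, h2, h3⟩ := (h1.and hl.eventually_norm).exists
  exact ⟨f, h3, h2⟩

lemma unit_alg (hNA : ∀ p, IsCStarNorm (NA p)) (hNB : ∀ q, IsCStarNorm (NB q))
    (hX : IsTensorCompletion (osProjNorm NA NB) X ι) (π1 : A →⋆ₙₐ[ℂ] (H →L[ℂ] H))
    (t : A ⊗[ℂ] B) (ht : t ∈ Submodule.span ℂ (Set.image2 (fun a b => a ⊗ₜ[ℂ] b) {a : A | π1 a = 0} (Set.univ : Set B)))
    (η : ℝ) (hη : 0 < η) : ∃ e f, π1 e = 0 ∧ ‖e‖ ≤ 2 ∧ ‖f‖ ≤ 1 ∧ ‖ι t - ι (e ⊗ₜ[ℂ] f) * ι t‖ ≤ η := by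
  obtain ⟨n, c, g, rfl⟩ := Submodule.mem_span_set'.1 ht
  have : ∀ i, ∃ a b, π1 a = 0 ∧ a ⊗ₜ[ℂ] b = (g i : A ⊗[ℂ] B) := fun i => by
    obtain ⟨a, ha, b, -, hab⟩ := (g i).2
    exact ⟨a, b, ha, hab⟩
  choose a b ha hab using this
  set M : ℝ := ∑ i, ‖c i‖ * (‖b i‖ + 2 * ‖a i‖) with hM
  have hM0 : 0 ≤ M := Finset.sum_nonneg fun i _ => by positivity
  obtain ⟨e, he, hen, hea⟩ := ker_unit π1 a ha (η / (M + 1)) (by positivity)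
  obtain ⟨f, hfn, hfb⟩ := alg_unit b (η / (M + 1)) (by positivity)
  refine ⟨e, f, he, hen, hfn, ?_⟩
  have h1 : ∀ i, ‖ι (a i ⊗ₜ[ℂ] b i) - ι (e ⊗ₜ[ℂ] f) * ι (a i ⊗ₜ[ℂ] b i)‖ ≤ η / (M + 1) * (‖b i‖ + 2 * ‖a i‖) := by
    intro i
    rw [hX.mul_tmul]
    have h2 : ι (a i ⊗ₜ[ℂ] b i) - ι ((e * a i) ⊗ₜ[ℂ] (f * b i)) =
        ι ((a i - e * a i) ⊗ₜ[ℂ] b i) + ι ((e * a i) ⊗ₜ[ℂ] (b i - f * b i)) := by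
      rw [TensorProduct.sub_tmul, TensorProduct.tmul_sub, map_sub, map_sub]; abel
    rw [h2]
    have h3 := norm_tmul_le hNA hNB hX (a i - e * a i) (b i)
    have h4 := norm_tmul_le hNA hNB hX (e * a i) (b i - f * b i)
    have h5 : ‖e * a i‖ ≤ 2 * ‖a i‖ := (norm_mul_le _ _).trans (by gcongr)
    calc _ ≤ ‖a i - e * a i‖ * ‖b i‖ + ‖e * a i‖ * ‖b i - f * b i‖ := (norm_add_le _ _).trans (add_le_add h3 h4)
      _ ≤ η / (M + 1) * ‖b i‖ + (2 * ‖a i‖) * (η / (M + 1)) := by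
        gcongr
        · exact hea i
        · exact hfb i
      _ = _ := by ring
  have h6 : ι (∑ i, c i • (g i : A ⊗[ℂ] B)) - ι (e ⊗ₜ[ℂ] f) * ι (∑ i, c i • (g i : A ⊗[ℂ] B)) =
      ∑ i, c i • (ι (a i ⊗ₜ[ℂ] b i) - ι (e ⊗ₜ[ℂ] f) * ι (a i ⊗ₜ[ℂ] b i)) := by
    simp only [map_sum, map_smul, ← hab, Finset.mul_sum, mul_smul_comm, smul_sub, Finset.sum_sub_distrib]
  rw [h6]
  calc _ ≤ ∑ i, ‖c i‖ * (η / (M + 1) * (‖b i‖ + 2 * ‖a i‖)) := (norm_sum_le _ _).trans (Finset.sum_le_sum fun i _ => by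
          rw [norm_smul]; gcongr; exact h1 i)
    _ = η / (M + 1) * M := by rw [hM, Finset.mul_sum]; exact Finset.sum_congr rfl fun i _ => by ring
    _ ≤ η := by
      rw [div_mul_eq_mul_div, div_le_iff₀ (by positivity)]; nlinarith

lemma unit_cl (hNA : ∀ p, IsCStarNorm (NA p)) (hNB : ∀ q, IsCStarNorm (NB q))
    (hX : IsTensorCompletion (osProjNorm NA NB) X ι) (π1 : A →⋆ₙₐ[ℂ] (H →L[ℂ] H))
    (z : X) (hz : z ∈ tensorIdeal ι {a : A | π1 a = 0} (Set.univ : Set B))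
    (η : ℝ) (hη : 0 < η) : ∃ e f, π1 e = 0 ∧ ‖ι (e ⊗ₜ[ℂ] f)‖ ≤ 2 ∧ ‖z - ι (e ⊗ₜ[ℂ] f) * z‖ ≤ η := by
  obtain ⟨_, ⟨t, ht, rfl⟩, hd⟩ := Metric.mem_closure_iff.1 hz (η / 6) (by positivity)
  obtain ⟨e, f, he, hen, hfn, h1⟩ := unit_alg hNA hNB hX π1 t ht (η / 2) (by positivity)
  have hg : ‖ι (e ⊗ₜ[ℂ] f)‖ ≤ 2 := (norm_tmul_le hNA hNB hX e f).trans (by nlinarith [norm_nonneg e, norm_nonneg f])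
  refine ⟨e, f, he, hg, ?_⟩
  set g := ι (e ⊗ₜ[ℂ] f)
  rw [dist_eq_norm] at hd
  have h2 : z - g * z = (z - ι t) + (ι t - g * ι t) - g * (z - ι t) := by rw [mul_sub]; abel
  have h3 : ‖g * (z - ι t)‖ ≤ 2 * ‖z - ι t‖ := (norm_mul_le _ _).trans (by gcongr)
  rw [h2]
  have h4 := norm_sub_le ((z - ι t) + (ι t - g * ι t)) (g * (z - ι t))
  have h5 := norm_add_le (z - ι t) (ι t - g * ι t)
  linarith

/-- the tensor ideal as a closed submodule -/
def TI (ι : A ⊗[ℂ] B →ₗ[ℂ] X) (S : Set A) (T : Set B) : Submodule ℂ X :=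
  ((Submodule.span ℂ (Set.image2 (fun a b => a ⊗ₜ[ℂ] b) S T)).map ι).topologicalClosure

lemma coe_TI (S : Set A) (T : Set B) : (TI ι S T : Set X) = tensorIdeal ι S T := by
  rw [TI, Submodule.topologicalClosure_coe, Submodule.map_coe]; rfl

lemma TI_closed (S : Set A) (T : Set B) : IsClosed (TI ι S T : Set X) := Submodule.isClosed_topologicalClosure _

lemma tmul_mem_TI (S : Set A) (T : Set B) {a : A} {b : B} (ha : a ∈ S) (hb : b ∈ T) : ι (a ⊗ₜ[ℂ] b) ∈ TI ι S T :=
  Submodule.le_topologicalClosure _ (Submodule.mem_map_of_mem (Submodule.subset_span ⟨a, ha, b, hb, rfl⟩))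

lemma TI_induction (S : Set A) (T : Set B) (L : Submodule ℂ X) (hL : IsClosed (L : Set X))
    (h : ∀ a ∈ S, ∀ b ∈ T, ι (a ⊗ₜ[ℂ] b) ∈ L) : TI ι S T ≤ L := by
  refine Submodule.topologicalClosure_minimal _ ?_ hL
  rw [Submodule.map_le_iff_le_comap, Submodule.span_le]
  rintro _ ⟨a, ha, b, hb, rfl⟩
  exact h a ha b hb

lemma TI_univ (hX : IsTensorCompletion (osProjNorm NA NB) X ι) (x : X) : x ∈ TI ι (Set.univ : Set A) (Set.univ : Set B) := by
  have : closure (Set.range ι) ⊆ (TI ι (Set.univ : Set A) (Set.univ : Set B) : Set X) := by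
    refine closure_minimal ?_ (TI_closed _ _)
    rintro _ ⟨t, rfl⟩
    induction t with
    | zero => simp
    | tmul a b => exact tmul_mem_TI _ _ trivial trivial
    | add x y hx hy => rw [map_add]; exact Submodule.add_mem _ hx hy
  exact this (by rw [hX.dense.closure_range]; trivial)

/-- left multiplication -/
def Lm (g : X) : X →L[ℂ] X :=
  ⟨{ toFun := fun x => g * x, map_add' := mul_add g, map_smul' := fun c x => mul_smul_comm c g x }, continuous_const.mul continuous_id⟩

lemma mul_mem_TI {S S' : Set A} {T T' : Set B} (hX : IsTensorCompletion (osProjNorm NA NB) X ι) (e : A) (f : B)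
    (hS : ∀ a ∈ S, e * a ∈ S') (hT : ∀ b ∈ T, f * b ∈ T') {x : X} (hx : x ∈ TI ι S T) : ι (e ⊗ₜ[ℂ] f) * x ∈ TI ι S' T' := by
  have : TI ι S T ≤ (TI ι S' T').comap (Lm (ι (e ⊗ₜ[ℂ] f))).toLinearMap := by
    refine TI_induction S T _ ((TI_closed S' T').preimage (Lm (ι (e ⊗ₜ[ℂ] f))).continuous) ?_
    intro a ha b hb
    change ι (e ⊗ₜ[ℂ] f) * ι (a ⊗ₜ[ℂ] b) ∈ TI ι S' T'
    rw [hX.mul_tmul]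
    exact tmul_mem_TI _ _ (hS a ha) (hT b hb)
  exact this hx

theorem sum_closed (hNA : ∀ p, IsCStarNorm (NA p)) (hNB : ∀ q, IsCStarNorm (NB q))
    (hX : IsTensorCompletion (osProjNorm NA NB) X ι) (π1 : A →⋆ₙₐ[ℂ] (H →L[ℂ] H)) (π2 : B →⋆ₙₐ[ℂ] (H →L[ℂ] H)) :
    IsClosed ((TI ι (Set.univ : Set A) {b : B | π2 b = 0} ⊔ TI ι {a : A | π1 a = 0} (Set.univ : Set B) : Submodule ℂ X) : Set X) := by
  set L1 := TI ι (Set.univ : Set A) {b : B | π2 b = 0} with hL1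
  set L2 := TI ι {a : A | π1 a = 0} (Set.univ : Set B) with hL2
  haveI : CompleteSpace L1 := (TI_closed _ _).completeSpace_coe
  haveI : CompleteSpace L2 := (TI_closed _ _).completeSpace_coe
  let f : NormedAddGroupHom (L1 × L2) X :=
    { toFun := fun p => (p.1 : X) + (p.2 : X)
      map_add' := fun p q => by
        simp only [Prod.fst_add, Prod.snd_add, Submodule.coe_add]; abel
      bound' := ⟨2, fun p => by
        have h1 : ‖(p.1 : X)‖ ≤ ‖p‖ := _root_.norm_fst_le p
        have h2 : ‖(p.2 : X)‖ ≤ ‖p‖ := _root_.norm_snd_le p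
        have := norm_add_le (p.1 : X) (p.2 : X)
        linarith⟩ }
  have hyp : f.SurjectiveOnWith (L1 ⊔ L2).toAddSubgroup 4 := by
    intro w hw
    by_cases hw0 : w = 0
    · exact ⟨0, by simp [hw0], by simp [hw0]⟩
    obtain ⟨y, hy, z, hz, hyz⟩ := Submodule.mem_sup.1 (show w ∈ L1 ⊔ L2 from hw)
    obtain ⟨e, f', he, hg, hn⟩ := unit_cl hNA hNB hX π1 z (by rw [← coe_TI]; exact hz) ‖w‖ (norm_pos_iff.2 hw0)
    set g := ι (e ⊗ₜ[ℂ] f') with hgdef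
    have m1 : y - g * y ∈ L1 := L1.sub_mem hy (mul_mem_TI hX e f' (fun _ _ => Set.mem_univ _) (fun b hb => by
      simp only [Set.mem_setOf_eq, map_mul] at *; rw [hb, mul_zero]) hy)
    have mg : ∀ x, g * x ∈ L2 := fun x => mul_mem_TI hX e f' (fun a _ => by
      simp only [Set.mem_setOf_eq, map_mul] at *; rw [he, zero_mul]) (fun _ _ => Set.mem_univ _) (TI_univ hX x)
    have m2 : g * w + (z - g * z) ∈ L2 := L2.add_mem (mg w) (L2.sub_mem hz (mg z))
    have hgw : ‖g * w‖ ≤ 2 * ‖w‖ := (norm_mul_le _ _).trans (by gcongr)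
    have hsum : (y - g * y) + (g * w + (z - g * z)) = w := by
      rw [← hyz, mul_add]; abel
    refine ⟨(⟨_, m1⟩, ⟨_, m2⟩), hsum, ?_⟩
    rw [Prod.norm_def]
    refine max_le ?_ ?_
    · change ‖y - g * y‖ ≤ 4 * ‖w‖
      have : y - g * y = w - g * w - (z - g * z) := by rw [← hyz, mul_add]; abel
      rw [this]
      have h1 := norm_sub_le (w - g * w) (z - g * z)
      have h2 := norm_sub_le w (g * w)
      linarith
    · change ‖g * w + (z - g * z)‖ ≤ 4 * ‖w‖
      have h1 := norm_add_le (g * w) (z - g * z)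
      have := norm_nonneg w
      linarith
  have hcl := controlled_closure_of_complete (by norm_num) (one_pos) hyp
  rw [← closure_subset_iff_isClosed]
  intro w hw
  obtain ⟨p, hp, -⟩ := hcl w hw
  rw [← hp]
  exact Submodule.add_mem_sup p.1.2 p.2.2

end S9
end PIS
end Part19

section Part20
namespace PIS
open Filter Topology

section S10
lemma exists_functional {X : Type*} [NormedAddCommGroup X] [NormedSpace ℂ X] (S : Submodule ℂ X)
    (hS : IsClosed (S : Set X)) (x : X) (hx : x ∉ S) : ∃ Φ : X →L[ℂ] ℂ, (∀ y ∈ S, Φ y = 0) ∧ Φ x ≠ 0 := by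
  haveI : IsClosed (S : Set X) := hS
  have hne : S.mkQ x ≠ 0 := by
    rw [Submodule.mkQ_apply, Ne, Submodule.Quotient.mk_eq_zero]; exact hx
  obtain ⟨f, hf⟩ := SeparatingDual.exists_ne_zero (R := ℂ) hne
  refine ⟨f.comp S.mkQL, ?_, hf⟩
  intro y hy
  have : S.mkQL y = 0 := (Submodule.Quotient.mk_eq_zero S).2 hy
  rw [ContinuousLinearMap.comp_apply, this, map_zero]

variable {A B X : Type u} [NonUnitalCStarAlgebra A] [PartialOrder A] [StarOrderedRing A]
  [NonUnitalCStarAlgebra B] [PartialOrder B] [StarOrderedRing B]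
  [NonUnitalNormedRing X] [StarRing X] [NormedSpace ℂ X] [CompleteSpace X]
  [IsScalarTower ℂ X X] [SMulCommClass ℂ X X]
  {NA : ∀ p : ℕ, Matrix (Fin p) (Fin p) A → ℝ} {NB : ∀ q : ℕ, Matrix (Fin q) (Fin q) B → ℝ}
  {ι : A ⊗[ℂ] B →ₗ[ℂ] X}
  {H : Type u} [NormedAddCommGroup H] [InnerProductSpace ℂ H] [CompleteSpace H]

theorem ker_eq (hNA : ∀ p, IsCStarNorm (NA p)) (hNB : ∀ q, IsCStarNorm (NB q))
    (hX : IsTensorCompletion (osProjNorm NA NB) X ι)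
    (π : X →⋆ₙₐ[ℂ] (H →L[ℂ] H)) (hc : Continuous π) (hnz : ∃ y, π y ≠ 0)
    (hirr : ∀ S : Submodule ℂ H, IsClosed (S : Set H) → (∀ y : X, ∀ v ∈ S, π y v ∈ S) → S = ⊥ ∨ S = ⊤) :
    ∃ (E : TwoSidedIdeal A) (F : TwoSidedIdeal B),
      IsClosedPrimeIdeal E ∧ IsClosedPrimeIdeal F ∧
      {x : X | π x = 0} =
        tensorIdeal ι (Set.univ : Set A) (F : Set B) +
          tensorIdeal ι (E : Set A) (Set.univ : Set B) := by
  obtain ⟨π1, π2, hπ, hcomm⟩ := exists_factors hNA hNB hX π hc hnz hirr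
  have h : IrrPair π1 π2 := by
    refine ⟨hcomm, ?_, ?_⟩
    · intro S hS hv
      exact irr_tmul hX π hc hirr S hS fun a b v hvS => by rw [hπ]; exact hv a b v hvS
    · by_contra! hcon
      obtain ⟨y, hy⟩ := hnz
      apply hy
      ext v
      have := mem_of_tmul hX π hc ⊥ (by simp) v (fun a b => by rw [hπ, hcon]; simp) y
      simpa using this
  refine ⟨TwoSidedIdeal.ker π1, TwoSidedIdeal.ker π2, h.prime, h.symm.prime, ?_⟩
  have hE : ((TwoSidedIdeal.ker π1 : TwoSidedIdeal A) : Set A) = {a : A | π1 a = 0} := by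
    ext a; simp [TwoSidedIdeal.mem_ker]
  have hF : ((TwoSidedIdeal.ker π2 : TwoSidedIdeal B) : Set B) = {b : B | π2 b = 0} := by
    ext a; simp [TwoSidedIdeal.mem_ker]
  rw [hE, hF, ← coe_TI, ← coe_TI, ← Submodule.coe_sup]
  have hcl := sum_closed hNA hNB hX π1 π2
  let P : X →L[ℂ] (H →L[ℂ] H) := ⟨{ toFun := π, map_add' := map_add π, map_smul' := fun c x => map_smul π c x }, hc⟩
  have hPk : ∀ x, x ∈ LinearMap.ker P.toLinearMap ↔ π x = 0 := fun x => Iff.rfl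
  have hPc : IsClosed (LinearMap.ker P.toLinearMap : Set X) := isClosed_singleton.preimage P.continuous
  apply Set.Subset.antisymm
  · intro x hx
    by_contra hxS
    obtain ⟨Φ, hΦ, hne⟩ := exists_functional _ hcl x hxS
    refine hne (phi_vanish hNA hNB hX π hc h hπ Φ ?_ ?_ x hx)
    · intro a b ha
      exact hΦ _ (Submodule.mem_sup_right (tmul_mem_TI _ _ ha (Set.mem_univ _)))
    · intro a b hb
      exact hΦ _ (Submodule.mem_sup_left (tmul_mem_TI _ _ (Set.mem_univ _) hb))
  · have : TI ι (Set.univ : Set A) {b : B | π2 b = 0} ⊔ TI ι {a : A | π1 a = 0} (Set.univ : Set B) ≤ LinearMap.ker P.toLinearMap := by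
      refine sup_le (TI_induction _ _ _ hPc ?_) (TI_induction _ _ _ hPc ?_)
      · intro a _ b hb
        rw [hPk, hπ, hb, mul_zero]
      · intro a ha b _
        rw [hPk, hπ, ha, zero_mul]
    intro x hx
    exact this hx

end S10
end PIS
end Part20

/-- If `K` is a primitive ideal of the Banach `*`-algebra `A ⊗̂ B`, then
`K = A ⊗̂ F + E ⊗̂ B` for some prime closed ideals `E` of `A` and `F` of `B`. -/
theorem primitive_ideal_structure {A B X : Type u} [NonUnitalCStarAlgebra A] [NonUnitalCStarAlgebra B]
    [NonUnitalNormedRing X] [StarRing X] [NormedSpace ℂ X] [CompleteSpace X]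
    [IsScalarTower ℂ X X] [SMulCommClass ℂ X X]
    (NA : ∀ p : ℕ, Matrix (Fin p) (Fin p) A → ℝ)
    (NB : ∀ q : ℕ, Matrix (Fin q) (Fin q) B → ℝ)
    (hNA : ∀ p, IsCStarNorm (NA p)) (hNB : ∀ q, IsCStarNorm (NB q))
    (ι : A ⊗[ℂ] B →ₗ[ℂ] X) (hX : IsTensorCompletion (osProjNorm NA NB) X ι)
    (K : TwoSidedIdeal X) (hK : IsPrimitiveIdeal K) :
    ∃ (E : TwoSidedIdeal A) (F : TwoSidedIdeal B),
      IsClosedPrimeIdeal E ∧ IsClosedPrimeIdeal F ∧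
      (K : Set X) =
        tensorIdeal ι (Set.univ : Set A) (F : Set B) +
          tensorIdeal ι (E : Set A) (Set.univ : Set B) := by
  obtain ⟨ρ, hρ⟩ := hK
  letI := ρ.normH
  letI := ρ.ipsH
  haveI := ρ.csH
  letI := CStarAlgebra.spectralOrder A
  letI := CStarAlgebra.spectralOrderedRing A
  letI := CStarAlgebra.spectralOrder B
  letI := CStarAlgebra.spectralOrderedRing B
  have hKs : (K : Set X) = {x : X | ρ.π x = 0} := by
    ext x; exact hρ x
  rw [hKs]
  exact PIS.ker_eq hNA hNB hX ρ.π ρ.continuous ρ.nonzero ρ.irreducible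

end
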